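/- Let n ≥ 1 be an integer, set β = n + 1/2, and let (P_n), C, L_s, γ_m, δ_m, a_r, B_r be as in the context. Then for every fixed real t < 0, lim_{N→∞} P_N(t) / Q_N(t) = 1, where Q_N(t) := (−1)^N (2π)^{−1/2} (−t C N^{1/β})^{−1/4} · exp( ((−1)^n (−t)^β/(2π)) ln( 4 C N^{1/β}/(−t) ) ) · exp( (N^{1−1/(2β)}/√(πC)) ∑_{r=0}^{n} (−1)^r B_r (−t)^{r+1/2} (C N^{1/β})^{−r} ). -/

import Mathlib

open MeasureTheory Real Filter Topology Polynomial

/-- `C(β) = 4 (Γ(β)²/Γ(2β))^{1/β}`. -/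
noncomputable def Ccoef (β : ℝ) : ℝ :=
  4 * (Real.Gamma β ^ 2 / Real.Gamma (2 * β)) ^ (1 / β)

/-- `L_s = s · 4^s · Γ(s)² / (2π Γ(2s))`. -/
noncomputable def Lcoef (s : ℝ) : ℝ :=
  s * (4:ℝ) ^ s * Real.Gamma s ^ 2 / (2 * π * Real.Gamma (2 * s))

/-- `γ_m = Γ(m−1/2)/Γ(m+1)` for `m ≥ 0` and `0` for `m < 0`. -/
noncomputable def gammaCoef (m : ℤ) : ℝ :=
  if 0 ≤ m then Real.Gamma ((m : ℝ) - 1/2) / Real.Gamma ((m : ℝ) + 1) else 0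

/-- `δ_m = ∑_{s=1}^n γ_{s−m} / L_{s−1/2}`. -/
noncomputable def deltaCoef (n : ℕ) (m : ℤ) : ℝ :=
  ∑ s ∈ Finset.Icc 1 n, gammaCoef ((s : ℤ) - m) / Lcoef ((s : ℝ) - 1/2)

/-- `a_r = Γ(r+1/2)/((r+1/2) Γ(r+1))`. -/
noncomputable def aCoef (r : ℕ) : ℝ :=
  Real.Gamma ((r : ℝ) + 1/2) / (((r : ℝ) + 1/2) * Real.Gamma ((r : ℝ) + 1))

/-- `B_r = a_r − (L_β/(2β)) δ_{n−r}` for `β = n + 1/2`. -/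
noncomputable def BCoef (n : ℕ) (β : ℝ) (r : ℕ) : ℝ :=
  aCoef r - (Lcoef β / (2 * β)) * deltaCoef n ((n : ℤ) - (r : ℤ))

noncomputable def bt (n : ℕ) : ℝ := n + 1 / 2

noncomputable def cc (n : ℕ) : ℕ → ℝ
  | 0 => 1
  | k + 1 => cc n k * ((bt n - k) / (bt n + k + 1))

lemma bt_pos (n : ℕ) : 0 < bt n := by unfold bt; positivity

lemma bt_ge {n : ℕ} (hn : 1 ≤ n) : 3 / 2 ≤ bt n := by
  have : (1 : ℝ) ≤ n := by exact_mod_cast hn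
  unfold bt; linarith

lemma cc_rec (n k : ℕ) : (bt n + k + 1) * cc n (k + 1) = (bt n - k) * cc n k := by
  have : bt n + k + 1 ≠ 0 := by have := bt_pos n; positivity
  simp only [cc]; field_simp

lemma cc_aux {n : ℕ} (hn : 1 ≤ n) (j : ℕ) :
    |cc n (n + 1 + j)| * (((n + 1 + j : ℕ) - 3 / 2 : ℝ) * ((n + 1 + j : ℕ) - 1 / 2) *
      ((n + 1 + j : ℕ) + 1 / 2) * ((n + 1 + j : ℕ) + 3 / 2)) ≤
    |cc n (n + 1)| * (((n + 1 : ℕ) - 3 / 2 : ℝ) * ((n + 1 : ℕ) - 1 / 2) *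
      ((n + 1 : ℕ) + 1 / 2) * ((n + 1 : ℕ) + 3 / 2)) := by
  induction j with
  | zero => simp
  | succ j ih =>
    refine le_trans ?_ ih
    have hb := bt_ge hn
    have hn' : (1 : ℝ) ≤ n := by exact_mod_cast hn
    set k : ℝ := ((n + 1 + j : ℕ) : ℝ) with hk
    have hkn : bt n + 1 / 2 ≤ k := by rw [hk]; unfold bt; push_cast; linarith [(Nat.cast_nonneg j : (0:ℝ) ≤ j)]
    have hO : |cc n (n + 1 + (j + 1))| = |cc n (n + 1 + j)| * ((k - bt n) / (bt n + k + 1)) := by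
      rw [← add_assoc]; simp only [cc]
      rw [← hk, abs_mul, abs_div, abs_of_nonpos (by linarith : bt n - k ≤ 0), abs_of_pos (by linarith : 0 < bt n + k + 1)]; ring
    have hQ : ((n + 1 + (j + 1) : ℕ) : ℝ) = k + 1 := by rw [hk]; push_cast; ring
    rw [hO, hQ, mul_assoc]
    refine mul_le_mul_of_nonneg_left ?_ (abs_nonneg _)
    have eA : (k - bt n) / (bt n + k + 1) ≤ (k - 3 / 2) / (k + 5 / 2) := by
      rw [div_le_div_iff₀ (by linarith) (by linarith)]; nlinarith
    calc (k - bt n) / (bt n + k + 1) * ((k + 1 - 3 / 2) * (k + 1 - 1 / 2) * (k + 1 + 1 / 2) * (k + 1 + 3 / 2))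
        ≤ (k - 3 / 2) / (k + 5 / 2) * ((k + 1 - 3 / 2) * (k + 1 - 1 / 2) * (k + 1 + 1 / 2) * (k + 1 + 3 / 2)) := by
          refine mul_le_mul_of_nonneg_right eA ?_
          have : 0 ≤ k + 1 - 3 / 2 := by linarith
          have : 0 ≤ k + 1 - 1 / 2 := by linarith
          have : 0 ≤ k := by linarith
          positivity
      _ = _ := by
          have : k + 5 / 2 ≠ 0 := by linarith
          rw [div_mul_eq_mul_div, div_eq_iff this]; ring

lemma cc_bound {n : ℕ} (hn : 1 ≤ n) : ∃ D : ℝ, ∀ k, |cc n k| ≤ D / ((k : ℝ) + 1) ^ 4 := by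
  set D0 := |cc n (n + 1)| * (((n + 1 : ℕ) - 3 / 2 : ℝ) * ((n + 1 : ℕ) - 1 / 2) *
      ((n + 1 : ℕ) + 1 / 2) * ((n + 1 : ℕ) + 3 / 2)) with hD0
  have hn' : (1 : ℝ) ≤ n := by exact_mod_cast hn
  refine ⟨16 * D0 + ∑ k ∈ Finset.range (n + 1), |cc n k| * ((k : ℝ) + 1) ^ 4, fun k => ?_⟩
  rw [le_div_iff₀ (by positivity)]
  have hS : 0 ≤ ∑ k ∈ Finset.range (n + 1), |cc n k| * ((k : ℝ) + 1) ^ 4 := by positivity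
  have hD : 0 ≤ D0 := by
    rw [hD0]; push_cast
    have : (0:ℝ) ≤ (n : ℝ) + 1 - 3 / 2 := by linarith
    have : (0:ℝ) ≤ (n : ℝ) + 1 - 1 / 2 := by linarith
    positivity
  by_cases hk : k < n + 1
  · have := Finset.single_le_sum (f := fun k => |cc n k| * ((k : ℝ) + 1) ^ 4)
      (fun i _ => by positivity) (Finset.mem_range.mpr hk)
    linarith
  · obtain ⟨j, rfl⟩ := Nat.exists_eq_add_of_le (not_lt.mp hk)
    have h := cc_aux hn j
    rw [← hD0] at h
    set x : ℝ := ((n + 1 + j : ℕ) : ℝ) with hx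
    have hx2 : 2 ≤ x := by rw [hx]; push_cast; linarith [(Nat.cast_nonneg j : (0:ℝ) ≤ j)]
    clear_value x
    have eH : (x + 1) ^ 4 ≤ 16 * ((x - 3 / 2) * (x - 1 / 2) * (x + 1 / 2) * (x + 3 / 2)) := by
      obtain ⟨y, rfl⟩ : ∃ y, x = y + 2 := ⟨x - 2, by ring⟩
      have hy : 0 ≤ y := by linarith
      have : 0 ≤ y ^ 2 := by positivity
      have : 0 ≤ y ^ 3 := by positivity
      have : 0 ≤ y ^ 4 := by positivity
      nlinarith
    nlinarith [mul_le_mul_of_nonneg_left eH (abs_nonneg (cc n (n + 1 + j)))]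

lemma cc_summable {n : ℕ} (hn : 1 ≤ n) (j : ℕ) (hj : j ≤ 2) :
    Summable fun k : ℕ => (k : ℝ) ^ j * |cc n k| := by
  obtain ⟨D, hD⟩ := cc_bound hn
  have hs : Summable fun k : ℕ => D * (1 / ((k : ℝ) + 1) ^ 2) := by
    have := (summable_nat_add_iff 1).mpr (summable_one_div_nat_pow.mpr (one_lt_two))
    exact (by simpa using this : Summable fun k : ℕ => 1 / ((k : ℝ) + 1) ^ 2).mul_left D
  refine Summable.of_nonneg_of_le (fun k => by positivity) (fun k => ?_) hs
  have hO : (k : ℝ) ^ j ≤ ((k : ℝ) + 1) ^ 2 := by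
    calc (k : ℝ) ^ j ≤ ((k : ℝ) + 1) ^ j := by gcongr; linarith
      _ ≤ _ := pow_le_pow_right₀ (by linarith [(Nat.cast_nonneg k : (0:ℝ) ≤ k)]) hj
  calc (k : ℝ) ^ j * |cc n k| ≤ ((k : ℝ) + 1) ^ 2 * (D / ((k : ℝ) + 1) ^ 4) := by
        gcongr; exact hD k
    _ = _ := by field_simp

noncomputable def FF (n j : ℕ) (z : ℂ) : ℂ := ∑' k : ℕ, (k : ℂ) ^ j * (cc n k : ℂ) * z ^ k

noncomputable def AA (n : ℕ) : ℝ := ∑' k : ℕ, (k : ℝ) ^ 2 * |cc n k|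

lemma AA_nonneg (n : ℕ) : 0 ≤ AA n := tsum_nonneg fun k => by positivity

lemma FF_term_le (n j k : ℕ) {z : ℂ} (hz : ‖z‖ ≤ 1) :
    ‖(k : ℂ) ^ j * (cc n k : ℂ) * z ^ k‖ ≤ (k : ℝ) ^ j * |cc n k| := by
  rw [norm_mul, norm_mul, norm_pow, norm_pow, Complex.norm_natCast, Complex.norm_real, norm_eq_abs]
  exact mul_le_of_le_one_right (by positivity) (pow_le_one₀ (norm_nonneg _) hz)

lemma FF_summable {n : ℕ} (hn : 1 ≤ n) (j : ℕ) (hj : j ≤ 2) {z : ℂ} (hz : ‖z‖ ≤ 1) :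
    Summable fun k : ℕ => (k : ℂ) ^ j * (cc n k : ℂ) * z ^ k :=
  Summable.of_norm_bounded (cc_summable hn j hj) fun k => FF_term_le n j k hz

lemma FF_hasSum {n : ℕ} (hn : 1 ≤ n) (j : ℕ) (hj : j ≤ 2) {z : ℂ} (hz : ‖z‖ ≤ 1) :
    HasSum (fun k : ℕ => (k : ℂ) ^ j * (cc n k : ℂ) * z ^ k) (FF n j z) :=
  (FF_summable hn j hj hz).hasSum

lemma FF_continuousOn {n : ℕ} (hn : 1 ≤ n) (j : ℕ) (hj : j ≤ 2) :
    ContinuousOn (FF n j) (Metric.closedBall 0 1) :=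
  continuousOn_tsum (fun k => by fun_prop) (cc_summable hn j hj)
    fun k z hz => FF_term_le n j k (by simpa using hz)

lemma FF2_norm_le {n : ℕ} (hn : 1 ≤ n) {z : ℂ} (hz : ‖z‖ ≤ 1) : ‖FF n 2 z‖ ≤ AA n :=
  tsum_of_norm_bounded (cc_summable hn 2 le_rfl).hasSum fun k => FF_term_le n 2 k hz

lemma FF_conj (n j : ℕ) (z : ℂ) : FF n j ((starRingEnd ℂ) z) = (starRingEnd ℂ) (FF n j z) := by
  unfold FF; rw [Complex.conj_tsum]; simp

lemma FF_identity {n : ℕ} (hn : 1 ≤ n) {z : ℂ} (hz : ‖z‖ ≤ 1) :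
    (1 + z) * FF n 1 z = (bt n) * (z - 1) * FF n 0 z + bt n := by
  have eC := FF_hasSum hn 0 (by norm_num) hz
  have hO := FF_hasSum hn 1 (by norm_num) hz
  have eR := (hasSum_nat_add_iff' 1).mpr eC
  have eF := (hasSum_nat_add_iff' 1).mpr hO
  simp only [Finset.range_one, Finset.sum_singleton] at eR eF
  have key := ((eF.add (hO.mul_left z)).sub ((eC.mul_left (z * bt n)).sub (eR.mul_left (bt n : ℂ))))
  have hz0 : ∀ k : ℕ, (((k + 1 : ℕ) : ℂ) ^ 1 * (cc n (k + 1) : ℂ) * z ^ (k + 1) + z * ((k : ℂ) ^ 1 * (cc n k : ℂ) * z ^ k)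
      - (z * bt n * ((k : ℂ) ^ 0 * (cc n k : ℂ) * z ^ k) - bt n * (((k + 1 : ℕ) : ℂ) ^ 0 * (cc n (k + 1) : ℂ) * z ^ (k + 1)))) = 0 := by
    intro k
    have := congrArg (fun x : ℝ => (x : ℂ)) (cc_rec n k)
    push_cast at this ⊢
    linear_combination z ^ (k + 1) * this
  have h := key.unique ((hasSum_zero).congr_fun hz0)
  simp [cc] at h
  linear_combination h

lemma norm_exp_I (θ : ℝ) : ‖Complex.exp (θ * Complex.I)‖ ≤ 1 := by
  rw [Complex.norm_exp_ofReal_mul_I]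

lemma FF_hasDerivAt_circle {n : ℕ} (hn : 1 ≤ n) (j : ℕ) (hj : j ≤ 1) (θ : ℝ) :
    HasDerivAt (fun θ : ℝ => FF n j (Complex.exp (θ * Complex.I)))
      (Complex.I * FF n (j + 1) (Complex.exp (θ * Complex.I))) θ := by
  have h := hasDerivAt_tsum (𝕜 := ℝ) (u := fun k : ℕ => (k : ℝ) ^ (j + 1) * |cc n k|)
    (g := fun (k : ℕ) (θ : ℝ) => (k : ℂ) ^ j * (cc n k : ℂ) * (Complex.exp (θ * Complex.I)) ^ k)
    (g' := fun (k : ℕ) (θ : ℝ) => Complex.I * ((k : ℂ) ^ (j + 1) * (cc n k : ℂ) * (Complex.exp (θ * Complex.I)) ^ k))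
    (y₀ := 0) (cc_summable hn (j + 1) (by omega)) ?_ ?_ (FF_summable hn j (by omega) (norm_exp_I 0)) θ
  · rw [tsum_mul_left] at h; exact h
  · intro k θ
    have hO : HasDerivAt (fun θ : ℝ => Complex.exp (k * (θ * Complex.I))) (Complex.exp (k * (θ * Complex.I)) * (k * (1 * Complex.I))) θ :=
      (((Complex.ofRealCLM.hasDerivAt (x := θ)).mul_const Complex.I).const_mul (k : ℂ)).cexp
    simp_rw [← Complex.exp_nat_mul]
    exact (hO.const_mul ((k : ℂ) ^ j * (cc n k : ℂ))).congr_deriv (by ring)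
  · intro k θ
    rw [norm_mul, Complex.norm_I, one_mul]
    exact FF_term_le n (j + 1) k (norm_exp_I θ)

noncomputable def eI (θ : ℝ) : ℂ := Complex.exp (θ * Complex.I)

lemma eI_norm (θ : ℝ) : ‖eI θ‖ = 1 := Complex.norm_exp_ofReal_mul_I θ

lemma eI_cont : Continuous eI := by unfold eI; fun_prop

lemma eI_conj (θ : ℝ) : (starRingEnd ℂ) (eI θ) = eI (-θ) := by
  unfold eI; rw [← Complex.exp_conj]; simp

lemma eI_mul_neg (θ : ℝ) : eI θ * eI (-θ) = 1 := by
  unfold eI; rw [← Complex.exp_add]; simp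

lemma eI_ne (θ : ℝ) : eI θ ≠ 0 := Complex.exp_ne_zero _

lemma eI_two_pi_sub (θ : ℝ) : eI (2 * π - θ) = eI (-θ) := by
  unfold eI
  rw [show ((2 * π - θ : ℝ) : ℂ) * Complex.I = ((-θ : ℝ) : ℂ) * Complex.I + 2 * π * Complex.I by push_cast; ring]
  exact Complex.exp_periodic _

lemma one_sub_ne {ζ : ℝ} (h : |ζ| < 1) (θ : ℝ) : (1 : ℂ) - ζ * eI θ ≠ 0 := by
  intro eC
  have : ‖(ζ : ℂ) * eI θ‖ = 1 := by rw [← sub_eq_zero.mp eC]; simp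
  rw [norm_mul, eI_norm, Complex.norm_real, mul_one, norm_eq_abs] at this
  linarith

lemma half_cauchy {g : ℂ → ℂ} (hg : DiffContOnCl ℂ g (Metric.ball 0 1))
    (hc : ∀ z, ‖z‖ = 1 → g ((starRingEnd ℂ) z) = (starRingEnd ℂ) (g z)) {ζ : ℝ} (hζ : |ζ| < 1) :
    g ζ = ((1 / π * ∫ θ in (0:ℝ)..π, (g (eI θ) * (1 - ζ * eI (-θ))⁻¹).re : ℝ) : ℂ) := by
  have hO := hg.circleIntegral_sub_inv_smul (w := (ζ : ℂ)) (by simpa using hζ)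
  set h : ℝ → ℂ := fun θ => g (eI θ) * (1 - ζ * eI (-θ))⁻¹ with hh
  have hcont : Continuous h := by
    have hQ : Continuous fun θ => g (eI θ) := by
      have := hg.continuousOn
      rw [closure_ball _ one_ne_zero] at this
      exact this.comp_continuous eI_cont (fun θ => by simp [eI_norm])
    exact hQ.mul (Continuous.inv₀ (by have := eI_cont; fun_prop) fun θ => one_sub_ne hζ _)
  have hcm : ∀ θ, circleMap 0 1 θ = eI θ := fun θ => by simp [circleMap, eI]
  have eA : (∮ z in C(0, 1), (z - (ζ:ℂ))⁻¹ • g z) = Complex.I * ∫ θ in (0:ℝ)..(2 * π), h θ := by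
    rw [circleIntegral, ← intervalIntegral.integral_const_mul]
    congr 1; ext θ
    have hne : eI θ - ζ ≠ 0 := by
      have := mul_ne_zero (eI_ne θ) (one_sub_ne hζ (-θ))
      rwa [mul_sub, mul_one, mul_left_comm, eI_mul_neg, mul_one] at this
    have e : (1 - (ζ:ℂ) * eI (-θ))⁻¹ = eI θ * (eI θ - ζ)⁻¹ := by
      rw [eq_mul_inv_iff_mul_eq₀ hne, inv_mul_eq_iff_eq_mul₀ (one_sub_ne hζ _), sub_mul, one_mul,
        mul_assoc, mul_comm (eI (-θ)), eI_mul_neg, mul_one]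
    simp only [deriv_circleMap, hcm, smul_eq_mul, hh, e]; ring
  have eH : ∫ θ in (0:ℝ)..(2 * π), h θ = 2 * ((∫ θ in (0:ℝ)..π, (h θ).re : ℝ) : ℂ) := by
    rw [← intervalIntegral.integral_add_adjacent_intervals (b := π) (hcont.intervalIntegrable _ _) (hcont.intervalIntegrable _ _)]
    have eO : ∫ θ in (π:ℝ)..(2 * π), h θ = ∫ θ in (0:ℝ)..π, h (2 * π - θ) := by
      rw [intervalIntegral.integral_comp_sub_left (fun x => h x)]; congr 1 <;> ring
    rw [eO, ← intervalIntegral.integral_add (hcont.intervalIntegrable _ _) ((by fun_prop : Continuous fun θ => h (2 * π - θ)).intervalIntegrable _ _),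
      ← intervalIntegral.integral_ofReal, ← intervalIntegral.integral_const_mul]
    congr 1; ext θ
    have eZ : h (2 * π - θ) = (starRingEnd ℂ) (h θ) := by
      simp only [hh]
      have : eI (-(2 * π - θ)) = eI θ := by
        rw [← eI_conj, eI_two_pi_sub, ← eI_conj, Complex.conj_conj]
      rw [this, eI_two_pi_sub, ← eI_conj, hc _ (eI_norm θ)]
      simp
    rw [eZ, Complex.add_conj]; push_cast; rfl
  rw [eA, eH] at hO
  have gB : g ζ = (1 / π : ℂ) * ((∫ θ in (0:ℝ)..π, (h θ).re : ℝ) : ℂ) := by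
    have hpi : (π : ℂ) ≠ 0 := by exact_mod_cast pi_ne_zero
    have hI := Complex.I_ne_zero
    rw [smul_eq_mul] at hO
    have : (2 * Complex.I) * (((∫ θ in (0:ℝ)..π, (h θ).re : ℝ) : ℂ) - π * g ζ) = 0 := by linear_combination hO
    have := (mul_eq_zero.mp this).resolve_left (by simp)
    rw [sub_eq_zero.mp this]; field_simp
  rw [gB]; push_cast; ring

lemma one_sub_conj (r θ : ℝ) : (starRingEnd ℂ) (1 - r * eI θ) = 1 - r * eI (-θ) := by
  simp [eI_conj]

lemma poisson_int {r : ℝ} (hr : |r| < 1) :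
    ∫ θ in (0:ℝ)..π, (‖1 - r * eI θ‖ ^ 2)⁻¹ = π / (1 - r ^ 2) := by
  have hd : ∀ z : ℂ, ‖z‖ ≤ 1 → 1 - (r:ℂ) * z ≠ 0 := by
    intro z hz eC
    have : ‖(r : ℂ) * z‖ = 1 := by rw [← sub_eq_zero.mp eC]; simp
    rw [norm_mul, Complex.norm_real, norm_eq_abs] at this
    nlinarith [abs_nonneg r, norm_nonneg z]
  have h := half_cauchy (g := fun z => (1 - r * z)⁻¹) (ζ := r) ?_ (by simp) hr
  · have e : ∀ θ : ℝ, ((1 - (r:ℂ) * eI θ)⁻¹ * (1 - r * eI (-θ))⁻¹).re = (‖1 - r * eI θ‖ ^ 2)⁻¹ := by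
      intro θ
      rw [← one_sub_conj, ← mul_inv, Complex.mul_conj, Complex.normSq_eq_norm_sq, ← Complex.ofReal_inv, Complex.ofReal_re]
    simp only [e] at h
    have h' : (1 - r * r)⁻¹ = 1 / π * ∫ θ in (0:ℝ)..π, (‖1 - r * eI θ‖ ^ 2)⁻¹ := by exact_mod_cast h
    have hr2 : 1 - r ^ 2 ≠ 0 := by nlinarith [abs_lt.mp hr]
    rw [show r * r = r ^ 2 by ring] at h'
    have := pi_ne_zero
    field_simp at h' ⊢; linarith
  · refine DifferentiableOn.diffContOnCl ?_
    rw [closure_ball _ one_ne_zero]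
    intro z hz
    have hO : DifferentiableAt ℂ (fun z : ℂ => 1 - (r:ℂ) * z) z := by fun_prop
    exact (hO.inv (hd z (by simpa using hz))).differentiableWithinAt

lemma FF_diffCont {n : ℕ} (hn : 1 ≤ n) : DiffContOnCl ℂ (FF n 0) (Metric.ball 0 1) := by
  refine ⟨?_, ?_⟩
  · exact Complex.differentiableOn_tsum_of_summable_norm (cc_summable hn 0 (by norm_num))
      (fun k => by fun_prop) Metric.isOpen_ball fun k z hz => FF_term_le n 0 k (by simpa using (mem_ball_zero_iff.mp hz).le)
  · rw [closure_ball _ one_ne_zero]; exact FF_continuousOn hn 0 (by norm_num)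

lemma FF_zero (n : ℕ) : FF n 0 0 = 1 := by
  unfold FF
  rw [tsum_eq_single 0 (fun k hk => by simp [hk])]
  simp [cc]

lemma circle_id {n : ℕ} (hn : 1 ≤ n) (θ : ℝ) :
    2 * (cos (θ / 2) : ℂ) * FF n 1 (eI θ) =
      2 * Complex.I * bt n * (sin (θ / 2) : ℂ) * FF n 0 (eI θ) + bt n * eI (-(θ / 2)) := by
  have h := FF_identity hn (z := eI θ) (eI_norm θ).le
  have eF : eI θ * eI (-(θ / 2)) = eI (θ / 2) := by
    unfold eI; rw [← Complex.exp_add]; congr 1; push_cast; ring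
  have eG : ∀ x : ℝ, eI x = cos x + sin x * Complex.I := by
    intro x; unfold eI; rw [Complex.exp_mul_I]; push_cast; rfl
  have hQ : eI (-(θ / 2)) * ((1 + eI θ) * FF n 1 (eI θ)) =
      eI (-(θ / 2)) * ((bt n) * (eI θ - 1) * FF n 0 (eI θ) + bt n) := by rw [h]
  have eA : (eI (-(θ / 2)) + eI (θ / 2)) * FF n 1 (eI θ) =
      bt n * (eI (θ / 2) - eI (-(θ / 2))) * FF n 0 (eI θ) + bt n * eI (-(θ / 2)) := by
    rw [← eF]; linear_combination hQ
  have eP : eI (-(θ / 2)) + eI (θ / 2) = 2 * (cos (θ / 2) : ℂ) := by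
    rw [eG, eG, cos_neg, sin_neg]; push_cast; ring
  have gH : eI (θ / 2) - eI (-(θ / 2)) = 2 * Complex.I * (sin (θ / 2) : ℂ) := by
    rw [eG, eG, cos_neg, sin_neg]; push_cast; ring
  rw [eP, gH] at eA; rw [eA]; ring

lemma eI_re (x : ℝ) : (eI x).re = cos x := Complex.exp_ofReal_mul_I_re x
lemma eI_im (x : ℝ) : (eI x).im = sin x := Complex.exp_ofReal_mul_I_im x

lemma circle_re {n : ℕ} (hn : 1 ≤ n) (θ : ℝ) :
    cos (θ / 2) * (FF n 1 (eI θ)).re =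
      - bt n * sin (θ / 2) * (FF n 0 (eI θ)).im + bt n / 2 * cos (θ / 2) := by
  have h := congrArg Complex.re (circle_id hn θ)
  simp [eI_re, eI_im, -Complex.ofReal_cos, -Complex.ofReal_sin] at h
  linarith

lemma circle_im {n : ℕ} (hn : 1 ≤ n) (θ : ℝ) :
    cos (θ / 2) * (FF n 1 (eI θ)).im =
      bt n * sin (θ / 2) * ((FF n 0 (eI θ)).re - 1 / 2) := by
  have h := congrArg Complex.im (circle_id hn θ)
  simp [eI_re, eI_im, -Complex.ofReal_cos, -Complex.ofReal_sin] at h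
  linarith

lemma F0_deriv_re {n : ℕ} (hn : 1 ≤ n) (θ : ℝ) :
    HasDerivAt (fun θ => (FF n 0 (eI θ)).re) (-(FF n 1 (eI θ)).im) θ := by
  have := Complex.reCLM.hasFDerivAt.comp_hasDerivAt θ (FF_hasDerivAt_circle hn 0 (by norm_num) θ)
  simpa [eI, Function.comp_def] using this

lemma F0_deriv_im {n : ℕ} (hn : 1 ≤ n) (θ : ℝ) :
    HasDerivAt (fun θ => (FF n 0 (eI θ)).im) ((FF n 1 (eI θ)).re) θ := by
  have := Complex.imCLM.hasFDerivAt.comp_hasDerivAt θ (FF_hasDerivAt_circle hn 0 (by norm_num) θ)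
  simpa [eI, Function.comp_def] using this

lemma FF_circle_cont {n : ℕ} (hn : 1 ≤ n) (j : ℕ) (hj : j ≤ 2) : Continuous fun θ => FF n j (eI θ) :=
  (FF_continuousOn hn j hj).comp_continuous eI_cont fun θ => by simp [eI_norm]

lemma cosinv_deriv {θ : ℝ} (hc : cos (θ / 2) ≠ 0) :
    HasDerivAt (fun θ => (cos (θ / 2))⁻¹) (sin (θ / 2) / 2 * (cos (θ / 2))⁻¹ ^ 2) θ := by
  have hO : HasDerivAt (fun θ : ℝ => cos (θ / 2)) (-sin (θ / 2) * (1 / 2)) θ :=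
    ((hasDerivAt_id θ).div_const 2).cos
  exact (hO.inv hc).congr_deriv (by field_simp)

lemma cos_half_pos {θ : ℝ} (eC : 0 ≤ θ) (hO : θ < π) : 0 < cos (θ / 2) :=
  cos_pos_of_mem_Ioo ⟨by linarith [pi_pos], by linarith⟩

noncomputable def eQ (n : ℕ) : ℝ := 2 * (FF n 0 1).re - 1

lemma yv_eq {n : ℕ} (hn : 1 ≤ n) {θ : ℝ} (hθ : θ ∈ Set.Icc 0 π) :
    2 * (FF n 0 (eI θ)).re - 1 = eQ n * cos (θ / 2) ^ (2 * n + 1) := by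
  have main : ∀ θ ∈ Set.Ico 0 π, 2 * (FF n 0 (eI θ)).re - 1 = eQ n * cos (θ / 2) ^ (2 * n + 1) := by
    intro x hx
    have hd : ∀ θ ∈ Set.Icc 0 x, HasDerivAt (fun θ => (2 * (FF n 0 (eI θ)).re - 1) * (cos (θ / 2))⁻¹ ^ (2 * n + 1)) 0 θ := by
      intro θ hθ
      have hc := cos_half_pos hθ.1 (lt_of_le_of_lt hθ.2 hx.2)
      have hO := (((F0_deriv_re hn θ).const_mul 2).sub_const 1).mul ((cosinv_deriv hc.ne').pow (2 * n + 1))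
      refine hO.congr_deriv ?_
      have hQ := circle_im hn θ
      have eA : (FF n 1 (eI θ)).im = bt n * sin (θ / 2) * ((FF n 0 (eI θ)).re - 1 / 2) * (cos (θ / 2))⁻¹ := by
        rw [← hQ]; field_simp
      rw [eA]; simp only [Pi.pow_apply, bt]; push_cast; ring
    have := constant_of_has_deriv_right_zero (fun θ hθ => (hd θ hθ).continuousAt.continuousWithinAt)
      (fun θ hθ => (hd θ (Set.Ico_subset_Icc_self hθ)).hasDerivWithinAt) x ⟨hx.1, le_rfl⟩
    have hc := cos_half_pos hx.1 hx.2
    have eR : eI 0 = 1 := by simp [eI]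
    simp only [eR, zero_div, cos_zero, inv_one, one_pow, mul_one] at this
    rw [← eQ, inv_pow, mul_inv_eq_iff_eq_mul₀ (by positivity)] at this
    exact this
  have hcl : closure (Set.Ico 0 π) = Set.Icc 0 π := closure_Ico pi_pos.ne
  have hE : Set.EqOn (fun θ => 2 * (FF n 0 (eI θ)).re - 1) (fun θ => eQ n * cos (θ / 2) ^ (2 * n + 1)) (closure (Set.Ico 0 π)) :=
    Set.EqOn.closure main (by have := Complex.continuous_re.comp (FF_circle_cont hn 0 (by norm_num)); exact (continuous_const.mul this).sub continuous_const) (by fun_prop)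
  exact hE (by rw [hcl]; exact hθ)

lemma S_ge {n : ℕ} (hn : 1 ≤ n) {x : ℝ} (hx : x ∈ Set.Ico 0 π) :
    bt n / (2 * n) * (sin (x / 2) * cos (x / 2)) ≤ (FF n 0 (eI x)).im := by
  have hn' : (1 : ℝ) ≤ n := by exact_mod_cast hn
  set g : ℝ → ℝ := fun θ => (FF n 0 (eI θ)).im * (cos (θ / 2))⁻¹ ^ (2 * n + 1) -
      bt n / (2 * n) * (sin (θ / 2) * (cos (θ / 2))⁻¹ ^ (2 * n)) with hg
  have hd : ∀ θ ∈ Set.Icc 0 x, HasDerivAt g (bt n / 2 * (cos (θ / 2))⁻¹ ^ (2 * n + 1) *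
      (1 - cos (θ / 2) ^ 2 / (2 * n) - sin (θ / 2) ^ 2)) θ := by
    intro θ hθ
    have hc := cos_half_pos hθ.1 (lt_of_le_of_lt hθ.2 hx.2)
    have hs : HasDerivAt (fun θ : ℝ => sin (θ / 2)) (cos (θ / 2) * (1 / 2)) θ :=
      ((hasDerivAt_id θ).div_const 2).sin
    have hO := ((F0_deriv_im hn θ).mul ((cosinv_deriv hc.ne').pow (2 * n + 1))).sub
      ((hs.mul ((cosinv_deriv hc.ne').pow (2 * n))).const_mul (bt n / (2 * n)))
    refine hO.congr_deriv ?_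
    have hQ := circle_re hn θ
    have eA : (FF n 1 (eI θ)).re = (- bt n * sin (θ / 2) * (FF n 0 (eI θ)).im + bt n / 2 * cos (θ / 2)) * (cos (θ / 2))⁻¹ := by
      rw [← hQ]; field_simp
    obtain ⟨m, rfl⟩ : ∃ m, n = m + 1 := ⟨n - 1, by omega⟩
    rw [eA]; simp only [Pi.pow_apply, bt]
    rw [Nat.add_sub_cancel, show 2 * (m + 1) - 1 = 2 * m + 1 by omega, show 2 * (m + 1) = 2 * m + 2 by omega,
      show 2 * m + 2 + 1 = 2 * m + 3 by omega]
    push_cast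
    have hm : (m : ℝ) + 1 ≠ 0 := by positivity
    clear hO hQ eA hg g hs
    generalize (FF (m + 1) 0 (eI θ)).im = S
    generalize sin (θ / 2) = s
    obtain ⟨d, hd0, hd⟩ : ∃ d : ℝ, d ≠ 0 ∧ cos (θ / 2) = d⁻¹ := ⟨_, inv_ne_zero hc.ne', (inv_inv _).symm⟩
    rw [hd, inv_inv]
    field_simp
    ring
  have hmono : MonotoneOn g (Set.Icc 0 x) := by
    refine monotoneOn_of_deriv_nonneg (convex_Icc 0 x) (fun θ hθ => (hd θ hθ).continuousAt.continuousWithinAt)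
      (fun θ hθ => (hd θ (interior_subset hθ)).differentiableAt.differentiableWithinAt) fun θ hθ => ?_
    have hθ' := interior_subset hθ
    rw [(hd θ hθ').deriv]
    have hc := cos_half_pos hθ'.1 (lt_of_le_of_lt hθ'.2 hx.2)
    refine mul_nonneg (by have := bt_pos n; positivity) ?_
    have : cos (θ / 2) ^ 2 / (2 * n) ≤ cos (θ / 2) ^ 2 := div_le_self (by positivity) (by linarith)
    linarith [sin_sq_add_cos_sq (θ / 2)]
  have eC := hmono ⟨le_rfl, hx.1⟩ ⟨hx.1, le_rfl⟩ hx.1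
  have eR : (FF n 0 (eI 0)).im = 0 := by
    have h := FF_conj n 0 1
    simp only [map_one] at h
    have := congrArg Complex.im h
    simp [eI] at this ⊢; linarith
  have hc := cos_half_pos hx.1 hx.2
  simp only [hg, eR, zero_div, sin_zero, zero_mul, mul_zero, sub_zero] at eC
  have hQ := mul_nonneg eC (pow_pos hc (2 * n + 1)).le
  have eP : ((FF n 0 (eI x)).im * (cos (x / 2))⁻¹ ^ (2 * n + 1) - bt n / (2 * n) * (sin (x / 2) * (cos (x / 2))⁻¹ ^ (2 * n))) * cos (x / 2) ^ (2 * n + 1)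
    = (FF n 0 (eI x)).im - bt n / (2 * n) * (sin (x / 2) * cos (x / 2)) := by
    rw [inv_pow, inv_pow, pow_succ]; field_simp
  linarith

lemma D1_ge {n : ℕ} (hn : 1 ≤ n) {θ : ℝ} (hθ : θ ∈ Set.Icc 0 π) :
    bt n / n * sin (θ / 2) ^ 2 ≤ 1 - 2 / bt n * (FF n 1 (eI θ)).re := by
  have hn' : (1 : ℝ) ≤ n := by exact_mod_cast hn
  have hb := bt_pos n
  have hcl : closure (Set.Ico 0 π) = Set.Icc 0 π := closure_Ico pi_pos.ne
  have hc1 := FF_circle_cont hn 1 (by norm_num)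
  refine le_on_closure (s := Set.Ico 0 π) (f := fun θ => bt n / n * sin (θ / 2) ^ 2)
    (g := fun θ => 1 - 2 / bt n * (FF n 1 (eI θ)).re) ?_ (by fun_prop) (by have := Complex.continuous_re.comp hc1; exact (continuous_const.sub (continuous_const.mul this)).continuousOn) (by rw [hcl]; exact hθ)
  intro x hx
  have hc := cos_half_pos hx.1 hx.2
  have hs : 0 ≤ sin (x / 2) := sin_nonneg_of_nonneg_of_le_pi (by linarith [hx.1]) (by linarith [hx.2, pi_pos])
  have hO := circle_re hn x
  have hQ := mul_le_mul_of_nonneg_left (S_ge hn hx) hs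
  refine le_of_mul_le_mul_left ?_ hc
  have eA : cos (x / 2) * (1 - 2 / bt n * (FF n 1 (eI x)).re) = 2 * sin (x / 2) * (FF n 0 (eI x)).im := by
    have : cos (x / 2) * (1 - 2 / bt n * (FF n 1 (eI x)).re) = cos (x / 2) - 2 / bt n * (cos (x / 2) * (FF n 1 (eI x)).re) := by ring
    rw [this, hO]; field_simp; ring
  show cos (x / 2) * (bt n / n * sin (x / 2) ^ 2) ≤ cos (x / 2) * (1 - 2 / bt n * (FF n 1 (eI x)).re)
  rw [eA]
  calc _ = 2 * (sin (x / 2) * (bt n / (2 * n) * (sin (x / 2) * cos (x / 2)))) := by field_simp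
    _ ≤ _ := by linarith

noncomputable def WW (n : ℕ) : ℝ := ∏ i ∈ Finset.range n, ((2 * i + 1 : ℝ) / (2 * i + 2))

lemma WW_pos (n : ℕ) : 0 < WW n := Finset.prod_pos fun i _ => by positivity

lemma y0_eq {n : ℕ} (hn : 1 ≤ n) : eQ n = π * bt n * WW n := by
  have h := half_cauchy (FF_diffCont hn) (fun z _ => FF_conj n 0 z) (ζ := 0) (by norm_num)
  simp only [Complex.ofReal_zero, FF_zero, zero_mul, sub_zero, inv_one, mul_one] at h
  have hO : (1:ℝ) = 1 / π * ∫ θ in (0:ℝ)..π, (FF n 0 (eI θ)).re := by exact_mod_cast h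
  have hpi := pi_pos
  have hcont : Continuous fun θ => (FF n 0 (eI θ)).re := Complex.continuous_re.comp (FF_circle_cont hn 0 (by norm_num))
  have hcont2 : Continuous fun θ => 2 * (FF n 0 (eI θ)).re := continuous_const.mul hcont
  have hQ : ∫ θ in (0:ℝ)..π, (2 * (FF n 0 (eI θ)).re - 1) = π := by
    rw [intervalIntegral.integral_sub (hcont2.intervalIntegrable _ _) intervalIntegrable_const,
      intervalIntegral.integral_const_mul]
    have : ∫ θ in (0:ℝ)..π, (FF n 0 (eI θ)).re = π := by field_simp at hO; linarith
    rw [this]; simp; ring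
  have eA : ∫ θ in (0:ℝ)..π, (2 * (FF n 0 (eI θ)).re - 1) = ∫ θ in (0:ℝ)..π, eQ n * cos (θ / 2) ^ (2 * n + 1) := by
    apply intervalIntegral.integral_congr
    intro θ hθ
    rw [Set.uIcc_of_le hpi.le] at hθ
    exact yv_eq hn hθ
  rw [hQ, intervalIntegral.integral_const_mul, intervalIntegral.integral_comp_div (fun x => cos x ^ (2 * n + 1)) two_ne_zero,
    zero_div, EulerSine.integral_cos_pow_eq, integral_sin_pow_odd] at eA
  have eH : ∀ m : ℕ, (∏ i ∈ Finset.range m, ((2 * (i:ℝ) + 2) / (2 * i + 3))) * ((2 * m + 1) * WW m) = 1 := by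
    intro m
    induction m with
    | zero => simp [WW]
    | succ m ih =>
      unfold WW at ih ⊢
      rw [Finset.prod_range_succ, Finset.prod_range_succ]
      push_cast
      generalize (∏ i ∈ Finset.range m, ((2 * (i:ℝ) + 2) / (2 * i + 3))) = X at ih ⊢
      generalize (∏ i ∈ Finset.range m, ((2 * (i:ℝ) + 1) / (2 * i + 2))) = Y at ih ⊢
      have : (2 * (m:ℝ) + 3) ≠ 0 := by positivity
      have : (2 * (m:ℝ) + 2) ≠ 0 := by positivity
      field_simp; linear_combination (2 * (m:ℝ) + 3) * ih
  have eO := eH n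
  set Q := ∏ i ∈ Finset.range n, ((2 * (i:ℝ) + 2) / (2 * i + 3))
  simp only [smul_eq_mul] at eA
  unfold bt
  calc eQ n = eQ n * (Q * ((2 * n + 1) * WW n)) := by rw [eO, mul_one]
    _ = (eQ n * (2 * (1 / 2 * (2 * Q)))) * ((n + 1 / 2) * WW n) := by ring
    _ = _ := by rw [← eA]; ring

noncomputable def Zf (n : ℕ) (σ y : ℝ) : ℝ := 2 * (FF n 0 ((σ * exp (-y) : ℝ) : ℂ)).re - 1

lemma ax_le {σ y : ℝ} (hσ : |σ| ≤ 1) (hy : 0 ≤ y) : ‖((σ * exp (-y) : ℝ) : ℂ)‖ ≤ 1 := by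
  rw [Complex.norm_real, norm_eq_abs, abs_mul, abs_of_pos (exp_pos _)]
  have : exp (-y) ≤ 1 := exp_le_one_iff.mpr (by linarith)
  nlinarith [abs_nonneg σ, exp_pos (-y)]

lemma Zf_cont {n : ℕ} (hn : 1 ≤ n) {σ : ℝ} (hσ : |σ| ≤ 1) : ContinuousOn (Zf n σ) (Set.Ici 0) := by
  have hO : ContinuousOn (fun y : ℝ => FF n 0 ((σ * exp (-y) : ℝ) : ℂ)) (Set.Ici 0) :=
    (FF_continuousOn hn 0 (by norm_num)).comp (by fun_prop) fun y hy => by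
      rw [mem_closedBall_zero_iff]; exact ax_le hσ hy
  exact (continuousOn_const.mul (Complex.continuous_re.comp_continuousOn hO)).sub continuousOn_const

lemma Zf_deriv {n : ℕ} (hn : 1 ≤ n) {σ : ℝ} (hσ : |σ| ≤ 1) {y : ℝ} (hy : 0 < y) :
    ∃ D, HasDerivAt (Zf n σ) D y ∧
      (1 + σ * exp (-y)) * D = bt n * (1 - σ * exp (-y)) * Zf n σ y - bt n * (1 + σ * exp (-y)) := by
  have h := hasDerivAt_tsum_of_isPreconnected (𝕜 := ℝ) (u := fun k : ℕ => (k : ℝ) ^ 1 * |cc n k|)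
    (g := fun (k : ℕ) (y : ℝ) => (k : ℂ) ^ 0 * (cc n k : ℂ) * ((σ * exp (-y) : ℝ) : ℂ) ^ k)
    (g' := fun (k : ℕ) (y : ℝ) => -((k : ℂ) ^ 1 * (cc n k : ℂ) * ((σ * exp (-y) : ℝ) : ℂ) ^ k))
    (y₀ := y) (y := y) (cc_summable hn 1 (by omega)) isOpen_Ioi isPreconnected_Ioi (t := Set.Ioi 0) ?_ ?_ hy
    (FF_summable hn 0 (by omega) (ax_le hσ hy.le)) hy
  · rw [tsum_neg] at h
    change HasDerivAt (fun y : ℝ => FF n 0 ((σ * exp (-y) : ℝ) : ℂ)) (-(FF n 1 ((σ * exp (-y) : ℝ) : ℂ))) y at h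
    have hQ := Complex.reCLM.hasFDerivAt.comp_hasDerivAt y h
    refine ⟨2 * (-(FF n 1 ((σ * exp (-y) : ℝ) : ℂ))).re, (hQ.const_mul 2).sub_const 1, ?_⟩
    have eA := congrArg Complex.re (FF_identity hn (ax_le hσ hy.le))
    have eF : (1 + ((σ * exp (-y) : ℝ) : ℂ)) = ((1 + σ * exp (-y) : ℝ) : ℂ) := by push_cast; ring
    have eG : (bt n : ℂ) * (((σ * exp (-y) : ℝ) : ℂ) - 1) = ((bt n * (σ * exp (-y) - 1) : ℝ) : ℂ) := by push_cast; ring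
    rw [eF, eG, Complex.add_re, Complex.re_ofReal_mul, Complex.re_ofReal_mul, Complex.ofReal_re] at eA
    unfold Zf; rw [Complex.neg_re]
    linear_combination -2 * eA
  · intro k y _
    have hO : HasDerivAt (fun y : ℝ => σ * exp (-y)) (σ * (exp (-y) * (-1))) y :=
      ((hasDerivAt_neg y).exp).const_mul σ
    have hQ := ((hO.ofReal_comp).pow k).const_mul ((k : ℂ) ^ 0 * (cc n k : ℂ))
    refine hQ.congr_deriv ?_
    rcases k with _ | k
    · simp
    · push_cast; ring
  · intro k y hy
    rw [norm_neg]
    exact FF_term_le n 1 k (ax_le hσ (le_of_lt hy))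

lemma sinh_ge_aux {x : ℝ} : x * cosh x ≤ (1 + x) * sinh x := by
  rw [cosh_eq, sinh_eq]
  have h : 1 + 2 * x ≤ exp (2 * x) := by linarith [add_one_le_exp (2 * x)]
  have hQ : exp x = exp (2 * x) * exp (-x) := by rw [← exp_add]; congr 1; ring
  have eA := mul_le_mul_of_nonneg_right h (exp_pos (-x)).le
  linarith

noncomputable def De (n : ℕ) (y : ℝ) : ℝ := eQ n * cosh (y / 2) ^ (2 * n + 1) - Zf n 1 y

lemma De_cont {n : ℕ} (hn : 1 ≤ n) : ContinuousOn (De n) (Set.Ici 0) := by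
  have h := Zf_cont hn (σ := 1) (by norm_num)
  have hQ : Continuous fun y : ℝ => eQ n * cosh (y / 2) ^ (2 * n + 1) := by fun_prop
  exact hQ.continuousOn.sub h

lemma De_deriv {n : ℕ} (hn : 1 ≤ n) {y : ℝ} (hy : 0 < y) :
    HasDerivAt (De n) (bt n * (sinh (y / 2) / cosh (y / 2)) * De n y + bt n) y := by
  obtain ⟨D, hD, gU⟩ := Zf_deriv hn (σ := 1) (by norm_num) hy
  have hO : HasDerivAt (fun y : ℝ => cosh (y / 2)) (sinh (y / 2) * (1 / 2)) y :=
    ((hasDerivAt_id y).div_const 2).cosh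
  have hQ := ((hO.pow (2 * n + 1)).const_mul (eQ n)).sub hD
  refine hQ.congr_deriv ?_
  have hc := cosh_pos (y / 2)
  have eF : 1 + 1 * exp (-y) = 2 * exp (-(y / 2)) * cosh (y / 2) := by
    rw [cosh_eq]
    have : exp (-y) = exp (-(y / 2)) * exp (-(y / 2)) := by rw [← exp_add]; congr 1; ring
    have hO : exp (-(y / 2)) * exp (y / 2) = 1 := by rw [← exp_add]; simp
    rw [this]; linear_combination -hO
  have eG : 1 - 1 * exp (-y) = 2 * exp (-(y / 2)) * sinh (y / 2) := by
    rw [sinh_eq]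
    have : exp (-y) = exp (-(y / 2)) * exp (-(y / 2)) := by rw [← exp_add]; congr 1; ring
    have hO : exp (-(y / 2)) * exp (y / 2) = 1 := by rw [← exp_add]; simp
    rw [this]; linear_combination -hO
  rw [eF, eG] at gU
  have he := exp_pos (-(y / 2))
  have hD3 : cosh (y / 2) * D = bt n * sinh (y / 2) * Zf n 1 y - bt n * cosh (y / 2) := by
    have : (2 * exp (-(y / 2))) * (cosh (y / 2) * D - (bt n * sinh (y / 2) * Zf n 1 y - bt n * cosh (y / 2))) = 0 := by
      linear_combination gU
    have := (mul_eq_zero.mp this).resolve_left (by positivity)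
    linarith
  have hD4 : D = (bt n * sinh (y / 2) * Zf n 1 y - bt n * cosh (y / 2)) / cosh (y / 2) := by
    rw [← hD3]; field_simp
  rw [hD4]; unfold De bt; push_cast; field_simp; ring

lemma De_zero (n : ℕ) : De n 0 = 0 := by simp [De, Zf, eQ]

lemma De_nonneg {n : ℕ} (hn : 1 ≤ n) {y : ℝ} (hy : 0 ≤ y) : 0 ≤ De n y := by
  have hb := bt_pos n
  have hd : ∀ y, 0 < y → HasDerivAt (fun y => De n y * (cosh (y / 2))⁻¹ ^ (2 * n + 1)) (bt n * (cosh (y / 2))⁻¹ ^ (2 * n + 1)) y := by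
    intro y hy
    have hc := cosh_pos (y / 2)
    have hO : HasDerivAt (fun y : ℝ => cosh (y / 2)) (sinh (y / 2) * (1 / 2)) y :=
      ((hasDerivAt_id y).div_const 2).cosh
    refine ((De_deriv hn hy).mul ((hO.inv hc.ne').pow (2 * n + 1))).congr_deriv ?_
    simp only [Pi.pow_apply, Pi.inv_apply, bt, inv_pow]; push_cast
    field_simp; ring
  have hmono : MonotoneOn (fun y => De n y * (cosh (y / 2))⁻¹ ^ (2 * n + 1)) (Set.Ici 0) := by
    refine monotoneOn_of_deriv_nonneg (convex_Ici 0) ?_ ?_ ?_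
    · refine (De_cont hn).mul (Continuous.continuousOn ?_)
      exact (Continuous.inv₀ (by fun_prop) fun y => (cosh_pos _).ne').pow _
    · intro y hy; rw [interior_Ici] at hy; exact (hd y hy).differentiableAt.differentiableWithinAt
    · intro y hy; rw [interior_Ici] at hy; rw [(hd y hy).deriv]
      have hc := cosh_pos (y / 2); positivity
  have := hmono (Set.mem_Ici.mpr le_rfl) hy hy
  simp only [De_zero, zero_mul] at this
  have hc : 0 < (cosh (y / 2))⁻¹ ^ (2 * n + 1) := by have := cosh_pos (y / 2); positivity
  exact nonneg_of_mul_nonneg_left this hc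

lemma De_ge {n : ℕ} (hn : 1 ≤ n) {y : ℝ} (hy : 0 ≤ y) :
    bt n * y + bt n ^ 2 / 4 * y ^ 2 * (y / (4 + y)) ≤ De n y := by
  have hb := bt_pos n
  have step : ∀ C p q : ℝ, 0 ≤ p → p ≤ q → (∀ s, p < s → s < q → C ≤ bt n * (sinh (s / 2) / cosh (s / 2)) * De n s + bt n) →
      C * (q - p) ≤ De n q - De n p := by
    intro C p q hp hpq h
    refine (convex_Icc p q).mul_sub_le_image_sub_of_le_deriv ((De_cont hn).mono fun s hs => hp.trans hs.1) ?_ ?_ p ⟨le_rfl, hpq⟩ q ⟨hpq, le_rfl⟩ hpq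
    · intro s hs; rw [interior_Icc] at hs
      exact (De_deriv hn (hp.trans_lt hs.1)).differentiableAt.differentiableWithinAt
    · intro s hs; rw [interior_Icc] at hs
      rw [(De_deriv hn (hp.trans_lt hs.1)).deriv]; exact h s hs.1 hs.2
  have hO : ∀ y, 0 ≤ y → bt n * y ≤ De n y := by
    intro y hy
    have := step (bt n) 0 y le_rfl hy fun s hs _ => by
      have hO := De_nonneg hn hs.le
      have hQ : 0 ≤ sinh (s / 2) := sinh_nonneg_iff.mpr (by linarith)
      have eA := cosh_pos (s / 2)
      have : 0 ≤ bt n * (sinh (s / 2) / cosh (s / 2)) * De n s := by positivity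
      linarith
    rw [De_zero] at this; linarith
  have hQ := step (bt n + bt n ^ 2 * (y / (4 + y)) * (y / 2)) (y / 2) y (by linarith) (by linarith) fun s hs hs2 => by
    have gN : 0 < s := by linarith
    have eS : y / (4 + y) ≤ sinh (s / 2) / cosh (s / 2) := by
      rw [div_le_div_iff₀ (by linarith) (cosh_pos _)]
      have := sinh_ge_aux (x := s / 2)
      have eA : 0 ≤ sinh (s / 2) := sinh_nonneg_iff.mpr (by linarith)
      have eH := cosh_pos (s / 2)
      have eO : sinh (s / 2) ≤ cosh (s / 2) := (sinh_lt_cosh _).le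
      nlinarith
    have eV : bt n * (y / 2) ≤ De n s := le_trans (by nlinarith) (hO s gN.le)
    have eW : 0 ≤ y / (4 + y) := by positivity
    have := mul_le_mul eS eV (by positivity) (eW.trans eS)
    nlinarith
  have eA := hO (y / 2) (by linarith)
  nlinarith

noncomputable def sh : ℕ → ℝ → ℝ
  | 0, φ => φ
  | m + 1, φ => (sinh φ ^ (2 * m + 1) * cosh φ - (2 * m + 1) * sh m φ) / (2 * m + 2)

lemma sh_zero (m : ℕ) : sh m 0 = 0 := by
  induction m with
  | zero => rfl
  | succ m ih => simp [sh, ih]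

lemma sh_deriv (m : ℕ) (φ : ℝ) : HasDerivAt (sh m) (sinh φ ^ (2 * m)) φ := by
  induction m with
  | zero => simp only [mul_zero, pow_zero]; exact hasDerivAt_id φ
  | succ m ih =>
    have hO := ((((hasDerivAt_sinh φ).pow (2 * m + 1)).mul (hasDerivAt_cosh φ)).sub (ih.const_mul (2 * (m:ℝ) + 1))).div_const (2 * (m:ℝ) + 2)
    refine hO.congr_deriv ?_
    have hQ := cosh_sq φ
    have : (2 * (m:ℝ) + 2) ≠ 0 := by positivity
    simp only [Pi.pow_apply]; push_cast; field_simp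
    rw [hQ]; ring

lemma Zn_eq {n : ℕ} (hn : 1 ≤ n) {y : ℝ} (hy : 0 < y) :
    Zf n (-1) y = 2 * bt n * sinh (y / 2) ^ (2 * n + 1) * sh n (arsinh (1 / sinh (y / 2))) := by
  have hS : ∀ y, 0 < y → 0 < sinh (y / 2) := fun y hy => sinh_pos_iff.mpr (by linarith)
  set R : ℝ → ℝ := fun y => Zf n (-1) y * (sinh (y / 2))⁻¹ ^ (2 * n + 1) - 2 * bt n * sh n (arsinh (sinh (y / 2))⁻¹) with hR
  have hd : ∀ y, 0 < y → HasDerivAt R 0 y := by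
    intro y hy
    have hs := hS y hy
    obtain ⟨D, hD, gU⟩ := Zf_deriv hn (σ := -1) (by norm_num) hy
    have hc := cosh_pos (y / 2)
    have eR : exp (-y) = exp (-(y / 2)) * exp (-(y / 2)) := by rw [← exp_add]; congr 1; ring
    have e0' : exp (-(y / 2)) * exp (y / 2) = 1 := by rw [← exp_add]; simp
    have eF : 1 + -1 * exp (-y) = 2 * exp (-(y / 2)) * sinh (y / 2) := by
      rw [sinh_eq, eR]; linear_combination -e0'
    have eG : 1 - -1 * exp (-y) = 2 * exp (-(y / 2)) * cosh (y / 2) := by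
      rw [cosh_eq, eR]; linear_combination -e0'
    rw [eF, eG] at gU
    have he := exp_pos (-(y / 2))
    have hD4 : D = (bt n * cosh (y / 2) * Zf n (-1) y - bt n * sinh (y / 2)) / sinh (y / 2) := by
      rw [eq_div_iff hs.ne']
      have : (2 * exp (-(y / 2))) * (D * sinh (y / 2) - (bt n * cosh (y / 2) * Zf n (-1) y - bt n * sinh (y / 2))) = 0 := by
        linear_combination gU
      have := (mul_eq_zero.mp this).resolve_left (by positivity)
      linarith
    have hO : HasDerivAt (fun y : ℝ => sinh (y / 2)) (cosh (y / 2) * (1 / 2)) y :=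
      ((hasDerivAt_id y).div_const 2).sinh
    have hQ := hO.inv hs.ne'
    have eA := hQ.arsinh
    have eH := (hD.mul (hQ.pow (2 * n + 1))).sub (((sh_deriv n _).comp y eA).const_mul (2 * bt n))
    refine eH.congr_deriv ?_
    have e5 : √(1 + (sinh (y / 2))⁻¹ ^ 2) = cosh (y / 2) / sinh (y / 2) := by
      rw [sqrt_eq_iff_mul_self_eq_of_pos (by positivity)]
      field_simp; linarith [cosh_sq (y / 2)]
    simp only [Pi.pow_apply, Pi.inv_apply, sinh_arsinh, e5, hD4, bt, smul_eq_mul]; push_cast; simp only [inv_pow]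
    field_simp; ring
  have hconst : ∀ y, 0 < y → ∀ z, 0 < z → R y = R z := by
    intro y hy z hz
    refine isOpen_Ioi.is_const_of_deriv_eq_zero (isPreconnected_Ioi (a := (0:ℝ))) (fun y hy => (hd y hy).differentiableAt.differentiableWithinAt) (fun y hy => (hd y hy).deriv) hy hz
  have hlim : Tendsto R atTop (𝓝 0) := by
    have hs : Tendsto (fun y : ℝ => (sinh (y / 2))⁻¹) atTop (𝓝 0) :=
      tendsto_inv_atTop_zero.comp ((tendsto_atTop_mono' atTop (by filter_upwards [eventually_ge_atTop 0] with y hy using self_le_sinh_iff.mpr (by positivity)) (tendsto_id.atTop_div_const two_pos)))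
    have hO : Tendsto (fun y : ℝ => FF n 0 ((-1 * exp (-y) : ℝ) : ℂ)) atTop (𝓝 (FF n 0 0)) := by
      have hc : ContinuousAt (FF n 0) 0 := (FF_continuousOn hn 0 (by norm_num)).continuousAt (Metric.closedBall_mem_nhds _ one_pos)
      refine hc.tendsto.comp ?_
      have : Tendsto (fun y : ℝ => -1 * exp (-y)) atTop (𝓝 (-1 * 0)) := tendsto_exp_neg_atTop_nhds_zero.const_mul _
      rw [mul_zero] at this
      exact (Complex.continuous_ofReal.tendsto _).comp this
    have hQ : Tendsto (fun y => Zf n (-1) y) atTop (𝓝 (2 * (FF n 0 0).re - 1)) :=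
      (((Complex.continuous_re.tendsto _).comp hO).const_mul 2).sub_const 1
    have eA : Tendsto (fun y : ℝ => sh n (arsinh (sinh (y / 2))⁻¹)) atTop (𝓝 (sh n (arsinh 0))) :=
      (sh_deriv n _).continuousAt.tendsto.comp ((continuous_arsinh.tendsto 0).comp hs)
    have eH := (hQ.mul (hs.pow (2 * n + 1))).sub (eA.const_mul (2 * bt n))
    rw [arsinh_zero, sh_zero, zero_pow (by omega), mul_zero, mul_zero, sub_zero] at eH; exact eH
  have eC : R y = 0 := by
    refine tendsto_nhds_unique (tendsto_const_nhds.congr' ?_) hlim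
    filter_upwards [eventually_gt_atTop 0] with z hz using hconst y hy z hz
  have hs := hS y hy
  simp only [hR, sub_eq_zero] at eC
  rw [one_div, mul_right_comm, ← eC, inv_pow]; field_simp

noncomputable def sr (z : ℂ) : ℂ := z ^ (2⁻¹ : ℂ)

lemma sr_sr (z : ℂ) : sr z ^ 2 = z := Complex.cpow_ofNat_inv_pow z 2

lemma sr_norm (z : ℂ) : ‖sr z‖ ^ 2 = ‖z‖ := by rw [← norm_pow, sr_sr]

lemma sr_re (z : ℂ) : 0 ≤ (sr z).re := by
  unfold sr; rw [Complex.cpow_inv_two_re]; positivity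

lemma sr_im {z : ℂ} (hz : 0 ≤ z.re) : |(sr z).im| ≤ (sr z).re := by
  have h := congrArg Complex.re (sr_sr z)
  rw [pow_two, Complex.mul_re] at h
  refine abs_le_of_sq_le_sq (by nlinarith) (sr_re z)

lemma sr_one : sr 1 = 1 := by simp [sr]
lemma sr_conj {z : ℂ} (hz : 0 ≤ z.re) : sr ((starRingEnd ℂ) z) = (starRingEnd ℂ) (sr z) := by
  unfold sr
  rw [Complex.conj_cpow]
  · simp [map_ofNat]
  · intro h; rw [Complex.arg_eq_pi_iff] at h; linarith [h.1]

lemma sr_diff {z : ℂ} (hz : 0 < z.re) : DifferentiableAt ℂ sr z :=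
  DifferentiableAt.cpow_const differentiableAt_id (Or.inl hz)

lemma sr_cont {z : ℂ} (hz : 0 < z.re ∨ z = 0) : ContinuousAt sr z := by
  rcases hz with hz | rfl
  · exact (sr_diff hz).continuousAt
  · refine Complex.continuousAt_cpow_const_of_re_pos (Or.inl (by simp)) (by simp)

lemma re_or {z : ℂ} (hz : ‖z‖ ≤ 1) : 0 < (1 - z).re ∨ 1 - z = 0 := by
  by_cases h : z.re < 1
  · left; simp; exact h
  · right
    have hO : z.re ≤ ‖z‖ := Complex.re_le_norm z
    have hQ : z.re = 1 := by linarith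
    have eA : z.re * z.re + z.im * z.im ≤ 1 := by
      have := Complex.sq_norm z; rw [Complex.normSq_apply] at this; nlinarith [norm_nonneg z]
    have eH : z.im = 0 := by rw [hQ] at eA; nlinarith
    apply Complex.ext <;> simp [hQ, eH]

lemma re_or' {z : ℂ} (hz : ‖z‖ ≤ 1) : 0 < (1 + z).re ∨ 1 + z = 0 := by
  have := re_or (z := -z) (by rwa [norm_neg]); simpa using this

noncomputable def ps (z : ℂ) : ℂ := sr (1 - z) * sr (1 + z)

lemma ps_diffCont : DiffContOnCl ℂ ps (Metric.ball 0 1) := by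
  refine ⟨fun z hz => ?_, ?_⟩
  · rw [mem_ball_zero_iff] at hz
    have hO : 0 < (1 - z).re := by have := Complex.re_le_norm z; simp; linarith
    have hQ : 0 < (1 + z).re := by have := Complex.re_le_norm (-z); rw [norm_neg, Complex.neg_re] at this; simp; linarith
    exact (((sr_diff hO).comp z (by fun_prop)).mul ((sr_diff hQ).comp z (by fun_prop))).differentiableWithinAt
  · rw [closure_ball _ one_ne_zero]
    intro z hz
    rw [mem_closedBall_zero_iff] at hz
    exact ((ContinuousAt.comp (sr_cont (re_or hz)) (by fun_prop)).mul (ContinuousAt.comp (sr_cont (re_or' hz)) (by fun_prop))).continuousWithinAt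

lemma ps_conj {z : ℂ} (hz : ‖z‖ ≤ 1) : ps ((starRingEnd ℂ) z) = (starRingEnd ℂ) (ps z) := by
  unfold ps
  have hO : 0 ≤ (1 - z).re := by rcases re_or hz with h | h <;> [exact h.le; simp [h]]
  have hQ : 0 ≤ (1 + z).re := by rcases re_or' hz with h | h <;> [exact h.le; simp [h]]
  rw [map_mul, ← sr_conj hO, ← sr_conj hQ]; simp

lemma ps_norm (z : ℂ) : ‖ps z‖ ^ 2 = ‖1 - z ^ 2‖ := by
  unfold ps; rw [norm_mul, mul_pow, sr_norm, sr_norm, ← norm_mul]; congr 1; ring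

lemma ps_norm_eI {θ : ℝ} (hθ : θ ∈ Set.Icc 0 π) : ‖ps (eI θ)‖ ^ 2 = 2 * sin θ := by
  have h : 1 - eI θ ^ 2 = eI θ * ((-(2 * sin θ) : ℝ) * Complex.I) := by
    have eF := eI_mul_neg θ
    have eG : eI (-θ) - eI θ = ((-(2 * sin θ) : ℝ) * Complex.I) := by
      apply Complex.ext
      · simp [eI_re]
      · rw [Complex.im_ofReal_mul]; simp [eI_im]; ring
    rw [← eG]; linear_combination -eF
  have := sin_nonneg_of_mem_Icc hθ
  rw [ps_norm, h, norm_mul, eI_norm, norm_mul, Complex.norm_I, Complex.norm_real, norm_neg, norm_of_nonneg (by positivity)]; ring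

noncomputable def BB (n : ℕ) (v : ℝ) (z : ℂ) : ℂ := Complex.exp (v / 2 - v * FF n 0 z)

lemma BB_diffCont {n : ℕ} (hn : 1 ≤ n) (v : ℝ) : DiffContOnCl ℂ (BB n v) (Metric.ball 0 1) :=
  Complex.differentiable_exp.comp_diffContOnCl (diffContOnCl_const.sub ((FF_diffCont hn).const_smul (v : ℂ)))

lemma BB_conj (n : ℕ) (v : ℝ) (z : ℂ) : BB n v ((starRingEnd ℂ) z) = (starRingEnd ℂ) (BB n v z) := by
  unfold BB; rw [FF_conj, ← Complex.exp_conj]; simp [map_ofNat]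

lemma BB_norm (n : ℕ) (v : ℝ) (z : ℂ) : ‖BB n v z‖ ^ 2 = exp (-(v * (2 * (FF n 0 z).re - 1))) := by
  unfold BB
  have : ((v:ℂ) / 2 - v * FF n 0 z).re = v / 2 - v * (FF n 0 z).re := by
    rw [Complex.sub_re, Complex.re_ofReal_mul, show (v:ℂ) / 2 = ((v / 2 : ℝ) : ℂ) by push_cast; ring, Complex.ofReal_re]
  rw [Complex.norm_exp, this, ← exp_nat_mul]; congr 1; push_cast; ring

lemma BB_zero (n : ℕ) (v : ℝ) : BB n v 0 = (exp (-(v / 2)) : ℝ) := by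
  unfold BB; rw [FF_zero]; push_cast; congr 1; ring

noncomputable def qq (a : ℝ) (N : ℕ) (P : ℝ[X]) (z : ℂ) : ℂ :=
  ∑ j ∈ Finset.range (N + 1), (P.coeff j : ℂ) * ((a / 4 : ℝ) : ℂ) ^ j * (1 + z) ^ (2 * j) * z ^ (N - j)

lemma qq_eval {a : ℝ} {N : ℕ} {P : ℝ[X]} (hP : P.natDegree ≤ N) {z : ℂ} (hz : z ≠ 0) :
    qq a N P z = z ^ N * P.aeval (((a / 4 : ℝ) : ℂ) * (z + 2 + z⁻¹)) := by
  rw [Polynomial.aeval_eq_sum_range' (Nat.lt_succ_of_le hP), Finset.mul_sum]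
  refine Finset.sum_congr rfl fun j hj => ?_
  have hj' : j ≤ N := Nat.lt_succ_iff.mp (Finset.mem_range.mp hj)
  have e : z + 2 + z⁻¹ = (1 + z) ^ 2 * z⁻¹ := by field_simp; ring
  have eG : z ^ N = z ^ (N - j) * z ^ j := by rw [← pow_add, Nat.sub_add_cancel hj']
  have eP : z ^ j * (z⁻¹) ^ j = 1 := by rw [← mul_pow, mul_inv_cancel₀ hz, one_pow]
  rw [e, eG, Algebra.smul_def, mul_pow, mul_pow, ← pow_mul]
  simp only [Complex.coe_algebraMap]
  linear_combination (-(P.coeff j : ℂ) * ((a / 4 : ℝ) : ℂ) ^ j * (1 + z) ^ (2 * j) * z ^ (N - j)) * eP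

lemma qq_circle {a : ℝ} {N : ℕ} {P : ℝ[X]} (hP : P.natDegree ≤ N) (θ : ℝ) :
    qq a N P (eI θ) = eI θ ^ N * ((P.eval (a * cos (θ / 2) ^ 2) : ℝ) : ℂ) := by
  rw [qq_eval hP (eI_ne θ)]
  have : ((a / 4 : ℝ) : ℂ) * (eI θ + 2 + (eI θ)⁻¹) = ((a * cos (θ / 2) ^ 2 : ℝ) : ℂ) := by
    have hO : (eI θ)⁻¹ = eI (-θ) := by rw [inv_eq_iff_eq_inv, eq_comm]; exact inv_eq_of_mul_eq_one_left (eI_mul_neg θ)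
    have hQ : cos (θ / 2) ^ 2 = (1 + cos θ) / 2 := by rw [cos_sq]; ring_nf
    have eA : eI θ + 2 + eI (-θ) = ((2 + 2 * cos θ : ℝ) : ℂ) := by
      apply Complex.ext
      · rw [Complex.ofReal_re]; simp [eI_re]; ring
      · simp [eI_im]
    rw [hO, eA, hQ, ← Complex.ofReal_mul]; congr 1; ring
  rw [this]; congr 1
  exact Polynomial.aeval_ofReal ..

lemma qq_zero {a : ℝ} {N : ℕ} {P : ℝ[X]} : qq a N P 0 = ((P.coeff N * (a / 4) ^ N : ℝ) : ℂ) := by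
  unfold qq
  rw [Finset.sum_eq_single_of_mem N (by simp)]
  · simp
  · intro j hj hne
    have : N - j ≠ 0 := by have := Finset.mem_range.mp hj; omega
    simp [this]

lemma qq_conj (a : ℝ) (N : ℕ) (P : ℝ[X]) (z : ℂ) : qq a N P ((starRingEnd ℂ) z) = (starRingEnd ℂ) (qq a N P z) := by
  unfold qq; simp [map_sum, map_ofNat]

lemma qq_diff (a : ℝ) (N : ℕ) (P : ℝ[X]) : Differentiable ℂ (qq a N P) := by
  unfold qq; fun_prop

noncomputable def kk (eB : ℝ) (z : ℂ) : ℂ := (1 - eB * z)⁻¹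
noncomputable def Ph (n N : ℕ) (v θ : ℝ) : ℂ := eI θ ^ N * (BB n v (eI θ) * ps (eI θ))
noncomputable def EE (n : ℕ) (v a : ℝ) (N : ℕ) (P : ℝ[X]) (z : ℂ) : ℂ := qq a N P z * (BB n v z * ps z)

lemma E_formula {n : ℕ} (hn : 1 ≤ n) (v a : ℝ) {N : ℕ} {P : ℝ[X]} (hP : P.natDegree ≤ N) {eB : ℝ} (eC : |eB| < 1) :
    EE n v a N P eB = ((1 / π * ∫ θ in (0:ℝ)..π, P.eval (a * cos (θ / 2) ^ 2) *
      ((starRingEnd ℂ) (Ph n N v θ) * kk eB (eI θ)).re : ℝ) : ℂ) := by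
  have hd : DiffContOnCl ℂ (EE n v a N P) (Metric.ball 0 1) := by
    have := (qq_diff a N P).diffContOnCl (s := Metric.ball 0 1)
    have hQ := ((BB_diffCont hn v).smul ps_diffCont)
    exact this.smul hQ
  rw [half_cauchy hd (fun z hz => by unfold EE; rw [map_mul, map_mul, ← qq_conj, ← BB_conj, ← ps_conj hz.le]) eC]
  congr 3; ext θ
  have e : (EE n v a N P (eI θ) * (1 - eB * eI (-θ))⁻¹) = (P.eval (a * cos (θ / 2) ^ 2) : ℝ) *
      (starRingEnd ℂ) ((starRingEnd ℂ) (Ph n N v θ) * kk eB (eI θ)) := by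
    unfold EE Ph kk; rw [qq_circle hP, map_mul, Complex.conj_conj, map_inv₀, one_sub_conj]; ring
  rw [e, Complex.re_ofReal_mul, Complex.conj_re]

lemma Ph_cont {n : ℕ} (hn : 1 ≤ n) (N : ℕ) (v : ℝ) : Continuous (Ph n N v) := by
  have hO : ContinuousOn (fun z => BB n v z * ps z) (Metric.closedBall 0 1) := by
    rw [← closure_ball _ one_ne_zero]; exact (BB_diffCont hn v).continuousOn.mul ps_diffCont.continuousOn
  exact (eI_cont.pow N).mul (hO.comp_continuous eI_cont fun θ => by simp [eI_norm])

lemma Ph_norm {n : ℕ} (hn : 1 ≤ n) (N : ℕ) {v a : ℝ} (ha : 0 < a) (hav : a ^ bt n = v * eQ n) {θ : ℝ} (hθ : θ ∈ Set.Icc 0 π) :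
    ‖Ph n N v θ‖ ^ 2 = 2 * sin θ * exp (-(a * cos (θ / 2) ^ 2) ^ bt n) := by
  unfold Ph
  rw [norm_mul, norm_pow, eI_norm, one_pow, one_mul, norm_mul, mul_pow, BB_norm, ps_norm_eI hθ, yv_eq hn hθ, mul_comm]
  congr 3
  have hc : 0 ≤ cos (θ / 2) := cos_nonneg_of_mem_Icc ⟨by linarith [hθ.1, pi_pos], by linarith [hθ.2]⟩
  rw [mul_rpow ha.le (by positivity), hav, ← rpow_natCast _ 2, ← rpow_mul hc,
    show ((2:ℕ):ℝ) * bt n = ((2 * n + 1 : ℕ) : ℝ) by unfold bt; push_cast; ring, rpow_natCast]; ring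

lemma poly_int {b : ℝ} (hb : 0 < b) (P : ℝ[X]) : IntegrableOn (fun x => P.eval x * exp (-(x ^ b))) (Set.Ioi 0) := by
  have h : ∀ x : ℝ, P.eval x * exp (-(x ^ b)) = ∑ i ∈ Finset.range (P.natDegree + 1), P.coeff i * (x ^ (i:ℝ) * exp (-(x ^ b))) := by
    intro x
    rw [Polynomial.eval_eq_sum_range, Finset.sum_mul]
    exact Finset.sum_congr rfl fun i _ => by rw [rpow_natCast]; ring
  simp_rw [h]
  refine integrable_finsetSum _ fun i _ => Integrable.const_mul ?_ _
  have hQ := integrableOn_rpow_mul_exp_neg_rpow (p := b) (s := (i:ℝ)) (by have : (0:ℝ) ≤ i := by positivity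
                                                                          linarith) hb
  exact hQ

lemma cov_in {a : ℝ} (ha : 0 < a) {G : ℝ → ℝ} :
    ∫ x in Set.Ioc 0 a, G x = ∫ θ in (0:ℝ)..π, a / 2 * sin θ * G (a * cos (θ / 2) ^ 2) := by
  have himg : (fun θ : ℝ => a * cos (θ / 2) ^ 2) '' Set.Ioo 0 π = Set.Ioo 0 a := by
    ext x; constructor
    · rintro ⟨θ, hθ, rfl⟩
      have hO := cos_half_pos hθ.1.le hθ.2
      have hQ : 0 < sin (θ / 2) := sin_pos_of_pos_of_lt_pi (by linarith [hθ.1]) (by linarith [hθ.2, pi_pos])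
      have eA := sin_sq_add_cos_sq (θ / 2)
      refine ⟨by positivity, ?_⟩
      show a * cos (θ / 2) ^ 2 < a
      have eH : 0 < sin (θ / 2) ^ 2 := by positivity
      nlinarith
    · rintro ⟨hO, hQ⟩
      have eC : 0 < x / a := by positivity
      have h01 : x / a < 1 := by rw [div_lt_one ha]; exact hQ
      have eA : √(x / a) < 1 := by rw [sqrt_lt' one_pos]; simpa using h01
      have eH : 0 < √(x / a) := sqrt_pos.mpr eC
      refine ⟨2 * arccos √(x / a), ⟨by have := arccos_pos.mpr eA; linarith, by have := arccos_lt_pi_div_two.mpr eH; linarith⟩, ?_⟩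
      show a * cos (2 * arccos √(x / a) / 2) ^ 2 = x
      rw [mul_div_cancel_left₀ _ two_ne_zero, cos_arccos (by linarith) eA.le, sq_sqrt eC.le]; field_simp
  have hinj : Set.InjOn (fun θ : ℝ => a * cos (θ / 2) ^ 2) (Set.Ioo 0 π) := by
    intro x hx y hy hxy
    have hO := cos_half_pos hx.1.le hx.2
    have hQ := cos_half_pos hy.1.le hy.2
    have eA : cos (x / 2) ^ 2 = cos (y / 2) ^ 2 := mul_left_cancel₀ ha.ne' hxy
    have eH : cos (x / 2) = cos (y / 2) := by
      rw [pow_left_inj₀ hO.le hQ.le two_ne_zero] at eA; exact eA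
    have := injOn_cos ⟨by linarith [hx.1], by linarith [hx.2, pi_pos]⟩ ⟨by linarith [hy.1], by linarith [hy.2, pi_pos]⟩ eH
    linarith
  have hder : ∀ θ ∈ Set.Ioo 0 π, HasDerivWithinAt (fun θ : ℝ => a * cos (θ / 2) ^ 2) (-(a / 2 * sin θ)) (Set.Ioo 0 π) θ := by
    intro θ _
    have hO : HasDerivAt (fun θ : ℝ => cos (θ / 2)) (-sin (θ / 2) * (1 / 2)) θ := ((hasDerivAt_id θ).div_const 2).cos
    refine ((hO.pow 2).const_mul a).hasDerivWithinAt.congr_deriv ?_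
    have : sin θ = 2 * sin (θ / 2) * cos (θ / 2) := by rw [← sin_two_mul]; congr 1; ring
    rw [this]; push_cast; ring
  have h := integral_image_eq_integral_abs_deriv_smul measurableSet_Ioo hder hinj G
  rw [himg] at h
  rw [integral_Ioc_eq_integral_Ioo, h, intervalIntegral.integral_of_le pi_pos.le, integral_Ioc_eq_integral_Ioo]
  refine setIntegral_congr_fun measurableSet_Ioo fun θ hθ => ?_
  have := sin_pos_of_mem_Ioo hθ
  simp only [abs_neg, smul_eq_mul]; rw [abs_of_pos (by positivity)]

lemma compare {n : ℕ} (hn : 1 ≤ n) {v a : ℝ} (ha : 0 < a) (hav : a ^ bt n = v * eQ n) {N : ℕ} {P p : ℝ[X]} (hP : P.natDegree ≤ N)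
    (hPn : ∫ x in Set.Ioi (0:ℝ), P.eval x ^ 2 * exp (-(x ^ bt n)) = 1) {eB : ℝ} (eC : |eB| < 1)
    {H : ℂ → ℂ} (hH : Continuous H)
    (hp : ∀ θ, p.eval (a * cos (θ / 2) ^ 2) = 2 * (2 / (a * π)) * ((starRingEnd ℂ) (eI θ ^ N) * H (eI θ)).re)
    {κ : ℝ} (hκ : 0 < κ)
    (hV : ∫ θ in (0:ℝ)..π, ‖H (eI θ) * (BB n v (eI θ) * ps (eI θ)) - kk eB (eI θ)‖ ^ 2 ≤ κ ^ 2)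
    (hT : ∫ x in Set.Ioi a, p.eval x ^ 2 * exp (-(x ^ bt n)) ≤ 2 / (a * π) * κ ^ 2) :
    |(EE n v a N P eB).re - ∫ x in Set.Ioi (0:ℝ), P.eval x * p.eval x * exp (-(x ^ bt n))| ≤ 2 * κ * √(2 / (a * π)) := by
  have hpi := pi_pos
  have hbp := bt_pos n
  have hint : ∀ Q : ℝ[X], IntegrableOn (fun x => Q.eval x * exp (-(x ^ bt n))) (Set.Ioi 0) := poly_int hbp
  have hsub1 : Set.Ioc 0 a ⊆ Set.Ioi 0 := fun x hx => hx.1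
  have hsub2 : Set.Ioi a ⊆ Set.Ioi 0 := fun x hx => ha.trans hx
  have hsplit : ∀ Q : ℝ[X], ∫ x in Set.Ioi (0:ℝ), Q.eval x * exp (-(x ^ bt n)) = (∫ x in Set.Ioc 0 a, Q.eval x * exp (-(x ^ bt n))) + ∫ x in Set.Ioi a, Q.eval x * exp (-(x ^ bt n)) := by
    intro Q
    rw [← Set.Ioc_union_Ioi_eq_Ioi ha.le, setIntegral_union (Set.Ioc_disjoint_Ioi le_rfl) measurableSet_Ioi ((hint Q).mono_set hsub1) ((hint Q).mono_set hsub2)]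
  have hPhi : ∀ Q : ℝ[X], ∫ x in Set.Ioc 0 a, Q.eval x * exp (-(x ^ bt n)) = a / 4 * ∫ θ in (0:ℝ)..π, Q.eval (a * cos (θ / 2) ^ 2) * ‖Ph n N v θ‖ ^ 2 := by
    intro Q
    rw [cov_in ha, ← intervalIntegral.integral_const_mul]
    refine intervalIntegral.integral_congr fun θ hθ => ?_
    rw [Set.uIcc_of_le hpi.le] at hθ
    simp only [Ph_norm hn N ha hav hθ]; ring
  have hPc := Ph_cont hn N v
  have hQc : ∀ Q : ℝ[X], Continuous fun θ : ℝ => Q.eval (a * cos (θ / 2) ^ 2) := fun Q => by fun_prop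
  have hec := eI_cont
  have hkc : Continuous fun θ => kk eB (eI θ) := Continuous.inv₀ (by fun_prop) fun θ => one_sub_ne eC θ
  have hbc : Continuous fun θ => BB n v (eI θ) * ps (eI θ) := by
    have := Ph_cont hn 0 v; unfold Ph at this; simpa using this
  have huc : Continuous fun θ => H (eI θ) * (BB n v (eI θ) * ps (eI θ)) - kk eB (eI θ) :=
    ((hH.comp hec).mul hbc).sub hkc
  set V : ℝ → ℂ := fun θ => H (eI θ) * (BB n v (eI θ) * ps (eI θ)) - kk eB (eI θ) with hVdef
  have key : ∀ θ, P.eval (a * cos (θ / 2) ^ 2) * ((starRingEnd ℂ) (Ph n N v θ) * kk eB (eI θ)).re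
      = (a * π / 4) * ((P * p).eval (a * cos (θ / 2) ^ 2) * ‖Ph n N v θ‖ ^ 2) - P.eval (a * cos (θ / 2) ^ 2) * ((starRingEnd ℂ) (Ph n N v θ) * V θ).re := by
    intro θ
    have e : ((starRingEnd ℂ) (Ph n N v θ) * (H (eI θ) * (BB n v (eI θ) * ps (eI θ)))) = (‖Ph n N v θ‖ ^ 2 : ℝ) * ((starRingEnd ℂ) (eI θ ^ N) * H (eI θ)) := by
      have eF : (starRingEnd ℂ) (eI θ ^ N) * eI θ ^ N = 1 := by
        rw [Complex.conj_mul', norm_pow, eI_norm]; simp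
      have eG := Complex.conj_mul' (Ph n N v θ)
      push_cast; rw [← eG]; unfold Ph; rw [map_mul]
      linear_combination (-((starRingEnd ℂ) (eI θ ^ N) * (starRingEnd ℂ) (BB n v (eI θ) * ps (eI θ)) * (H (eI θ) * (BB n v (eI θ) * ps (eI θ))))) * eF
    have eP := congrArg Complex.re e
    rw [Complex.re_ofReal_mul] at eP
    simp only [hVdef]
    rw [mul_sub, Complex.sub_re, eP, Polynomial.eval_mul, hp θ]; field_simp; ring
  have hE : (EE n v a N P eB).re = (∫ x in Set.Ioc 0 a, (P * p).eval x * exp (-(x ^ bt n))) - 1 / π * ∫ θ in (0:ℝ)..π, P.eval (a * cos (θ / 2) ^ 2) * ((starRingEnd ℂ) (Ph n N v θ) * V θ).re := by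
    rw [E_formula hn v a hP eC, Complex.ofReal_re]
    simp_rw [key]
    rw [intervalIntegral.integral_sub, intervalIntegral.integral_const_mul, hPhi]
    · field_simp
    · exact (continuous_const.mul ((hQc _).mul (hPc.norm.pow 2))).intervalIntegrable _ _
    · exact ((hQc _).mul (Complex.continuous_re.comp ((Complex.continuous_conj.comp hPc).mul huc))).intervalIntegrable _ _
  have hPP : ∀ x, P.eval x ^ 2 * exp (-(x ^ bt n)) = (P * P).eval x * exp (-(x ^ bt n)) := fun x => by rw [Polynomial.eval_mul]; ring
  have hpp : ∀ x, p.eval x ^ 2 * exp (-(x ^ bt n)) = (p * p).eval x * exp (-(x ^ bt n)) := fun x => by rw [Polynomial.eval_mul]; ring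
  have hnn : ∀ Q : ℝ[X], ∀ x, 0 ≤ (Q * Q).eval x * exp (-(x ^ bt n)) := fun Q x => by
    rw [Polynomial.eval_mul]; exact mul_nonneg (mul_self_nonneg _) (exp_pos _).le
  simp_rw [hPP] at hPn
  simp_rw [hpp] at hT
  have hs1 := hsplit (P * P)
  rw [hPn] at hs1
  have gO : 0 ≤ ∫ x in Set.Ioc 0 a, (P * P).eval x * exp (-(x ^ bt n)) := integral_nonneg (hnn P)
  have n2 : 0 ≤ ∫ x in Set.Ioi a, (P * P).eval x * exp (-(x ^ bt n)) := integral_nonneg (hnn P)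
  set μ := 2 / (a * π) with hμ
  have hμp : 0 < μ := by positivity
  have ht : |∫ x in Set.Ioi a, (P * p).eval x * exp (-(x ^ bt n))| ≤ κ * √μ := by
    set s := κ * √μ with hs
    have hsp : 0 < s := by positivity
    have hs2 : s ^ 2 = κ ^ 2 * μ := by rw [hs, mul_pow, sq_sqrt hμp.le]
    calc _ ≤ ∫ x in Set.Ioi a, (s / 2 * ((P * P).eval x * exp (-(x ^ bt n))) + 1 / (2 * s) * ((p * p).eval x * exp (-(x ^ bt n)))) := by
          rw [← norm_eq_abs]
          refine norm_integral_le_of_norm_le ((((hint _).mono_set hsub2).const_mul _).add (((hint _).mono_set hsub2).const_mul _)) (ae_of_all _ fun x => ?_)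
          have hw := exp_pos (-(x ^ bt n))
          rw [norm_mul, norm_of_nonneg hw.le, Polynomial.eval_mul, Polynomial.eval_mul, Polynomial.eval_mul, norm_mul, norm_eq_abs, norm_eq_abs]
          have : |P.eval x| * |p.eval x| ≤ s / 2 * (P.eval x * P.eval x) + 1 / (2 * s) * (p.eval x * p.eval x) := by
            rw [← abs_mul_abs_self (P.eval x), ← abs_mul_abs_self (p.eval x)]
            generalize |P.eval x| = A
            generalize |p.eval x| = B
            have : s / 2 * (A * A) + 1 / (2 * s) * (B * B) - A * B = (s * A - B) ^ 2 / (2 * s) := by field_simp; ring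
            have : 0 ≤ (s * A - B) ^ 2 / (2 * s) := by positivity
            linarith
          calc _ ≤ (s / 2 * (P.eval x * P.eval x) + 1 / (2 * s) * (p.eval x * p.eval x)) * exp (-(x ^ bt n)) := mul_le_mul_of_nonneg_right this hw.le
            _ = _ := by ring
      _ = s / 2 * (∫ x in Set.Ioi a, (P * P).eval x * exp (-(x ^ bt n))) + 1 / (2 * s) * ∫ x in Set.Ioi a, (p * p).eval x * exp (-(x ^ bt n)) := by
          rw [integral_add (((hint _).mono_set hsub2).const_mul _) (((hint _).mono_set hsub2).const_mul _), integral_const_mul, integral_const_mul]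
      _ ≤ s / 2 * 1 + 1 / (2 * s) * (μ * κ ^ 2) := by gcongr; linarith
      _ = s := by rw [mul_comm μ, ← hs2]; field_simp; ring
  have hm : |1 / π * ∫ θ in (0:ℝ)..π, P.eval (a * cos (θ / 2) ^ 2) * ((starRingEnd ℂ) (Ph n N v θ) * V θ).re| ≤ κ * √μ := by
    have hsa : 0 < √a := sqrt_pos.mpr ha
    have hsa2 : √a ^ 2 = a := sq_sqrt ha.le
    set s := κ * √a / 2 with hs
    have hsp : 0 < s := by positivity
    have hc1 : Continuous fun θ => s / 2 * ((P * P).eval (a * cos (θ / 2) ^ 2) * ‖Ph n N v θ‖ ^ 2) := continuous_const.mul ((hQc _).mul (hPc.norm.pow 2))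
    have gV : Continuous fun θ => 1 / (2 * s) * ‖V θ‖ ^ 2 := continuous_const.mul (huc.norm.pow 2)
    have : |∫ θ in (0:ℝ)..π, P.eval (a * cos (θ / 2) ^ 2) * ((starRingEnd ℂ) (Ph n N v θ) * V θ).re| ≤ 2 * κ / √a := by
      calc _ ≤ ∫ θ in (0:ℝ)..π, (s / 2 * ((P * P).eval (a * cos (θ / 2) ^ 2) * ‖Ph n N v θ‖ ^ 2) + 1 / (2 * s) * ‖V θ‖ ^ 2) := by
            rw [← norm_eq_abs]
            refine intervalIntegral.norm_integral_le_of_norm_le hpi.le (ae_of_all _ fun θ _ => ?_) ((hc1.add gV).intervalIntegrable _ _)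
            have hO : ‖((starRingEnd ℂ) (Ph n N v θ) * V θ).re‖ ≤ ‖Ph n N v θ‖ * ‖V θ‖ := by
              refine (Complex.abs_re_le_norm _).trans ?_; rw [norm_mul, RCLike.norm_conj]
            rw [norm_mul, Polynomial.eval_mul]
            refine (mul_le_mul_of_nonneg_left hO (norm_nonneg _)).trans ?_
            rw [← abs_mul_abs_self (P.eval _), norm_eq_abs]
            generalize |P.eval (a * cos (θ / 2) ^ 2)| = A
            generalize ‖Ph n N v θ‖ = B
            generalize ‖V θ‖ = C
            have : s / 2 * (A * A * B ^ 2) + 1 / (2 * s) * C ^ 2 - A * (B * C) = (s * A * B - C) ^ 2 / (2 * s) := by field_simp; ring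
            have : 0 ≤ (s * A * B - C) ^ 2 / (2 * s) := by positivity
            linarith
        _ = s / 2 * (∫ θ in (0:ℝ)..π, (P * P).eval (a * cos (θ / 2) ^ 2) * ‖Ph n N v θ‖ ^ 2) + 1 / (2 * s) * ∫ θ in (0:ℝ)..π, ‖V θ‖ ^ 2 := by
            rw [intervalIntegral.integral_add (hc1.intervalIntegrable _ _) (gV.intervalIntegrable _ _), intervalIntegral.integral_const_mul, intervalIntegral.integral_const_mul]
        _ ≤ s / 2 * (4 / a) + 1 / (2 * s) * κ ^ 2 := by
            gcongr
            have := hPhi (P * P)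
            rw [le_div_iff₀ ha]; linarith
        _ = 2 * κ / √a := by rw [hs]; nth_rewrite 2 [← hsa2]; field_simp; ring
    have e : √μ = √(2 * π) / (π * √a) := by
      rw [hμ, sqrt_eq_iff_mul_self_eq_of_pos (by positivity)]
      have : √(2 * π) * √(2 * π) = 2 * π := mul_self_sqrt (by positivity)
      rw [div_mul_div_comm, this, show π * √a * (π * √a) = π * π * √a ^ 2 by ring, hsa2]; field_simp
    have hQ : 2 ≤ √(2 * π) := le_sqrt_of_sq_le (by nlinarith [pi_gt_three])
    rw [abs_mul, abs_of_pos (by positivity), e]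
    calc 1 / π * _ ≤ 1 / π * (2 * κ / √a) := by gcongr
      _ = κ * (2 / (π * √a)) := by field_simp
      _ ≤ _ := by gcongr
  have hs3 := hsplit (P * p)
  simp_rw [Polynomial.eval_mul] at hs3 ht hE
  rw [hs3, hE]
  rw [abs_le] at hm ht ⊢
  constructor <;> linarith [hm.1, hm.2, ht.1, ht.2]

/-- single cell estimate -/
lemma cell {ρ : ℝ → ℝ} (hρ : Continuous ρ) {s t : ℝ} (hst : s ≤ t) (hpos : ∀ x ∈ Set.Icc s t, 0 ≤ ρ x)
    (hm : ∫ x in s..t, ρ x = 1) :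
    ∃ α ∈ Set.Icc s t, ∀ f f' f'' : ℝ → ℂ, (∀ x, HasDerivAt f (f' x) x) → (∀ x, HasDerivAt f' (f'' x) x) → Continuous f'' →
      ‖f α - ∫ x in s..t, f x * ρ x‖ ≤ ∫ x in s..t, ‖f' x‖ ∧
      ‖f α - ∫ x in s..t, f x * ρ x‖ ≤ (t - s) * ∫ x in s..t, ‖f'' x‖ := by
  set α := ∫ x in s..t, x * ρ x with hα
  have hxc : Continuous fun x => x * ρ x := by fun_prop
  have hαm : α ∈ Set.Icc s t := by
    constructor
    · calc s = ∫ x in s..t, s * ρ x := by rw [intervalIntegral.integral_const_mul, hm, mul_one]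
        _ ≤ α := intervalIntegral.integral_mono_on hst ((continuous_const.mul hρ).intervalIntegrable _ _) (hxc.intervalIntegrable _ _)
            fun x hx => mul_le_mul_of_nonneg_right hx.1 (hpos x hx)
    · calc α ≤ ∫ x in s..t, t * ρ x := intervalIntegral.integral_mono_on hst (hxc.intervalIntegrable _ _) ((continuous_const.mul hρ).intervalIntegrable _ _)
            fun x hx => mul_le_mul_of_nonneg_right hx.2 (hpos x hx)
        _ = t := by rw [intervalIntegral.integral_const_mul, hm, mul_one]
  have hmC : ∫ x in s..t, (ρ x : ℂ) = 1 := by rw [intervalIntegral.integral_ofReal, hm]; simp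
  have hρC : Continuous fun x => (ρ x : ℂ) := by fun_prop
  have avg : ∀ (g : ℝ → ℂ), Continuous g → ∀ B : ℝ, (∀ x ∈ Set.Icc s t, ‖g x‖ ≤ B) → ‖∫ x in s..t, g x * ρ x‖ ≤ B := by
    intro g hg B hB
    calc _ ≤ ∫ x in s..t, B * ρ x := by
          refine intervalIntegral.norm_integral_le_of_norm_le hst (ae_of_all _ fun x hx => ?_) ((continuous_const.mul hρ).intervalIntegrable _ _)
          have hx' : x ∈ Set.Icc s t := ⟨hx.1.le, hx.2⟩
          rw [norm_mul, Complex.norm_real, norm_of_nonneg (hpos x hx')]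
          exact mul_le_mul_of_nonneg_right (hB x hx') (hpos x hx')
      _ = B := by rw [intervalIntegral.integral_const_mul, hm, mul_one]
  refine ⟨α, hαm, fun f f' f'' hO hQ eA => ?_⟩
  have hfc : Continuous f := continuous_iff_continuousAt.mpr fun x => (hO x).continuousAt
  have hfc' : Continuous f' := continuous_iff_continuousAt.mpr fun x => (hQ x).continuousAt
  have sub : ∀ (g : ℝ → ℝ), Continuous g → (∀ x, 0 ≤ g x) → ∀ x ∈ Set.Icc s t, ∀ y ∈ Set.Icc s t, |∫ z in x..y, g z| ≤ ∫ z in s..t, g z := by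
    intro g hg hg0 x hx y hy
    wlog hxy : x ≤ y generalizing x y
    · rw [intervalIntegral.integral_symm, abs_neg]; exact this y hy x hx (le_of_not_ge hxy)
    rw [abs_of_nonneg (intervalIntegral.integral_nonneg hxy fun z _ => hg0 z)]
    exact intervalIntegral.integral_mono_interval hx.1 hxy hy.2 (ae_of_all _ hg0) (hg.intervalIntegrable _ _)
  have dif : ∀ (g g' : ℝ → ℂ), (∀ x, HasDerivAt g (g' x) x) → Continuous g' → ∀ x ∈ Set.Icc s t, ∀ y ∈ Set.Icc s t, ‖g y - g x‖ ≤ ∫ z in s..t, ‖g' z‖ := by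
    intro g g' hg hg' x hx y hy
    rw [← intervalIntegral.integral_eq_sub_of_hasDerivAt (fun z _ => hg z) (hg'.intervalIntegrable _ _)]
    exact (intervalIntegral.norm_integral_le_abs_integral_norm).trans (sub _ hg'.norm (fun z => norm_nonneg _) x hx y hy)
  have id1 : f α - ∫ x in s..t, f x * ρ x = ∫ x in s..t, (f α - f x) * ρ x := by
    simp_rw [sub_mul]
    rw [intervalIntegral.integral_sub ((by fun_prop : Continuous fun x => f α * (ρ x:ℂ)).intervalIntegrable _ _) ((by fun_prop : Continuous fun x => f x * (ρ x:ℂ)).intervalIntegrable _ _), intervalIntegral.integral_const_mul, hmC, mul_one]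
  constructor
  · rw [id1]
    exact avg _ (by fun_prop) _ fun x hx => dif f f' hO hfc' x hx α hαm
  · have id2 : ∫ x in s..t, (f α - f x) * ρ x = ∫ x in s..t, (f α - f x - f' α * (α - x)) * ρ x := by
      have : ∫ x in s..t, f' α * ((α:ℂ) - x) * ρ x = 0 := by
        simp_rw [mul_assoc, sub_mul]
        rw [intervalIntegral.integral_const_mul, intervalIntegral.integral_sub ((by fun_prop : Continuous fun x => (α:ℂ) * (ρ x:ℂ)).intervalIntegrable _ _) ((by fun_prop : Continuous fun x : ℝ => (x:ℂ) * (ρ x:ℂ)).intervalIntegrable _ _), intervalIntegral.integral_const_mul, hmC]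
        have : ∫ x in s..t, (x:ℂ) * ρ x = (α : ℂ) := by
          rw [hα, ← intervalIntegral.integral_ofReal]; congr 1; ext x; push_cast; ring
        rw [this]; ring
      simp_rw [sub_mul _ (f' α * _)]
      rw [intervalIntegral.integral_sub ((by fun_prop : Continuous fun x => (f α - f x) * (ρ x:ℂ)).intervalIntegrable _ _) ((by fun_prop : Continuous fun x : ℝ => f' α * ((α:ℂ) - x) * ρ x).intervalIntegrable _ _), this, sub_zero]
    rw [id1, id2]
    refine avg _ (by fun_prop) _ fun x hx => ?_
    set B := ∫ z in s..t, ‖f'' z‖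
    have hB : 0 ≤ B := intervalIntegral.integral_nonneg hst fun _ _ => norm_nonneg _
    have hk : ∀ z, HasDerivAt (fun z : ℝ => f z - f' α * z) (f' z - f' α) z := fun z => by
      have := (hO z).sub ((Complex.ofRealCLM.hasDerivAt (x := z)).const_mul (f' α))
      exact this.congr_deriv (by simp)
    have := (convex_Icc s t).norm_image_sub_le_of_norm_hasDerivWithin_le (f := fun z : ℝ => f z - f' α * z) (f' := fun z => f' z - f' α) (C := B)
      (fun z _ => (hk z).hasDerivWithinAt) (fun z hz => dif f' f'' hQ eA α hαm z hz) hx hαm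
    have e : f α - f x - f' α * (α - x) = f α - f' α * α - (f x - f' α * x) := by ring
    rw [e]
    refine this.trans ?_
    rw [mul_comm]; refine mul_le_mul_of_nonneg_right ?_ hB
    rw [norm_eq_abs, abs_le]; constructor <;> linarith [hx.1, hx.2, hαm.1, hαm.2]

lemma discretize {ρ : ℝ → ℝ} (hρ : Continuous ρ) {ρ0 ρ1 δ : ℝ} (hρ0 : 0 < ρ0) (hρ1 : 0 < ρ1)
    (eC : ∀ x ∈ Set.Icc 0 π, ρ0 ≤ ρ x) (hO : ∀ x ∈ Set.Icc δ π, ρ1 ≤ ρ x) (hd : 1 / ρ0 ≤ δ / 2) {Nc : ℕ}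
    (hm : ∫ x in (0:ℝ)..π, ρ x = Nc) :
    ∃ α : ℕ → ℝ, ∀ f f' f'' : ℝ → ℂ, (∀ x, HasDerivAt f (f' x) x) → (∀ x, HasDerivAt f' (f'' x) x) → Continuous f'' →
      ‖∑ j ∈ Finset.range Nc, f (α j) - ∫ x in (0:ℝ)..π, f x * ρ x‖ ≤ ∫ x in (0:ℝ)..π, ‖f' x‖ ∧
      ∀ G, 0 ≤ G → (∀ x ∈ Set.Icc 0 (3 * δ / 2), ‖f'' x‖ ≤ G) →
      ‖∑ j ∈ Finset.range Nc, f (α j) - ∫ x in (0:ℝ)..π, f x * ρ x‖ ≤ 1 / ρ1 * (∫ x in (0:ℝ)..π, ‖f'' x‖) + 1 / ρ0 * G * π := by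
  have hpi := pi_pos
  set R : ℝ → ℝ := fun t => ∫ x in (0:ℝ)..t, ρ x with hR
  have hii : ∀ a b : ℝ, IntervalIntegrable ρ volume a b := fun a b => hρ.intervalIntegrable _ _
  have hRd : ∀ s ∈ Set.Icc 0 π, ∀ t ∈ Set.Icc 0 π, R t - R s = ∫ x in s..t, ρ x := fun s _ t _ =>
    intervalIntegral.integral_interval_sub_left (hii _ _) (hii _ _)
  have hlow : ∀ s ∈ Set.Icc 0 π, ∀ t ∈ Set.Icc 0 π, s ≤ t → ρ0 * (t - s) ≤ R t - R s := by
    intro s hs t ht hst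
    rw [hRd s hs t ht]
    calc ρ0 * (t - s) = ∫ x in s..t, ρ0 := by simp; ring
      _ ≤ _ := intervalIntegral.integral_mono_on hst intervalIntegrable_const (hii _ _) fun x hx => eC x ⟨hs.1.trans hx.1, hx.2.trans ht.2⟩
  have hRc : Continuous R := intervalIntegral.continuous_primitive hii 0
  have hiv : ∀ j : ℕ, ∃ t ∈ Set.Icc 0 π, j ≤ Nc → R t = j := by
    intro j
    by_cases hj : j ≤ Nc
    · have := intermediate_value_Icc hpi.le hRc.continuousOn
      have hQ : (j:ℝ) ∈ Set.Icc (R 0) (R π) := by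
        simp only [hR, hm, intervalIntegral.integral_same]; exact ⟨by positivity, by exact_mod_cast hj⟩
      obtain ⟨t, ht, h⟩ := this hQ
      exact ⟨t, ht, fun _ => h⟩
    · exact ⟨0, ⟨le_rfl, hpi.le⟩, fun h => absurd h hj⟩
  choose t ht hRt using hiv
  have hmono : ∀ s ∈ Set.Icc 0 π, ∀ t ∈ Set.Icc 0 π, R s ≤ R t → s ≤ t := by
    intro s hs t ht h
    by_contra hc
    have := hlow t ht s hs (not_le.mp hc).le
    nlinarith
  have hle : ∀ j, j < Nc → t j ≤ t (j + 1) := fun j hj => hmono _ (ht _) _ (ht _) (by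
    rw [hRt j hj.le, hRt (j+1) hj]; push_cast; linarith)
  have ht0 : t 0 = 0 := by
    refine le_antisymm (hmono _ (ht _) _ ⟨le_rfl, hpi.le⟩ ?_) (ht 0).1
    rw [hRt 0 (Nat.zero_le _)]; simp [hR]
  have htN : t Nc = π := by
    refine le_antisymm (ht _).2 (hmono _ ⟨hpi.le, le_rfl⟩ _ (ht _) ?_)
    rw [hRt Nc le_rfl]; simp only [hR, hm]; exact le_rfl
  have hcell : ∀ j, ∃ α : ℝ, j < Nc → ∀ f f' f'' : ℝ → ℂ, (∀ x, HasDerivAt f (f' x) x) → (∀ x, HasDerivAt f' (f'' x) x) → Continuous f'' →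
      ‖f α - ∫ x in t j..t (j+1), f x * ρ x‖ ≤ ∫ x in t j..t (j+1), ‖f' x‖ ∧
      ‖f α - ∫ x in t j..t (j+1), f x * ρ x‖ ≤ (t (j+1) - t j) * ∫ x in t j..t (j+1), ‖f'' x‖ := by
    intro j
    by_cases hj : j < Nc
    · obtain ⟨α, _, h⟩ := cell hρ (hle j hj) (fun x hx => hρ0.le.trans (eC x ⟨(ht j).1.trans hx.1, hx.2.trans (ht _).2⟩)) (by
        rw [← hRd _ (ht _) _ (ht _), hRt j hj.le, hRt (j+1) hj]; push_cast; ring)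
      exact ⟨α, fun _ => h⟩
    · exact ⟨0, fun h => absurd h hj⟩
  choose α hα using hcell
  refine ⟨α, fun f f' f'' d1 d2 d3 => ?_⟩
  have hfc : Continuous f := continuous_iff_continuousAt.mpr fun x => (d1 x).continuousAt
  have hfc' : Continuous f' := continuous_iff_continuousAt.mpr fun x => (d2 x).continuousAt
  have hsum : ∀ {E : Type} [NormedAddCommGroup E] [NormedSpace ℝ E] (g : ℝ → E), Continuous g → ∫ x in (0:ℝ)..π, g x = ∑ j ∈ Finset.range Nc, ∫ x in t j..t (j+1), g x := by
    intro E _ _ g hg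
    rw [intervalIntegral.sum_integral_adjacent_intervals fun k _ => hg.intervalIntegrable _ _, ht0, htN]
  have hmain : ‖∑ j ∈ Finset.range Nc, f (α j) - ∫ x in (0:ℝ)..π, f x * ρ x‖ ≤ ∑ j ∈ Finset.range Nc, ‖f (α j) - ∫ x in t j..t (j+1), f x * ρ x‖ := by
    rw [hsum (fun x => f x * ρ x) (by fun_prop), ← Finset.sum_sub_distrib]; exact norm_sum_le _ _
  constructor
  · refine hmain.trans ?_
    rw [hsum (fun x => ‖f' x‖) hfc'.norm]
    exact Finset.sum_le_sum fun j hj => (hα j (Finset.mem_range.mp hj) f f' f'' d1 d2 d3).1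
  · intro G hG hGb
    refine hmain.trans ?_
    have hpi' : π = ∑ j ∈ Finset.range Nc, (t (j+1) - t j) := by rw [Finset.sum_range_sub, ht0, htN, sub_zero]
    nth_rewrite 2 [hpi']
    rw [hsum (fun x => ‖f'' x‖) d3.norm, Finset.mul_sum, Finset.mul_sum, ← Finset.sum_add_distrib]
    refine Finset.sum_le_sum fun j hj => ?_
    have hj' := Finset.mem_range.mp hj
    refine (hα j hj' f f' f'' d1 d2 d3).2.trans ?_
    have hl := hle j hj'
    have hn : 0 ≤ ∫ x in t j..t (j+1), ‖f'' x‖ := intervalIntegral.integral_nonneg hl fun _ _ => norm_nonneg _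
    have hone : R (t (j+1)) - R (t j) = 1 := by rw [hRt j hj'.le, hRt (j+1) hj']; push_cast; ring
    have hlen : t (j+1) - t j ≤ 1 / ρ0 := by
      have := hlow _ (ht j) _ (ht (j+1)) hl
      rw [hone] at this; rw [le_div_iff₀ hρ0]; linarith
    have hrho0 : 0 < 1 / ρ0 := by positivity
    have hrho1 : 0 < 1 / ρ1 := by positivity
    by_cases hc : δ ≤ t j
    · have : t (j+1) - t j ≤ 1 / ρ1 := by
        have : ρ1 * (t (j+1) - t j) ≤ 1 := by
          rw [← hone, hRd _ (ht _) _ (ht _)]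
          calc ρ1 * (t (j+1) - t j) = ∫ x in t j..t (j+1), ρ1 := by simp; ring
            _ ≤ _ := intervalIntegral.integral_mono_on hl intervalIntegrable_const (hii _ _) fun x hx => hO x ⟨hc.trans hx.1, hx.2.trans (ht _).2⟩
        rw [le_div_iff₀ hρ1]; linarith
      have eA : 0 ≤ 1 / ρ0 * G * (t (j+1) - t j) := by have : 0 ≤ t (j+1) - t j := by linarith
                                                       positivity
      nlinarith
    · have : ∫ x in t j..t (j+1), ‖f'' x‖ ≤ G * (t (j+1) - t j) := by
        calc _ ≤ ∫ x in t j..t (j+1), G := intervalIntegral.integral_mono_on hl (d3.norm.intervalIntegrable _ _) intervalIntegrable_const fun x hx => hGb x ⟨(ht j).1.trans hx.1, by linarith [hx.2]⟩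
          _ = _ := by simp; ring
      have eH : 0 ≤ 1 / ρ1 * ∫ x in t j..t (j+1), ‖f'' x‖ := by positivity
      calc _ ≤ 1 / ρ0 * (G * (t (j+1) - t j)) := mul_le_mul hlen this hn hrho0.le
        _ ≤ _ := by linarith

noncomputable def fz (z : ℂ) (α : ℝ) : ℂ := Complex.log (1 - z * eI α) + Complex.log (1 - z * eI (-α))
noncomputable def gI (z : ℂ) (α : ℝ) : ℂ :=
  -(Complex.I * (z * eI α * (1 - z * eI α)⁻¹)) + Complex.I * (z * eI (-α) * (1 - z * eI (-α))⁻¹)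
noncomputable def gF (z : ℂ) (α : ℝ) : ℂ :=
  z * eI α * ((1 - z * eI α)⁻¹) ^ 2 + z * eI (-α) * ((1 - z * eI (-α))⁻¹) ^ 2

lemma eI_deriv (θ : ℝ) : HasDerivAt eI (Complex.I * eI θ) θ := by
  have h := ((Complex.ofRealCLM.hasDerivAt (x := θ)).mul_const Complex.I).cexp
  exact h.congr_deriv (by simp [eI]; ring)

lemma eI_deriv_neg (θ : ℝ) : HasDerivAt (fun x => eI (-x)) (-(Complex.I * eI (-θ))) θ := by
  have h := (eI_deriv (-θ)).scomp θ (hasDerivAt_neg θ)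
  exact h.congr_deriv (by simp)

lemma zeI_norm {z : ℂ} (hz : ‖z‖ < 1) (α : ℝ) : ‖z * eI α‖ < 1 := by rw [norm_mul, eI_norm, mul_one]; exact hz

lemma slit_sub {w : ℂ} (hw : ‖w‖ < 1) : 1 - w ∈ Complex.slitPlane := by
  rw [sub_eq_add_neg]; exact Complex.mem_slitPlane_of_norm_lt_one (by rwa [norm_neg])

lemma one_sub_ne' {w : ℂ} (hw : ‖w‖ < 1) : 1 - w ≠ 0 := Complex.slitPlane_ne_zero (slit_sub hw)

lemma fz_deriv {z : ℂ} (hz : ‖z‖ < 1) (α : ℝ) : HasDerivAt (fz z) (gI z α) α := by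
  have hO := (((eI_deriv α).const_mul z).const_sub 1).clog_real (slit_sub (zeI_norm hz α))
  have hQ := (((eI_deriv_neg α).const_mul z).const_sub 1).clog_real (slit_sub (zeI_norm hz (-α)))
  refine (hO.add hQ).congr_deriv ?_
  simp only [gI]; ring

lemma fz1_deriv {z : ℂ} (hz : ‖z‖ < 1) (α : ℝ) : HasDerivAt (gI z) (gF z α) α := by
  have eF := (eI_deriv α).const_mul z
  have eG := (eI_deriv_neg α).const_mul z
  have gO := one_sub_ne' (zeI_norm hz α)
  have n2 := one_sub_ne' (zeI_norm hz (-α))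
  have hO := (eF.mul ((eF.const_sub 1).inv gO)).const_mul Complex.I
  have hQ := (eG.mul ((eG.const_sub 1).inv n2)).const_mul Complex.I
  refine (hO.neg.add hQ).congr_deriv ?_
  simp only [gF, Pi.inv_apply]
  field_simp
  ring_nf
  simp only [Complex.I_sq]
  ring

lemma fz2_cont {z : ℂ} (hz : ‖z‖ < 1) : Continuous (gF z) := by
  have gO := fun α : ℝ => one_sub_ne' (zeI_norm hz α)
  have hc := eI_cont
  have hc' : Continuous fun α : ℝ => eI (-α) := hc.comp continuous_neg
  unfold gF
  exact ((continuous_const.mul hc).mul (((continuous_const.sub (continuous_const.mul hc)).inv₀ gO).pow 2)).add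
    ((continuous_const.mul hc').mul (((continuous_const.sub (continuous_const.mul hc')).inv₀ fun α => gO (-α)).pow 2))

lemma fz_exp {z : ℂ} (hz : ‖z‖ < 1) (α : ℝ) : Complex.exp (fz z α) = 1 - 2 * z * cos α + z ^ 2 := by
  rw [fz, Complex.exp_add, Complex.exp_log (one_sub_ne' (zeI_norm hz α)), Complex.exp_log (one_sub_ne' (zeI_norm hz (-α)))]
  have hO : eI α * eI (-α) = 1 := eI_mul_neg α
  have hQ : 2 * (cos α : ℂ) = eI α + eI (-α) := by
    rw [Complex.ofReal_cos, Complex.two_cos]; simp [eI]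
  linear_combination z ^ 2 * hO + z * hQ

/-- the kernel modulus -/
noncomputable def hr (r φ : ℝ) : ℝ := ‖1 - r * eI φ‖⁻¹

lemma hr_nonneg (r φ : ℝ) : 0 ≤ hr r φ := by unfold hr; positivity

lemma eI_add (a b : ℝ) : eI (a + b) = eI a * eI b := by simp only [eI]; rw [← Complex.exp_add]; push_cast; ring_nf

lemma fz1_norm {r : ℝ} (eN : 0 ≤ r) (eM : r < 1) (θ α : ℝ) : ‖gI (r * eI θ) α‖ ≤ hr r (θ + α) + hr r (θ - α) := by
  have e : ∀ x, (r:ℂ) * eI θ * eI x = r * eI (θ + x) := fun x => by rw [mul_assoc, eI_add]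
  have a : ∀ x, ‖(r:ℂ) * eI x‖ ≤ 1 := fun x => by rw [norm_mul, eI_norm, Complex.norm_real, norm_of_nonneg eN]; linarith
  have b : ∀ x, ‖Complex.I * ((r:ℂ) * eI x * (1 - r * eI x)⁻¹)‖ ≤ hr r x := fun x => by
    rw [norm_mul, Complex.norm_I, one_mul, norm_mul, norm_inv]
    exact mul_le_of_le_one_left (by positivity) (a x)
  simp only [gI, e]
  refine (norm_add_le _ _).trans (add_le_add ?_ (b _))
  rw [norm_neg]; exact b _

lemma fz2_norm {r : ℝ} (eN : 0 ≤ r) (eM : r < 1) (θ α : ℝ) : ‖gF (r * eI θ) α‖ ≤ hr r (θ + α) ^ 2 + hr r (θ - α) ^ 2 := by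
  have e : ∀ x, (r:ℂ) * eI θ * eI x = r * eI (θ + x) := fun x => by rw [mul_assoc, eI_add]
  have a : ∀ x, ‖(r:ℂ) * eI x‖ ≤ 1 := fun x => by rw [norm_mul, eI_norm, Complex.norm_real, norm_of_nonneg eN]; linarith
  have b : ∀ x, ‖(r:ℂ) * eI x * ((1 - r * eI x)⁻¹)^2‖ ≤ hr r x ^ 2 := fun x => by
    rw [norm_mul, norm_pow, norm_inv]
    exact mul_le_of_le_one_left (by positivity) (a x)
  simp only [gF, e]
  exact (norm_add_le _ _).trans (add_le_add (b _) (b _))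

lemma hr_cont {r : ℝ} (h : |r| < 1) : Continuous (hr r) := by
  unfold hr
  refine Continuous.inv₀ (by have := eI_cont; fun_prop) fun φ => norm_ne_zero_iff.mpr (one_sub_ne' ?_)
  rw [norm_mul, eI_norm, Complex.norm_real, mul_one]; exact h

lemma hr_even (r φ : ℝ) : hr r (-φ) = hr r φ := by
  unfold hr
  rw [← Complex.norm_conj (1 - (r:ℂ) * eI φ)]
  congr 2; simp [eI_conj]

lemma hr_period (r : ℝ) : Function.Periodic (hr r) (2 * π) := fun φ => by
  unfold hr
  have : eI (φ + 2 * π) = eI φ := by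
    simp only [eI]; push_cast; rw [add_mul, Complex.exp_add, Complex.exp_two_pi_mul_I, mul_one]
  rw [this]

lemma even_per {h : ℝ → ℝ} (hc : Continuous h) (he : ∀ x, h (-x) = h x) (hp : Function.Periodic h (2 * π)) (θ : ℝ) :
    ∫ α in (0:ℝ)..π, (h (θ + α) + h (θ - α)) = 2 * ∫ α in (0:ℝ)..π, h α := by
  have ii : ∀ a b, IntervalIntegrable h volume a b := fun a b => hc.intervalIntegrable _ _
  rw [intervalIntegral.integral_add ((by fun_prop : Continuous fun α => h (θ + α)).intervalIntegrable _ _)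
    ((by fun_prop : Continuous fun α => h (θ - α)).intervalIntegrable _ _), intervalIntegral.integral_comp_add_left,
    intervalIntegral.integral_comp_sub_left, add_comm, add_zero, sub_zero, intervalIntegral.integral_add_adjacent_intervals (ii _ _) (ii _ _)]
  have hO := hp.intervalIntegral_add_eq (θ - π) (-π)
  rw [show θ - π + 2 * π = θ + π by ring, show -π + 2 * π = π by ring] at hO
  rw [hO, ← intervalIntegral.integral_add_adjacent_intervals (ii _ 0) (ii _ _)]
  have hQ := intervalIntegral.integral_comp_neg (a := 0) (b := π) h
  simp only [he, neg_zero] at hQ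
  rw [← hQ]; ring

lemma fz2_int {r : ℝ} (eN : 0 ≤ r) (eM : r < 1) (θ : ℝ) : ∫ α in (0:ℝ)..π, ‖gF (r * eI θ) α‖ ≤ 2 * π / (1 - r ^ 2) := by
  have hc := hr_cont (abs_lt.mpr ⟨by linarith, eM⟩ : |r| < 1)
  have hz : ‖(r:ℂ) * eI θ‖ < 1 := by rw [norm_mul, eI_norm, Complex.norm_real, norm_of_nonneg eN]; linarith
  calc _ ≤ ∫ α in (0:ℝ)..π, (hr r (θ + α) ^ 2 + hr r (θ - α) ^ 2) :=
        intervalIntegral.integral_mono_on pi_pos.le ((fz2_cont hz).norm.intervalIntegrable _ _)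
          ((by fun_prop : Continuous fun α => hr r (θ + α) ^ 2 + hr r (θ - α) ^ 2).intervalIntegrable _ _) fun α _ => fz2_norm eN eM θ α
    _ = 2 * ∫ α in (0:ℝ)..π, hr r α ^ 2 := even_per (h := fun x => hr r x ^ 2) (by fun_prop) (fun x => by simp only [hr_even]) (fun x => by simp only [hr_period r x]) θ
    _ = _ := by
      have := poisson_int (abs_lt.mpr ⟨by linarith, eM⟩ : |r| < 1)
      simp only [hr, inv_pow]; rw [this]; ring

lemma hr_sq (r φ : ℝ) : ‖1 - (r:ℂ) * eI φ‖ ^ 2 = (1 - r) ^ 2 + 4 * r * sin (φ / 2) ^ 2 := by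
  rw [← Complex.normSq_eq_norm_sq, Complex.normSq_apply]
  have hO : (eI φ).re = cos φ := eI_re φ
  have hQ : (eI φ).im = sin φ := eI_im φ
  simp only [Complex.sub_re, Complex.sub_im, Complex.one_re, Complex.one_im, Complex.re_ofReal_mul, Complex.im_ofReal_mul, hO, hQ]
  have eA : cos φ = 1 - 2 * sin (φ/2) ^ 2 := by
    rw [show φ = 2 * (φ / 2) by ring, cos_two_mul, show 2 * (φ/2)/2 = φ / 2 by ring]; nlinarith [sin_sq_add_cos_sq (φ/2)]
  have eH := sin_sq_add_cos_sq φ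
  have eO : sin φ ^ 2 = 1 - cos φ ^ 2 := by linarith
  have : (1 - r * cos φ) * (1 - r * cos φ) + (0 - r * sin φ) * (0 - r * sin φ) = 1 - 2 * r * cos φ + r ^ 2 * (sin φ ^ 2 + cos φ ^ 2) := by ring
  rw [this, eH, eA]; ring

lemma sin_half_ge {φ : ℝ} (eC : 0 ≤ φ) (hO : φ ≤ π) : φ / π ≤ sin (φ / 2) := by
  have := mul_le_sin (x := φ / 2) (by linarith) (by linarith)
  calc φ / π = 2 / π * (φ / 2) := by ring
    _ ≤ _ := this

lemma norm_lower {r φ : ℝ} (eN : 1 / 2 ≤ r) (eM : r < 1) (eC : 0 ≤ φ) (hO : φ ≤ π) :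
    (1 - r) + φ / π ≤ √2 * ‖1 - (r:ℂ) * eI φ‖ := by
  have := sin_half_ge eC hO
  have hp : 0 ≤ φ / π := by positivity
  refine le_of_sq_le_sq ?_ (by positivity)
  rw [mul_pow, sq_sqrt (by norm_num), hr_sq]
  have hQ : (φ / π) ^ 2 ≤ sin (φ / 2) ^ 2 := by gcongr
  nlinarith [sq_nonneg ((1 - r) - φ / π), sq_nonneg (sin (φ/2))]

lemma fz1_int {r : ℝ} (eN : 1 / 2 ≤ r) (eM : r < 1) (θ : ℝ) : ∫ α in (0:ℝ)..π, ‖gI (r * eI θ) α‖ ≤ 9 * log (2 / (1 - r)) := by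
  have hr0' : 0 ≤ r := by linarith
  have hc := hr_cont (abs_lt.mpr ⟨by linarith, eM⟩ : |r| < 1)
  have hz : ‖(r:ℂ) * eI θ‖ < 1 := by rw [norm_mul, eI_norm, Complex.norm_real, norm_of_nonneg hr0']; linarith
  have hfc : Continuous (gI (r * eI θ)) := continuous_iff_continuousAt.mpr fun x => (fz1_deriv hz x).continuousAt
  have hpi := pi_pos
  have hden : ∀ φ ∈ Set.Icc 0 π, 0 < (1 - r) + φ / π := fun φ hφ => by have := hφ.1; have : 0 ≤ φ / π := by positivity
                                                                       linarith
  have hl : ∫ φ in (0:ℝ)..π, ((1 - r) + φ / π)⁻¹ = π * log ((1 - r) + 1) - π * log (1 - r) := by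
    have := intervalIntegral.integral_eq_sub_of_hasDerivAt (a := 0) (b := π) (f := fun φ => π * log ((1 - r) + φ / π)) (f' := fun φ => ((1 - r) + φ / π)⁻¹)
      (fun φ hφ => by
        rw [Set.uIcc_of_le hpi.le] at hφ
        have h := ((((hasDerivAt_id φ).div_const π).const_add (1 - r)).log (hden φ hφ).ne').const_mul π
        refine h.congr_deriv ?_
        simp only [id]; field_simp)
      (ContinuousOn.intervalIntegrable (by
        rw [Set.uIcc_of_le hpi.le]
        exact ContinuousOn.inv₀ (by fun_prop) fun φ hφ => (hden φ hφ).ne'))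
    rw [this]; simp [hpi.ne']
  have hi2 : IntervalIntegrable (fun φ => √2 * ((1 - r) + φ / π)⁻¹) volume 0 π := ContinuousOn.intervalIntegrable (by
        rw [Set.uIcc_of_le hpi.le]
        exact ContinuousOn.mul continuousOn_const (ContinuousOn.inv₀ (by fun_prop) fun φ hφ => (hden φ hφ).ne'))
  calc _ ≤ ∫ α in (0:ℝ)..π, (hr r (θ + α) + hr r (θ - α)) :=
        intervalIntegral.integral_mono_on pi_pos.le (hfc.norm.intervalIntegrable _ _)
          ((by fun_prop : Continuous fun α => hr r (θ + α) + hr r (θ - α)).intervalIntegrable _ _) fun α _ => fz1_norm hr0' eM θ α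
    _ = 2 * ∫ α in (0:ℝ)..π, hr r α := even_per hc (hr_even r) (hr_period r) θ
    _ ≤ 2 * ∫ φ in (0:ℝ)..π, √2 * ((1 - r) + φ / π)⁻¹ := by
      refine mul_le_mul_of_nonneg_left (intervalIntegral.integral_mono_on hpi.le (hc.intervalIntegrable _ _) hi2 fun φ hφ => ?_) (by norm_num)
      have hO := norm_lower eN eM hφ.1 hφ.2
      have hQ := hden φ hφ
      have eA : 0 < ‖1 - (r:ℂ) * eI φ‖ := by
        by_contra hc; nlinarith [sqrt_nonneg 2]
      rw [hr, ← div_eq_mul_inv, inv_eq_one_div, div_le_div_iff₀ eA hQ]; linarith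
    _ = 2 * √2 * π * (log ((1 - r) + 1) - log (1 - r)) := by rw [intervalIntegral.integral_const_mul, hl]; ring
    _ ≤ 9 * log (2 / (1 - r)) := by
      have eH : log ((1 - r) + 1) ≤ log 2 := log_le_log (by linarith) (by linarith)
      have eO : log (1 - r) ≤ 0 := log_nonpos (by linarith) (by linarith)
      have eZ : 0 ≤ log ((1 - r) + 1) := log_nonneg (by linarith)
      have gB : 2 * √2 * π ≤ 9 := by
        have : √2 ≤ 1.415 := by rw [sqrt_le_left (by norm_num)]; norm_num
        have := pi_lt_d2; nlinarith [sqrt_nonneg 2]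
      rw [log_div (by norm_num) (by linarith)]
      nlinarith

lemma fz2_far {r θ α δ : ℝ} (eN : 1 / 2 ≤ r) (eM : r < 1) (hd : 0 < δ) (hd1 : δ ≤ 1) (hO : 2 * δ ≤ θ) (hQ : θ ≤ π)
    (hα : α ∈ Set.Icc 0 (3 * δ / 2)) : ‖gF (r * eI θ) α‖ ≤ 40 / δ ^ 2 := by
  have hpi := pi_gt_three
  have key : ∀ φ, δ / 2 ≤ φ → φ ≤ 2 * π - δ / 2 → hr r φ ^ 2 ≤ 20 / δ ^ 2 := by
    intro φ ha hb
    have hs : δ / (2 * π) ≤ sin (φ / 2) := by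
      rcases le_total φ π with h | h
      · refine le_trans ?_ (sin_half_ge (by linarith) h)
        rw [div_le_div_iff₀ (by positivity) (by positivity)]; nlinarith
      · have := sin_half_ge (φ := 2 * π - φ) (by linarith) (by linarith)
        rw [show (2 * π - φ) / 2 = π - φ / 2 by ring, sin_pi_sub] at this
        refine le_trans ?_ this
        rw [div_le_div_iff₀ (by positivity) (by positivity)]; nlinarith
    have hs2 : (δ / (2 * π)) ^ 2 ≤ sin (φ / 2) ^ 2 := by
      have : 0 ≤ δ / (2 * π) := by positivity
      gcongr
    have hp2 : π ^ 2 ≤ 10 := by nlinarith [pi_lt_d2]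
    have hd2 : δ ^ 2 / 40 ≤ (δ / (2 * π)) ^ 2 := by
      rw [div_pow, div_le_div_iff₀ (by norm_num) (by positivity)]; nlinarith [sq_nonneg δ]
    rw [hr, inv_pow, hr_sq, ← one_div, div_le_div_iff₀ _ (by positivity)]
    · nlinarith [sq_nonneg (1 - r)]
    · nlinarith [sq_nonneg (1 - r), sq_pos_of_pos hd]
  have a := key (θ + α) (by linarith [hα.1]) (by linarith [hα.2])
  have b := key (θ - α) (by linarith [hα.2]) (by linarith [hα.1])
  refine (fz2_norm (by linarith) eM θ α).trans ?_
  calc _ ≤ 20 / δ ^ 2 + 20 / δ ^ 2 := add_le_add a b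
    _ = _ := by ring

lemma swap_sum {F : ℕ → ℝ → ℂ} {f : ℝ → ℂ} {b : ℕ → ℝ} (s t : ℝ) (hF : ∀ k, Continuous (F k)) (hb : ∀ k x, ‖F k x‖ ≤ b k) (hs : Summable b)
    (h : ∀ x, HasSum (fun k => F k x) (f x)) : HasSum (fun k => ∫ x in s..t, F k x) (∫ x in s..t, f x) :=
  intervalIntegral.hasSum_integral_of_dominated_convergence (fun k _ => b k) (fun k => (hF k).aestronglyMeasurable)
    (fun k => ae_of_all _ fun x _ => hb k x) (ae_of_all _ fun _ _ => hs) intervalIntegrable_const (ae_of_all _ fun x _ => h x)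

lemma int_cos_int (k : ℤ) (hk : k ≠ 0) : ∫ x in (0:ℝ)..π, cos (k * x) = 0 := by
  have hk' : (k:ℝ) ≠ 0 := by exact_mod_cast hk
  rw [intervalIntegral.integral_comp_mul_left _ hk', integral_cos, sin_int_mul_pi]; simp

lemma int_cos_cos (m k : ℕ) (hk : k ≠ 0) : ∫ x in (0:ℝ)..π, cos (m * x) * cos (k * x) = if m = k then π / 2 else 0 := by
  have e : ∀ x : ℝ, cos (m * x) * cos (k * x) = 1 / 2 * (cos (((m:ℤ) - (k:ℤ) : ℤ) * x) + cos (((m:ℤ) + (k:ℤ) : ℤ) * x)) := fun x => by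
    have := two_mul_cos_mul_cos (m * x) (k * x)
    push_cast; rw [sub_mul, add_mul]; linarith
  simp_rw [e]
  rw [intervalIntegral.integral_const_mul, intervalIntegral.integral_add ((by fun_prop : Continuous _).intervalIntegrable _ _) ((by fun_prop : Continuous _).intervalIntegrable _ _),
    int_cos_int _ (by omega : (m:ℤ) + k ≠ 0)]
  split_ifs with h
  · subst h; simp; ring
  · rw [int_cos_int _ (by omega)]; simp

lemma fz_hasSum {z : ℂ} (hz : ‖z‖ < 1) (α : ℝ) : HasSum (fun m : ℕ => -(2 * z ^ m / m * (cos (m * α) : ℂ))) (fz z α) := by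
  have hO := Complex.hasSum_taylorSeries_neg_log (zeI_norm hz α)
  have hQ := Complex.hasSum_taylorSeries_neg_log (zeI_norm hz (-α))
  have eA := (hO.add hQ).neg
  rw [← neg_add, neg_neg] at eA
  refine eA.congr_fun fun m => ?_
  have : 2 * (cos (m * α) : ℂ) = eI α ^ m + eI (-α) ^ m := by
    rw [Complex.ofReal_cos, Complex.two_cos]; simp only [eI, ← Complex.exp_nat_mul]; push_cast; congr 2 <;> ring
  rw [mul_pow, mul_pow, ← add_div, ← mul_add, ← this]; ring

lemma two_pow_le (z : ℂ) (m : ℕ) : ‖(2:ℂ)‖ * ‖z‖ ^ m / m ≤ 2 * ‖z‖ ^ m := by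
  rw [Complex.norm_ofNat]
  rcases Nat.eq_zero_or_pos m with h | h
  · subst h; simp
  · exact div_le_self (by positivity) (by exact_mod_cast h)

lemma fz_cos {z : ℂ} (hz : ‖z‖ < 1) (k : ℕ) (hk : k ≠ 0) : ∫ α in (0:ℝ)..π, fz z α * (cos (k * α) : ℂ) = -π * z ^ k / k := by
  have h := swap_sum (F := fun m α => -(2 * z ^ m / m * (cos (m * α) : ℂ)) * (cos (k * α) : ℂ)) (b := fun m => 2 * ‖z‖ ^ m) 0 π
    (fun m => by fun_prop) (fun m x => ?_) ((summable_geometric_of_lt_one (norm_nonneg _) hz).mul_left 2) (fun x => (fz_hasSum hz x).mul_right _)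
  · refine h.unique ?_
    have e : ∀ m : ℕ, ∫ α in (0:ℝ)..π, -(2 * z ^ m / m * (cos (m * α) : ℂ)) * (cos (k * α) : ℂ) = if m = k then -π * z ^ k / k else 0 := by
      intro m
      have : ∀ α : ℝ, -(2 * z ^ m / m * (cos (m * α) : ℂ)) * (cos (k * α) : ℂ) = -(2 * z ^ m / m) * ((cos (m * α) * cos (k * α) : ℝ) : ℂ) := fun α => by
        push_cast; ring
      simp_rw [this]
      rw [intervalIntegral.integral_const_mul, intervalIntegral.integral_ofReal, int_cos_cos m k hk]
      split_ifs with h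
      · subst h; push_cast; ring
      · simp
    simp_rw [e]
    exact hasSum_ite_eq k _
  · rw [norm_mul, norm_neg, norm_mul, Complex.norm_real, Complex.norm_real, norm_div, norm_mul, norm_pow, Complex.norm_natCast]
    have hO := abs_cos_le_one (m * x)
    have hQ := abs_cos_le_one (k * x)
    have eA := two_pow_le z m
    simp only [norm_eq_abs]
    calc _ ≤ (2 * ‖z‖ ^ m) * 1 * 1 := by gcongr
      _ = _ := by ring

lemma fz_zero {z : ℂ} (hz : ‖z‖ < 1) : ∫ α in (0:ℝ)..π, fz z α = 0 := by
  have h := swap_sum (F := fun m α => -(2 * z ^ m / m * (cos (m * α) : ℂ))) (b := fun m => 2 * ‖z‖ ^ m) 0 π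
    (fun m => by fun_prop) (fun m x => ?_) ((summable_geometric_of_lt_one (norm_nonneg _) hz).mul_left 2) (fun x => (fz_hasSum hz x))
  · refine h.unique ?_
    convert hasSum_zero with m
    rw [intervalIntegral.integral_neg, intervalIntegral.integral_const_mul, intervalIntegral.integral_ofReal]
    rcases Nat.eq_zero_or_pos m with h | h
    · subst h; simp
    · have := int_cos_int m (by exact_mod_cast h.ne'); push_cast at this; rw [this]; simp
  · rw [norm_neg, norm_mul, Complex.norm_real, norm_div, norm_mul, norm_pow, Complex.norm_natCast]
    have hO := abs_cos_le_one (m * x)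
    have eA := two_pow_le z m
    simp only [norm_eq_abs]
    calc _ ≤ (2 * ‖z‖ ^ m) * 1 := by gcongr
      _ = _ := by ring

noncomputable def rh (W : ℕ → ℝ) (c : ℝ) (α : ℝ) : ℝ := (c - ∑' k : ℕ, W k * cos (k * α)) / π

lemma W_term (W : ℕ → ℝ) (k : ℕ) (α : ℝ) : ‖W k * cos (k * α)‖ ≤ |W k| := by
  rw [norm_mul, norm_eq_abs, norm_eq_abs]; exact mul_le_of_le_one_right (abs_nonneg _) (abs_cos_le_one _)

lemma rh_cont {W : ℕ → ℝ} (hW : Summable fun k => |W k|) (c : ℝ) : Continuous (rh W c) := by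
  unfold rh
  exact (continuous_const.sub (continuous_tsum (fun k => by fun_prop) hW (W_term W))).div_const _

lemma rh_fz {W : ℕ → ℝ} (hW : Summable fun k => |W k|) (eC : W 0 = 0) (c : ℝ) {z : ℂ} (hz : ‖z‖ < 1) :
    HasSum (fun k : ℕ => W k * z ^ k / k) (∫ α in (0:ℝ)..π, fz z α * rh W c α) := by
  have hfc : Continuous (fz z) := continuous_iff_continuousAt.mpr fun x => (fz_deriv hz x).continuousAt
  have hrc := rh_cont hW c
  have hpi : (π:ℂ) ≠ 0 := by exact_mod_cast pi_ne_zero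
  obtain ⟨B, hB⟩ : ∃ B, ∀ α, ‖fz z α‖ ≤ B := by
    refine ⟨∑' m : ℕ, 2 * ‖z‖ ^ m, fun α => (fz_hasSum hz α).tsum_eq ▸ tsum_of_norm_bounded ((summable_geometric_of_lt_one (norm_nonneg _) hz).mul_left 2).hasSum fun m => ?_⟩
    rw [norm_neg, norm_mul, Complex.norm_real, norm_div, norm_mul, norm_pow, Complex.norm_natCast]
    have hO := abs_cos_le_one (m * α)
    have eA := two_pow_le z m
    simp only [norm_eq_abs]
    calc _ ≤ (2 * ‖z‖ ^ m) * 1 := by gcongr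
      _ = _ := by ring
  have hS : ∀ α, HasSum (fun k : ℕ => W k * cos (k * α)) (∑' k : ℕ, W k * cos (k * α)) := fun α =>
    (Summable.of_norm_bounded hW fun k => W_term W k α).hasSum
  have h := swap_sum (F := fun k α => fz z α * ((W k * cos (k * α) : ℝ) : ℂ)) (b := fun k => B * |W k|) 0 π
    (fun k => by fun_prop) (fun k x => ?_) (hW.mul_left B) (fun x => (Complex.hasSum_ofReal.mpr (hS x)).mul_left (fz z x))
  · have e : ∫ α in (0:ℝ)..π, fz z α * rh W c α = -(π:ℂ)⁻¹ * ∫ α in (0:ℝ)..π, fz z α * ((∑' k : ℕ, W k * cos (k * α) : ℝ) : ℂ) := by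
      have : ∀ α, fz z α * rh W c α = (c / π) * fz z α + (-(π:ℂ)⁻¹) * (fz z α * ((∑' k : ℕ, W k * cos (k * α) : ℝ) : ℂ)) := fun α => by
        rw [rh, Complex.ofReal_div, Complex.ofReal_sub]; generalize (∑' k : ℕ, W k * cos (k * α)) = S; field_simp; ring
      have gV : Continuous fun α => fz z α * ((∑' k : ℕ, W k * cos (k * α) : ℝ) : ℂ) :=
        hfc.mul (Complex.continuous_ofReal.comp (continuous_tsum (fun k => by fun_prop) hW (W_term W)))
      simp_rw [this]
      rw [intervalIntegral.integral_add ((by fun_prop : Continuous _).intervalIntegrable _ _) ((by fun_prop : Continuous _).intervalIntegrable _ _),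
        intervalIntegral.integral_const_mul, intervalIntegral.integral_const_mul, fz_zero hz]; simp
    rw [e]
    refine (h.mul_left _).congr_fun ?_
    intro k
    rcases Nat.eq_zero_or_pos k with hk | hk
    · subst hk; simp [eC]
    · have : ∀ α : ℝ, fz z α * ((W k * cos (k * α) : ℝ) : ℂ) = W k * (fz z α * (cos (k * α) : ℂ)) := fun α => by push_cast; ring
      simp_rw [this]
      rw [intervalIntegral.integral_const_mul, fz_cos hz k hk.ne']; field_simp
  · rw [norm_mul, Complex.norm_real]
    exact mul_le_mul (hB x) (W_term W k x) (norm_nonneg _) ((norm_nonneg _).trans (hB x))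

lemma rh_int {W : ℕ → ℝ} (hW : Summable fun k => |W k|) (eC : W 0 = 0) (c : ℝ) : ∫ α in (0:ℝ)..π, rh W c α = c := by
  have hS : ∀ α, HasSum (fun k : ℕ => W k * cos (k * α)) (∑' k : ℕ, W k * cos (k * α)) := fun α =>
    (Summable.of_norm_bounded hW fun k => W_term W k α).hasSum
  have h := swap_sum (F := fun k α => ((W k * cos (k * α) : ℝ) : ℂ)) (b := fun k => |W k|) 0 π
    (fun k => by fun_prop) (fun k x => by rw [Complex.norm_real]; exact W_term W k x) hW (fun x => Complex.hasSum_ofReal.mpr (hS x))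
  have hQ : ∫ α in (0:ℝ)..π, ∑' k : ℕ, W k * cos (k * α) = 0 := by
    rw [intervalIntegral.integral_ofReal] at h
    have := h.unique (a₂ := 0) (by
      convert hasSum_zero with k
      rw [intervalIntegral.integral_ofReal, intervalIntegral.integral_const_mul]
      rcases Nat.eq_zero_or_pos k with hk | hk
      · subst hk; simp [eC]
      · have := int_cos_int k (by exact_mod_cast hk.ne'); push_cast at this; rw [this]; simp)
    exact_mod_cast this
  unfold rh
  have gV : Continuous fun α : ℝ => ∑' k : ℕ, W k * cos (k * α) := continuous_tsum (fun k => by fun_prop) hW (W_term W)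
  rw [intervalIntegral.integral_div, intervalIntegral.integral_sub intervalIntegrable_const (gV.intervalIntegrable _ _), hQ]
  simp

noncomputable def Wk (n : ℕ) (v η : ℝ) (J : ℕ) (eJ eK eL : ℝ) (k : ℕ) : ℝ :=
  if k = 0 then 0 else v * (k ^ 1 * cc n k) + v * η * (k ^ 2 * cc n k) + ((J + 1 / 2) * eJ ^ k + 1 / 2 * eK ^ k + eL ^ k)

lemma Wk_summable {n : ℕ} (hn : 1 ≤ n) (v η : ℝ) (J : ℕ) {eJ eK eL : ℝ} (hO : |eJ| < 1) (hQ : |eK| < 1) (eA : |eL| < 1) :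
    Summable fun k => |Wk n v η J eJ eK eL k| := by
  have g : ∀ {b : ℝ}, |b| < 1 → Summable fun k : ℕ => |b| ^ k := fun hb => summable_geometric_of_lt_one (abs_nonneg _) hb
  refine Summable.of_nonneg_of_le (fun k => abs_nonneg _) (fun k => ?_)
    ((((cc_summable hn 1 (by norm_num)).mul_left |v|).add ((cc_summable hn 2 le_rfl).mul_left |v * η|)).add
      ((((g hO).mul_left (J + 1 / 2 : ℝ)).add ((g hQ).mul_left (1/2))).add (g eA)))
  unfold Wk
  split_ifs with h
  · simp; positivity
  · refine (abs_add_le _ _).trans (add_le_add ((abs_add_le _ _).trans (add_le_add ?_ ?_)) ((abs_add_le _ _).trans (add_le_add ((abs_add_le _ _).trans (add_le_add ?_ ?_)) ?_)))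
    · rw [abs_mul, abs_mul, abs_of_nonneg (by positivity : (0:ℝ) ≤ (k:ℝ) ^ 1)]
    · rw [abs_mul, abs_mul ((k:ℝ)^2), abs_of_nonneg (by positivity : (0:ℝ) ≤ (k:ℝ) ^ 2)]
    · rw [abs_mul, abs_pow, abs_of_nonneg (by positivity : (0:ℝ) ≤ (J:ℝ) + 1 / 2)]
    · rw [abs_mul, abs_pow]; norm_num
    · rw [abs_pow]

noncomputable def Gr (b α : ℝ) : ℝ := (b * cos α - b ^ 2) * (‖1 - (b:ℂ) * eI α‖ ^ 2)⁻¹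

lemma eI_pow_re (k : ℕ) (α : ℝ) : (eI α ^ k).re = cos (k * α) := by
  rw [← eI_re]; congr 1; simp only [eI, ← Complex.exp_nat_mul]; push_cast; ring_nf

lemma Gr_hasSum {b : ℝ} (hb : |b| < 1) (α : ℝ) : HasSum (fun k : ℕ => if k = 0 then 0 else b ^ k * cos (k * α)) (Gr b α) := by
  have hz : ‖(b:ℂ) * eI α‖ < 1 := by rw [norm_mul, eI_norm, Complex.norm_real, mul_one]; exact hb
  have h := (Complex.hasSum_re (hasSum_geometric_of_norm_lt_one hz)).sub (hasSum_ite_eq (0:ℕ) (1:ℝ))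
  have hg : ((1 - (b:ℂ) * eI α)⁻¹).re - 1 = Gr b α := by
    rw [Complex.inv_re, Complex.normSq_eq_norm_sq, Gr]
    have hne : ‖1 - (b:ℂ) * eI α‖ ^ 2 ≠ 0 := pow_ne_zero _ (norm_ne_zero_iff.mpr (one_sub_ne' hz))
    rw [← div_eq_mul_inv, eq_div_iff hne, sub_mul, div_mul_cancel₀ _ hne, one_mul, hr_sq]
    simp only [Complex.sub_re, Complex.one_re, Complex.re_ofReal_mul, eI_re]
    have eA : cos α = 1 - 2 * sin (α/2) ^ 2 := by
      rw [show α = 2 * (α / 2) by ring, cos_two_mul, show 2 * (α/2)/2 = α / 2 by ring]; nlinarith [sin_sq_add_cos_sq (α/2)]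
    rw [eA]; ring
  rw [hg] at h
  refine h.congr_fun fun k => ?_
  split_ifs with hk
  · subst hk; simp
  · rw [sub_zero, mul_pow, ← Complex.ofReal_pow, Complex.re_ofReal_mul, eI_pow_re]

lemma Gr_le {b : ℝ} (hb : |b| < 1) (α : ℝ) : Gr b α ≤ 1 / (1 - |b|) := by
  have hO : (1 - |b|) ≤ ‖1 - (b:ℂ) * eI α‖ := by
    have := norm_sub_norm_le (1:ℂ) ((b:ℂ) * eI α)
    rwa [norm_one, norm_mul, eI_norm, Complex.norm_real, mul_one] at this
  have hQ : b * cos α - b ^ 2 ≤ ‖1 - (b:ℂ) * eI α‖ := by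
    have h := Complex.abs_re_le_norm (1 - (b:ℂ) * eI α)
    have h' := norm_nonneg (1 - (b:ℂ) * eI α)
    refine le_of_abs_le (abs_le_of_sq_le_sq ?_ h')
    rw [hr_sq]
    have eA : cos α = 1 - 2 * sin (α/2) ^ 2 := by
      rw [show α = 2 * (α / 2) by ring, cos_two_mul, show 2 * (α/2)/2 = α / 2 by ring]; nlinarith [sin_sq_add_cos_sq (α/2)]
    have e : (1 - b)^2 + 4 * b * sin (α/2)^2 = (1 - b * cos α) ^ 2 + (b * sin α) ^ 2 := by
      have := sin_sq_add_cos_sq α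
      have eH : sin (α/2)^2 = (1 - cos α) / 2 := by linarith
      have eO : sin α ^ 2 = 1 - cos α ^ 2 := by linarith
      rw [eH, mul_pow b, eO]; ring
    rw [e]
    have eO : (b * sin α) ^ 2 = b ^ 2 * (1 - cos α ^ 2) := by rw [mul_pow, sin_sq]
    rw [eO]
    have hb2 : b ^ 2 ≤ 1 := by rw [← sq_abs]; exact pow_le_one₀ (abs_nonneg _) hb.le
    nlinarith [sq_nonneg (1 - b * cos α), mul_nonneg (sub_nonneg.2 hb2) (sq_nonneg (1 - b * cos α)), sq_nonneg b]
  have hp : 0 < 1 - |b| := by linarith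
  have hq : 0 < ‖1 - (b:ℂ) * eI α‖ := by linarith
  rw [Gr, ← div_eq_mul_inv, div_le_div_iff₀ (by positivity) hp]
  calc _ ≤ ‖1 - (b:ℂ) * eI α‖ * ‖1 - (b:ℂ) * eI α‖ := mul_le_mul hQ hO hp.le hq.le
    _ = _ := by ring

lemma Gr_nonpos {b α : ℝ} (hb : b ≤ 0) (hα : 0 ≤ cos α) : Gr b α ≤ 0 :=
  mul_nonpos_of_nonpos_of_nonneg (by nlinarith [sq_nonneg b]) (by positivity)

lemma Wk_sum {n : ℕ} (hn : 1 ≤ n) (v η : ℝ) (J : ℕ) {eJ eK eL : ℝ} (hO : |eJ| < 1) (hQ : |eK| < 1) (eA : |eL| < 1) (α : ℝ) :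
    ∑' k : ℕ, Wk n v η J eJ eK eL k * cos (k * α) =
      v * (FF n 1 (eI α)).re + v * η * (FF n 2 (eI α)).re + ((J + 1 / 2) * Gr eJ α + 1 / 2 * Gr eK α + Gr eL α) := by
  have hz : ‖eI α‖ ≤ 1 := (eI_norm α).le
  have f1 := (Complex.hasSum_re (FF_hasSum hn 1 (by norm_num) hz)).mul_left v
  have f2 := (Complex.hasSum_re (FF_hasSum hn 2 (by norm_num) hz)).mul_left (v * η)
  have h := (f1.add f2).add ((((Gr_hasSum hO α).mul_left (J + 1 / 2 : ℝ)).add ((Gr_hasSum hQ α).mul_left (1/2))).add (Gr_hasSum eA α))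
  refine HasSum.tsum_eq (h.congr_fun fun k => ?_)
  have e : ∀ j : ℕ, (((k:ℂ) ^ j * (cc n k : ℂ)) * eI α ^ k).re = k ^ j * cc n k * cos (k * α) := fun j => by
    rw [← eI_pow_re, show (k:ℂ) ^ j * (cc n k : ℂ) = ((k ^ j * cc n k : ℝ) : ℂ) by push_cast; ring, Complex.re_ofReal_mul]
  rw [e, e]
  unfold Wk
  split_ifs with hk
  · subst hk; simp
  · ring

lemma rho_lower {n : ℕ} (hn : 1 ≤ n) {M L K η eJ eK eL : ℝ} {N J' : ℕ} (hM : 0 < M) (hη : 0 ≤ η) (hML : M + L = N)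
    (hO : 0 ≤ eJ) (h1' : eJ < 1) (hQ : eK ≤ 0) (h2' : -1 < eK) (eA : eL ≤ 0) (h3' : -1 < eL)
    (hK : K + 2 * M / bt n * η * AA n + ((2 * J' : ℕ) + 1 / 2) / (1 - eJ) + J' ≤ L) (hb : 1 / 2 / (1 + eK) + 1 / (1 + eL) ≤ M / 8)
    (hJ : J' ≤ N) {α : ℝ} (hα : α ∈ Set.Icc 0 π) :
    K + M * α ^ 2 / 20 ≤ π * rh (Wk n (2 * M / bt n) η (2 * J') eJ eK eL) ((N - J' : ℕ) : ℝ) α := by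
  have eS : |eJ| < 1 := by rw [abs_of_nonneg hO]; exact h1'
  have eV : |eK| < 1 := by rw [abs_of_nonpos hQ]; linarith
  have eW : |eL| < 1 := by rw [abs_of_nonpos eA]; linarith
  have hbt := bt_pos n
  rw [rh, mul_div_cancel₀ _ pi_ne_zero, Wk_sum hn _ _ _ eS eV eW, Nat.cast_sub hJ, ← hML]
  have d := D1_ge hn hα
  have hn' : (0:ℝ) < n := by exact_mod_cast hn
  have hbn : 1 ≤ bt n / n := by rw [le_div_iff₀ hn', bt]; linarith
  have hsin := sin_half_ge hα.1 hα.2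
  have hq : (α / π) ^ 2 ≤ sin (α / 2) ^ 2 := by
    have : 0 ≤ α / π := div_nonneg hα.1 pi_pos.le
    gcongr
  have hD : (α / π) ^ 2 ≤ 1 - 2 / bt n * (FF n 1 (eI α)).re := by nlinarith [sq_nonneg (sin (α/2))]
  have hMD : M * (α / π) ^ 2 ≤ M - 2 * M / bt n * (FF n 1 (eI α)).re := by
    have := mul_le_mul_of_nonneg_left hD hM.le
    calc _ ≤ _ := this
      _ = _ := by ring
  have hF2 : 2 * M / bt n * η * (FF n 2 (eI α)).re ≤ 2 * M / bt n * η * AA n :=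
    mul_le_mul_of_nonneg_left ((Complex.re_le_norm _).trans (FF2_norm_le hn (eI_norm α).le)) (by positivity)
  have g1 : (((2 * J' : ℕ) : ℝ) + 1 / 2) * Gr eJ α ≤ ((2 * J' : ℕ) + 1 / 2) / (1 - eJ) := by
    have := Gr_le eS α
    rw [abs_of_nonneg hO] at this
    calc _ ≤ (((2 * J' : ℕ) : ℝ) + 1 / 2) * (1 / (1 - eJ)) := mul_le_mul_of_nonneg_left this (by positivity)
      _ = _ := by ring
  have hp2 : π ^ 2 ≤ 10 := by nlinarith [pi_lt_d2, pi_gt_three]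
  have hmain : M * α ^ 2 / 20 + (1 / 2 * Gr eK α + Gr eL α) ≤ M * (α / π) ^ 2 := by
    have eF : α ^ 2 / 10 ≤ (α / π) ^ 2 := by rw [div_pow]; exact div_le_div_of_nonneg_left (sq_nonneg _) (by positivity) hp2
    rcases le_total α (π / 2) with h | h
    · have hc := cos_nonneg_of_mem_Icc (x := α) ⟨by linarith [hα.1, pi_pos], h⟩
      have := Gr_nonpos hQ hc
      have := Gr_nonpos eA hc
      nlinarith [sq_nonneg α]
    · have gP := Gr_le eV α
      have g3 := Gr_le eW α
      rw [abs_of_nonpos hQ, sub_neg_eq_add] at gP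
      rw [abs_of_nonpos eA, sub_neg_eq_add] at g3
      have eG : (1:ℝ) / 4 ≤ (α / π) ^ 2 := by
        have : (1:ℝ) / 2 ≤ α / π := by rw [le_div_iff₀ pi_pos]; linarith
        nlinarith
      have eP : 1 / 2 * Gr eK α + Gr eL α ≤ M / 8 := by
        refine le_trans ?_ hb
        have : 1 / 2 / (1 + eK) = 1 / 2 * (1 / (1 + eK)) := by ring
        rw [this]; linarith
      have gG := mul_le_mul_of_nonneg_left eF hM.le
      have gW := mul_le_mul_of_nonneg_left eG hM.le
      generalize (α / π) ^ 2 = q at *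
      linarith
  linarith

lemma sr_exp {w : ℂ} (hw : w ≠ 0) : Complex.exp (-(1 / 2 * Complex.log w)) = (sr w)⁻¹ := by
  rw [sr, Complex.cpow_def_of_ne_zero hw, ← Complex.exp_neg]; congr 1; ring

lemma Wk_fz {n : ℕ} (hn : 1 ≤ n) (v : ℝ) {η : ℝ} (hη : 0 ≤ η) (J : ℕ) {eJ eK eL : ℝ} (hO : |eJ| < 1) (hQ : |eK| < 1) (eA : |eL| < 1)
    (hv : 0 ≤ v) {ζ gJ : ℂ} (hζ : ‖ζ‖ = 1)
    (hI : HasSum (fun k : ℕ => Wk n v η J eJ eK eL k * (exp (-η) * ζ) ^ k / k) gJ) :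
    ‖gJ - (v * (FF n 0 ζ - 1) - (J + 1 / 2) * Complex.log (1 - exp (-η) * eJ * ζ) - 1 / 2 * Complex.log (1 - exp (-η) * eK * ζ)
      - Complex.log (1 - exp (-η) * eL * ζ))‖ ≤ v * η ^ 2 * AA n := by
  have eM : exp (-η) ≤ 1 := exp_le_one_iff.mpr (by linarith)
  have hlt : ∀ {b : ℝ}, |b| < 1 → ‖(exp (-η) : ℂ) * b * ζ‖ < 1 := fun {b} hb => by
    rw [norm_mul, norm_mul, hζ, Complex.norm_real, Complex.norm_real, norm_of_nonneg (exp_pos _).le, norm_eq_abs, mul_one]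
    exact lt_of_le_of_lt (mul_le_of_le_one_left (abs_nonneg _) eM) hb
  have l : ∀ {b : ℝ}, |b| < 1 → HasSum (fun k : ℕ => ((exp (-η) : ℂ) * b * ζ) ^ k / k) (-Complex.log (1 - exp (-η) * b * ζ)) :=
    fun hb => Complex.hasSum_taylorSeries_neg_log (hlt hb)
  have f0 := FF_hasSum hn 0 (by norm_num) hζ.le
  have g := (f0.sub (hasSum_ite_eq (0:ℕ) (1:ℂ))).mul_left (v:ℂ)
  have hs := hI.sub ((g.add ((l hO).mul_left (J + 1 / 2 : ℂ))).add (((l hQ).mul_left (1/2)).add (l eA)))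
  have key : ∀ k : ℕ, ‖(Wk n v η J eJ eK eL k * (exp (-η) * ζ) ^ k / k - (v * ((k:ℂ) ^ 0 * (cc n k : ℂ) * ζ ^ k - if k = 0 then 1 else 0) +
      (J + 1 / 2 : ℂ) * (((exp (-η) : ℂ) * eJ * ζ) ^ k / k) + (1/2 * (((exp (-η) : ℂ) * eK * ζ) ^ k / k) + ((exp (-η) : ℂ) * eL * ζ) ^ k / k)))‖
      ≤ v * η ^ 2 * ((k:ℝ) ^ 2 * |cc n k|) := by
    intro k
    rcases Nat.eq_zero_or_pos k with hk | hk
    · subst hk; simp [Wk, cc]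
    have hk' : (k:ℂ) ≠ 0 := by exact_mod_cast hk.ne'
    have e : (Wk n v η J eJ eK eL k * (exp (-η) * ζ) ^ k / k - (v * ((k:ℂ) ^ 0 * (cc n k : ℂ) * ζ ^ k - if k = 0 then 1 else 0) +
      (J + 1 / 2 : ℂ) * (((exp (-η) : ℂ) * eJ * ζ) ^ k / k) + (1/2 * (((exp (-η) : ℂ) * eK * ζ) ^ k / k) + ((exp (-η) : ℂ) * eL * ζ) ^ k / k)))
      = ((v * cc n k * ((1 + k * η) * exp (-(k * η)) - 1) : ℝ) : ℂ) * ζ ^ k := by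
      have eO : exp (-(k * η)) = exp (-η) ^ k := by rw [← exp_nat_mul]; ring_nf
      rw [eO, if_neg hk.ne', Wk, if_neg hk.ne']
      push_cast
      simp only [mul_pow]
      field_simp
      ring
    rw [e, norm_mul, norm_pow, hζ, one_pow, mul_one, Complex.norm_real, norm_eq_abs, abs_mul, abs_mul, abs_of_nonneg hv]
    have eZ : |(1 + k * η) * exp (-(k * η)) - 1| ≤ (k * η) ^ 2 := by
      have hx : 0 ≤ k * η := by positivity
      generalize k * η = x at hx
      have a := add_one_le_exp (-x)
      have b := add_one_le_exp x
      have c : exp x * exp (-x) = 1 := by rw [← exp_add]; simp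
      have d := exp_pos (-x)
      rw [abs_le]; constructor <;> nlinarith
    calc v * |cc n k| * |(1 + k * η) * exp (-(k * η)) - 1| ≤ v * |cc n k| * (k * η) ^ 2 := by gcongr
      _ = _ := by ring
  have hfin := tsum_of_norm_bounded ((cc_summable hn 2 le_rfl).hasSum.mul_left (v * η ^ 2)) key
  rw [hs.tsum_eq] at hfin
  refine le_trans (le_of_eq ?_) hfin
  congr 1; ring

lemma approx {n : ℕ} (hn : 1 ≤ n) {M L K η δ eJ eK eL : ℝ} {N J' : ℕ} (hM : 0 < M) (hη : 0 < η) (hη' : η ≤ 1 / 2) (hML : M + L = N)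
    (hO : 0 ≤ eJ) (h1' : eJ < 1) (hQ : eK ≤ 0) (h2' : -1 < eK) (eA : eL ≤ 0) (h3' : -1 < eL)
    (hK : K + 2 * M / bt n * η * AA n + ((2 * J' : ℕ) + 1 / 2) / (1 - eJ) + J' ≤ L) (hb : 1 / 2 / (1 + eK) + 1 / (1 + eL) ≤ M / 8)
    (hJ : J' ≤ N) (hδ : 0 < δ) (hδ' : δ ≤ 1) (hK0 : 0 < K) (hKδ : π / K ≤ δ / 2) :
    ∃ α : ℕ → ℝ, ∀ θ : ℝ, ∃ e : ℂ,
      ∏ j ∈ Finset.range (N - J'), (1 - 2 * (exp (-η) * eI θ) * cos (α j) + (exp (-η) * eI θ) ^ 2) =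
        Complex.exp ((2 * M / bt n : ℝ) * (FF n 0 (eI θ) - 1) + e) * ((1 - exp (-η) * eJ * eI θ) ^ (2 * J') * sr (1 - exp (-η) * eJ * eI θ) *
          sr (1 - exp (-η) * eK * eI θ) * (1 - exp (-η) * eL * eI θ))⁻¹ ∧
      ‖e‖ ≤ 9 * log (2 / (1 - exp (-η))) + 2 * M / bt n * η ^ 2 * AA n ∧
      (2 * δ ≤ θ → θ ≤ π → ‖e‖ ≤ 20 * π / (M * δ ^ 2) * (2 * π / (1 - exp (-η) ^ 2)) + π / K * (40 / δ ^ 2) * π + 2 * M / bt n * η ^ 2 * AA n) := by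
  have eS : |eJ| < 1 := by rw [abs_of_nonneg hO]; exact h1'
  have eV : |eK| < 1 := by rw [abs_of_nonpos hQ]; linarith
  have eW : |eL| < 1 := by rw [abs_of_nonpos eA]; linarith
  have hbt := bt_pos n
  have hpi := pi_pos
  set v := 2 * M / bt n with hv
  have hv0 : 0 ≤ v := by positivity
  set W := Wk n v η (2 * J') eJ eK eL with hWdef
  have hW : Summable fun k => |W k| := Wk_summable hn _ _ _ eS eV eW
  have hW0 : W 0 = 0 := by simp [hWdef, Wk]
  have low : ∀ x ∈ Set.Icc 0 π, K + M * x ^ 2 / 20 ≤ π * rh W ((N - J' : ℕ) : ℝ) x := fun x hx =>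
    rho_lower hn hM hη.le hML hO h1' hQ h2' eA h3' hK hb hJ hx
  obtain ⟨α, hα⟩ := discretize (ρ0 := K / π) (ρ1 := M * δ ^ 2 / (20 * π)) (δ := δ) (rh_cont hW ((N - J' : ℕ) : ℝ)) (by positivity) (by positivity)
    (fun x hx => by have := low x hx; rw [div_le_iff₀ hpi]; nlinarith [mul_nonneg hM.le (sq_nonneg x)])
    (fun x hx => by
      have := low x ⟨hδ.le.trans hx.1, hx.2⟩
      have hq : δ ^ 2 ≤ x ^ 2 := by have := hx.1; gcongr
      have hq2 := mul_le_mul_of_nonneg_left hq hM.le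
      rw [div_le_iff₀ (by positivity)]; linarith)
    (by rw [one_div_div]; exact hKδ) (rh_int hW hW0 _)
  refine ⟨α, fun θ => ?_⟩
  set r := exp (-η) with hr
  have eM : r < 1 := by rw [hr, exp_lt_one_iff]; linarith
  have hrh : 1 / 2 ≤ r := by have := add_one_le_exp (-η); linarith
  have hz : ‖(r:ℂ) * eI θ‖ < 1 := by rw [norm_mul, eI_norm, Complex.norm_real, norm_of_nonneg (by linarith)]; linarith
  obtain ⟨gQ, c2⟩ := hα _ _ _ (fz_deriv hz) (fz1_deriv hz) (fz2_cont hz)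
  set gJ := ∫ x in (0:ℝ)..π, fz (r * eI θ) x * rh W ((N - J' : ℕ) : ℝ) x with hI0
  have hI := rh_fz hW hW0 ((N - J' : ℕ) : ℝ) hz
  have hF := Wk_fz hn v hη.le (2 * J') eS eV eW hv0 (eI_norm θ) hI
  rw [← hr] at hF
  have hne : ∀ {b : ℝ}, |b| < 1 → (1:ℂ) - r * b * eI θ ≠ 0 := fun {b} hb => one_sub_ne' (by
    rw [norm_mul, norm_mul, eI_norm, Complex.norm_real, Complex.norm_real, norm_of_nonneg (by linarith), norm_eq_abs, mul_one]
    exact lt_of_le_of_lt (mul_le_of_le_one_left (abs_nonneg _) eM.le) hb)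
  set T := (v:ℂ) * (FF n 0 (eI θ) - 1) - ((2 * J' : ℕ) + 1 / 2) * Complex.log (1 - r * eJ * eI θ) - 1 / 2 * Complex.log (1 - r * eK * eI θ)
      - Complex.log (1 - r * eL * eI θ) with hT
  set S := ∑ j ∈ Finset.range (N - J'), fz (r * eI θ) (α j) with hS
  refine ⟨S - T, ?_, ?_, fun gR gS => ?_⟩
  · have eF : ∏ j ∈ Finset.range (N - J'), (1 - 2 * ((r:ℂ) * eI θ) * cos (α j) + (r * eI θ) ^ 2) = Complex.exp S := by
      rw [hS, Complex.exp_sum]; exact Finset.prod_congr rfl fun j _ => (fz_exp hz _).symm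
    have eG : (v:ℂ) * (FF n 0 (eI θ) - 1) + (S - T) = S + ((2 * J' : ℕ) * Complex.log (1 - r * eJ * eI θ) + (1 / 2 * Complex.log (1 - r * eJ * eI θ))
      + (1 / 2 * Complex.log (1 - r * eK * eI θ)) + Complex.log (1 - r * eL * eI θ)) := by rw [hT]; ring
    rw [eF, eG, Complex.exp_add, Complex.exp_add, Complex.exp_add, Complex.exp_add, Complex.exp_nat_mul, Complex.exp_log (hne eS), Complex.exp_log (hne eW)]
    have s1 : ∀ {w : ℂ}, w ≠ 0 → Complex.exp (1 / 2 * Complex.log w) = sr w := fun hw => by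
      rw [← inv_inj, ← sr_exp hw, ← Complex.exp_neg]
    rw [s1 (hne eS), s1 (hne eV)]
    have gO : sr (1 - r * eJ * eI θ) ≠ 0 := fun h => hne eS (by rw [← sr_sr (1 - r * eJ * eI θ), h]; simp)
    have n2 : sr (1 - r * eK * eI θ) ≠ 0 := fun h => hne eV (by rw [← sr_sr (1 - r * eK * eI θ), h]; simp)
    have n3 := hne eS
    have n4 := hne eW
    rw [mul_inv_cancel_right₀ (by positivity)]
  · calc ‖S - T‖ ≤ ‖S - gJ‖ + ‖gJ - T‖ := norm_sub_le_norm_sub_add_norm_sub _ _ _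
      _ ≤ _ := add_le_add (gQ.trans (fz1_int hrh eM θ)) hF
  · calc ‖S - T‖ ≤ ‖S - gJ‖ + ‖gJ - T‖ := norm_sub_le_norm_sub_add_norm_sub _ _ _
      _ ≤ _ := add_le_add ((c2 (40 / δ ^ 2) (by positivity) fun x hx => fz2_far hrh eM hδ hδ' gR gS hx).trans ?_) hF
    rw [one_div_div, one_div_div]
    gcongr
    exact fz2_int (by linarith) eM θ

lemma quot_re {z w : ℂ} (hz : 0 ≤ z.re) (hw : 0 ≤ w.re) {s : ℝ} (hs : 0 ≤ s) : 0 ≤ ((s:ℂ) * (sr z / sr w)).re := by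
  rw [Complex.re_ofReal_mul]
  refine mul_nonneg hs ?_
  rw [Complex.div_re, ← add_div]
  refine div_nonneg ?_ (Complex.normSq_nonneg _)
  have a := abs_le.mp (sr_im hz)
  have b := abs_le.mp (sr_im hw)
  nlinarith [sr_re z, sr_re w]

lemma sub_one_le_sq {q : ℂ} (hq : 0 ≤ q.re) : ‖q - 1‖ ≤ ‖q ^ 2 - 1‖ := by
  have hO : 1 ≤ ‖q + 1‖ := by
    have := Complex.abs_re_le_norm (q + 1)
    simp only [Complex.add_re, Complex.one_re] at this
    rw [abs_of_nonneg (by linarith)] at this; linarith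
  rw [show q ^ 2 - 1 = (q - 1) * (q + 1) by ring, norm_mul]
  exact le_mul_of_one_le_right (norm_nonneg _) hO

noncomputable def gg (hU : ℝ) (ζ : ℂ) : ℂ := ((1 + hU) / 2 : ℝ) * ((1 - ζ) / (1 - hU * ζ))
noncomputable def eX (hU : ℝ) (ζ : ℂ) : ℂ := (√((1 + hU) / 2) : ℝ) * (sr (1 - ζ) / sr (1 - hU * ζ))
noncomputable def gC (eE : ℝ) (ζ : ℂ) : ℂ := (1 : ℝ) * (sr (1 + ζ) / sr (1 + eE * ζ))

lemma one_sub_re {r : ℝ} (hr : |r| ≤ 1) (θ : ℝ) : 0 ≤ (1 - (r:ℂ) * eI θ).re := by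
  simp only [Complex.sub_re, Complex.one_re, Complex.re_ofReal_mul, eI_re]
  have hO := abs_le.mp (abs_cos_le_one θ)
  have hQ := abs_le.mp hr
  have : |r * cos θ| ≤ 1 := by rw [abs_mul]; exact mul_le_one₀ hr (abs_nonneg _) (abs_cos_le_one θ)
  linarith [(abs_le.mp this).2]

lemma q1_sq {hU : ℝ} (eC : 0 ≤ hU) (ζ : ℂ) : eX hU ζ ^ 2 = gg hU ζ := by
  unfold eX gg; rw [mul_pow, div_pow, sr_sr, sr_sr, ← Complex.ofReal_pow, sq_sqrt (by linarith)]

lemma q2_sq (eE : ℝ) (ζ : ℂ) : gC eE ζ ^ 2 = (1 + ζ) / (1 + eE * ζ) := by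
  unfold gC; rw [mul_pow, div_pow, sr_sr, sr_sr]; simp

lemma norm_one_sub_sq (θ : ℝ) : ‖1 - eI θ‖ ^ 2 = 4 * sin (θ / 2) ^ 2 := by
  have := hr_sq 1 θ; simp at this; rw [this]

lemma gg_le {hU : ℝ} (eC : 0 ≤ hU) (hO : hU < 1) (θ : ℝ) : ‖gg hU (eI θ)‖ ≤ 1 := by
  have hne : 0 < ‖1 - (hU:ℂ) * eI θ‖ := norm_pos_iff.mpr (one_sub_ne (abs_lt.mpr ⟨by linarith, hO⟩) θ)
  unfold gg
  rw [norm_mul, norm_div, Complex.norm_real, norm_of_nonneg (by linarith), ← mul_div_assoc, div_le_one hne]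
  refine le_of_abs_le (abs_le_of_sq_le_sq ?_ hne.le)
  rw [mul_pow, norm_one_sub_sq, hr_sq]
  nlinarith [sq_nonneg (1 - hU), sin_sq_le_one (θ / 2), mul_nonneg (sq_nonneg (1 - hU)) (sub_nonneg.2 (sin_sq_le_one (θ / 2)))]

lemma gg_le2 {hU : ℝ} (eC : 0 ≤ hU) (hO : hU < 1) {θ : ℝ} (hθ : 0 ≤ θ) : ‖gg hU (eI θ)‖ ≤ θ / (1 - hU) := by
  have hd : 1 - hU ≤ ‖1 - (hU:ℂ) * eI θ‖ := by
    have := norm_sub_norm_le (1:ℂ) ((hU:ℂ) * eI θ)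
    rwa [norm_one, norm_mul, eI_norm, Complex.norm_real, mul_one, norm_of_nonneg eC] at this
  have hn : ‖1 - eI θ‖ ≤ θ := by
    refine le_of_abs_le (abs_le_of_sq_le_sq ?_ hθ)
    rw [norm_one_sub_sq]
    have := abs_sin_le_abs (x := θ / 2)
    have hQ := sq_le_sq.mpr this
    linarith
  unfold gg
  rw [norm_mul, norm_div, Complex.norm_real, norm_of_nonneg (by linarith)]
  calc _ ≤ 1 * (θ / (1 - hU)) := by
        have : 0 < 1 - hU := by linarith
        gcongr
        linarith
    _ = _ := one_mul _

lemma gg_sub {hU : ℝ} (eC : 0 ≤ hU) (hO : hU < 1) (θ : ℝ) : ‖gg hU (eI θ) - 1‖ = (1 - hU) / 2 * (‖1 + eI θ‖ * hr hU θ) := by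
  have hne := one_sub_ne (abs_lt.mpr ⟨by linarith, hO⟩ : |hU| < 1) θ
  have : gg hU (eI θ) - 1 = ((-((1 - hU) / 2) : ℝ) : ℂ) * ((1 + eI θ) * (1 - hU * eI θ)⁻¹) := by
    unfold gg; push_cast; field_simp; ring
  rw [this, norm_mul, norm_mul, norm_inv, Complex.norm_real, norm_neg, norm_of_nonneg (by linarith), hr]

lemma q2_norm {eE : ℝ} (eC : 0 ≤ eE) (hO : eE < 1) (θ : ℝ) : ‖gC eE (eI θ)‖ ≤ √2 := by
  have hd : 1 - eE ≤ ‖1 + (eE:ℂ) * eI θ‖ := by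
    have := norm_sub_norm_le (1:ℂ) (-((eE:ℂ) * eI θ))
    rwa [norm_one, norm_neg, norm_mul, eI_norm, Complex.norm_real, mul_one, norm_of_nonneg eC, sub_neg_eq_add] at this
  refine le_sqrt_of_sq_le ?_
  rw [← norm_pow, q2_sq, norm_div, div_le_iff₀ (by linarith)]
  have : ‖1 + eI θ‖ ≤ ‖1 + (eE:ℂ) * eI θ‖ + (1 - eE) := by
    calc ‖1 + eI θ‖ = ‖(1 + (eE:ℂ) * eI θ) + ((1 - eE : ℝ) : ℂ) * eI θ‖ := by congr 1; push_cast; ring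
      _ ≤ _ := by
        refine (norm_add_le _ _).trans (add_le_add le_rfl ?_)
        rw [norm_mul, eI_norm, Complex.norm_real, norm_of_nonneg (by linarith), mul_one]
  linarith

lemma q2_sub {eE : ℝ} (eC : 0 ≤ eE) (hO : eE < 1) (θ : ℝ) : ‖gC eE (eI θ) - 1‖ ≤ (1 - eE) * hr (-eE) θ := by
  have hne := one_sub_ne (abs_lt.mpr ⟨by linarith, by linarith⟩ : |(-eE)| < 1) θ
  push_cast at hne
  rw [neg_mul, sub_neg_eq_add] at hne
  have hre : 0 ≤ (gC eE (eI θ)).re := by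
    have a := one_sub_re (r := -1) (by simp) θ
    have b := one_sub_re (r := -eE) (by rw [abs_neg, abs_of_nonneg eC]; exact hO.le) θ
    push_cast at a b
    rw [neg_mul, sub_neg_eq_add] at a b
    rw [one_mul] at a
    exact quot_re a b (by norm_num)
  refine (sub_one_le_sq hre).trans (le_of_eq ?_)
  rw [q2_sq]
  have : (1 + eI θ) / (1 + eE * eI θ) - 1 = ((1 - eE : ℝ) : ℂ) * eI θ * (1 + eE * eI θ)⁻¹ := by
    rw [div_sub_one hne, ← div_eq_mul_inv]; congr 1; push_cast; ring
  rw [this, norm_mul, norm_mul, eI_norm, norm_inv, Complex.norm_real, norm_of_nonneg (by linarith), mul_one, hr]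
  push_cast; rw [neg_mul, sub_neg_eq_add]

lemma q1_norm {hU : ℝ} (eC : 0 ≤ hU) (hO : hU < 1) (θ : ℝ) : ‖eX hU (eI θ)‖ ≤ 1 := by
  have := gg_le eC hO θ
  rw [← q1_sq eC, norm_pow] at this
  exact (pow_le_one_iff_of_nonneg (norm_nonneg _) two_ne_zero).mp this

lemma q1_sub {hU : ℝ} (eC : 0 ≤ hU) (hO : hU < 1) (θ : ℝ) : ‖eX hU (eI θ) - 1‖ ≤ ‖gg hU (eI θ) - 1‖ := by
  rw [← q1_sq eC]
  refine sub_one_le_sq (quot_re ?_ (one_sub_re (by rw [abs_of_nonneg eC]; exact hO.le) θ) (sqrt_nonneg _))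
  have := one_sub_re (r := 1) (by simp) θ
  simpa using this

lemma chi1_sub {hU : ℝ} (eC : 0 ≤ hU) (hO : hU < 1) (J : ℕ) (θ : ℝ) : ‖gg hU (eI θ) ^ J * eX hU (eI θ) - 1‖ ≤ (J + 1) * ‖gg hU (eI θ) - 1‖ := by
  have hg := gg_le eC hO θ
  have hp : ∀ J : ℕ, ‖gg hU (eI θ) ^ J - 1‖ ≤ J * ‖gg hU (eI θ) - 1‖ := fun J => by
    induction J with
    | zero => simp
    | succ J ih =>
      rw [show gg hU (eI θ) ^ (J + 1) - 1 = gg hU (eI θ) ^ J * (gg hU (eI θ) - 1) + (gg hU (eI θ) ^ J - 1) by ring]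
      refine (norm_add_le _ _).trans ?_
      rw [norm_mul, norm_pow]
      have : ‖gg hU (eI θ)‖ ^ J * ‖gg hU (eI θ) - 1‖ ≤ 1 * ‖gg hU (eI θ) - 1‖ := by gcongr; exact pow_le_one₀ (norm_nonneg _) hg
      push_cast; linarith
  rw [show gg hU (eI θ) ^ J * eX hU (eI θ) - 1 = gg hU (eI θ) ^ J * (eX hU (eI θ) - 1) + (gg hU (eI θ) ^ J - 1) by ring]
  refine (norm_add_le _ _).trans ?_
  rw [norm_mul, norm_pow]
  have : ‖gg hU (eI θ)‖ ^ J * ‖eX hU (eI θ) - 1‖ ≤ 1 * ‖gg hU (eI θ) - 1‖ := by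
    gcongr
    · exact pow_le_one₀ (norm_nonneg _) hg
    · exact q1_sub eC hO θ
  linarith [hp J]

lemma kk_add {eB : ℝ} (eC : eB ≤ 0) (hO : -1 < eB) (θ : ℝ) : ‖kk eB (eI θ)‖ * ‖1 + eI θ‖ ≤ 2 ∧ ‖kk eB (eI θ)‖ ≤ 1 / (1 + eB) := by
  have hd : 1 + eB ≤ ‖1 - (eB:ℂ) * eI θ‖ := by
    have := norm_sub_norm_le (1:ℂ) ((eB:ℂ) * eI θ)
    rwa [norm_one, norm_mul, eI_norm, Complex.norm_real, mul_one, norm_of_nonpos eC, sub_neg_eq_add] at this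
  have hp : 0 < 1 + eB := by linarith
  have hq : 0 < ‖1 - (eB:ℂ) * eI θ‖ := by linarith
  unfold kk
  rw [norm_inv]
  constructor
  · rw [← div_eq_inv_mul, div_le_iff₀ hq]
    have : ‖1 + eI θ‖ ≤ ‖1 - (eB:ℂ) * eI θ‖ + (1 + eB) := by
      calc ‖1 + eI θ‖ = ‖(1 - (eB:ℂ) * eI θ) + ((1 + eB : ℝ) : ℂ) * eI θ‖ := by congr 1; push_cast; ring
        _ ≤ _ := by
          refine (norm_add_le _ _).trans (add_le_add le_rfl ?_)
          rw [norm_mul, eI_norm, Complex.norm_real, norm_of_nonneg hp.le, mul_one]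
    linarith
  · rw [inv_eq_one_div]; exact one_div_le_one_div_of_le hp hd

lemma kk_le_one {eB : ℝ} (eC : eB ≤ 0) {θ : ℝ} (hθ : 0 ≤ cos θ) : ‖kk eB (eI θ)‖ ≤ 1 := by
  unfold kk; rw [norm_inv]
  refine inv_le_one_of_one_le₀ ?_
  have := Complex.re_le_norm (1 - (eB:ℂ) * eI θ)
  simp only [Complex.sub_re, Complex.one_re, Complex.re_ofReal_mul, eI_re] at this
  nlinarith

noncomputable def XX (hU eE : ℝ) (J : ℕ) (e : ℂ) (ζ : ℂ) : ℂ := gg hU ζ ^ J * eX hU ζ * gC eE ζ * Complex.exp e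

lemma XX_norm {hU eE : ℝ} (eC : 0 ≤ hU) (hO : hU < 1) (hQ : 0 ≤ eE) (eA : eE < 1) (J : ℕ) (e : ℂ) (θ : ℝ) :
    ‖XX hU eE J e (eI θ)‖ ≤ √2 * (‖gg hU (eI θ)‖ ^ J * exp ‖e‖) := by
  unfold XX
  rw [norm_mul, norm_mul, norm_mul, norm_pow]
  have a := q1_norm eC hO θ
  have b := q2_norm hQ eA θ
  have c : ‖Complex.exp e‖ ≤ exp ‖e‖ := by rw [Complex.norm_exp]; exact exp_le_exp.mpr (Complex.re_le_norm _)
  calc _ ≤ ‖gg hU (eI θ)‖ ^ J * 1 * √2 * exp ‖e‖ := by gcongr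
    _ = _ := by ring

lemma XX_sub {hU eE eB : ℝ} (eC : 0 ≤ hU) (hO : hU < 1) (hQ : 0 ≤ eE) (eA : eE < 1) (hz : eB ≤ 0) (hz' : -1 < eB) (J : ℕ) {e : ℂ} (he : ‖e‖ ≤ 1) (θ : ℝ) :
    ‖kk eB (eI θ) * XX hU eE J e (eI θ) - kk eB (eI θ)‖ ^ 2 ≤
      54 * (J + 1) ^ 2 * (1 - hU) ^ 2 * hr hU θ ^ 2 + 27 * (1 / (1 + eB)) ^ 2 * (1 - eE) ^ 2 * hr (-eE) θ ^ 2 + 12 * ‖e‖ ^ 2 * hr eB θ ^ 2 := by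
  set k := kk eB (eI θ) with hk
  set gX := gg hU (eI θ) ^ J * eX hU (eI θ)
  set gY := gC eE (eI θ)
  set E := Complex.exp e
  have hkn : ‖k‖ = hr eB θ := by rw [hk, kk, norm_inv, hr]
  have hE : ‖E‖ ≤ 3 := by
    have c : ‖Complex.exp e‖ ≤ exp ‖e‖ := by rw [Complex.norm_exp]; exact exp_le_exp.mpr (Complex.re_le_norm _)
    have := exp_le_exp.mpr he
    linarith [exp_one_lt_three]
  have gZ : ‖E - 1‖ ≤ 2 * ‖e‖ := Complex.norm_exp_sub_one_le he
  obtain ⟨gG, gW⟩ := kk_add hz hz' θ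
  have hs2 : 0 ≤ √2 := sqrt_nonneg 2
  have A : ‖k * (gX - 1) * gY * E‖ ≤ (J + 1) * (1 - hU) * hr hU θ * √2 * 3 := by
    rw [norm_mul, norm_mul, norm_mul]
    have gQ := chi1_sub eC hO J θ
    rw [gg_sub eC hO] at gQ
    have eN := hr_nonneg hU θ
    have hp1 : 0 ≤ 1 - hU := by linarith
    have : ‖k‖ * ‖gX - 1‖ ≤ (J + 1) * (1 - hU) * hr hU θ := by
      calc _ ≤ ‖k‖ * ((J + 1) * ((1 - hU) / 2 * (‖1 + eI θ‖ * hr hU θ))) := mul_le_mul_of_nonneg_left gQ (norm_nonneg _)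
        _ = (‖k‖ * ‖1 + eI θ‖) * ((J + 1) * ((1 - hU) / 2 * hr hU θ)) := by ring
        _ ≤ 2 * ((J + 1) * ((1 - hU) / 2 * hr hU θ)) := mul_le_mul_of_nonneg_right gG (by positivity)
        _ = _ := by ring
    have q := q2_norm hQ eA θ
    have : 0 ≤ (J + 1) * (1 - hU) * hr hU θ := (by positivity : 0 ≤ ‖k‖ * ‖gX - 1‖).trans this
    gcongr
  have B : ‖k * (gY - 1) * E‖ ≤ 1 / (1 + eB) * (1 - eE) * hr (-eE) θ * 3 := by
    rw [norm_mul, norm_mul]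
    have c := q2_sub hQ eA θ
    have eN := hr_nonneg (-eE) θ
    have p1 : 0 ≤ 1 / (1 + eB) := by have : 0 < 1 + eB := by linarith
                                     positivity
    have p2 : 0 ≤ 1 - eE := by linarith
    calc _ ≤ 1 / (1 + eB) * ((1 - eE) * hr (-eE) θ) * 3 := by gcongr
      _ = _ := by ring
  have C : ‖k * (E - 1)‖ ≤ hr eB θ * (2 * ‖e‖) := by
    rw [norm_mul, hkn]; exact mul_le_mul_of_nonneg_left gZ (hr_nonneg _ _)
  have T : ‖k * XX hU eE J e (eI θ) - k‖ ≤ (J + 1) * (1 - hU) * hr hU θ * √2 * 3 + 1 / (1 + eB) * (1 - eE) * hr (-eE) θ * 3 + hr eB θ * (2 * ‖e‖) := by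
    have : k * XX hU eE J e (eI θ) - k = k * (gX - 1) * gY * E + k * (gY - 1) * E + k * (E - 1) := by
      simp only [XX, gX, gY, E]; ring
    rw [this]
    exact (norm_add_le _ _).trans (add_le_add ((norm_add_le _ _).trans (add_le_add A B)) C)
  have h2s : √2 ^ 2 = 2 := sq_sqrt (by norm_num)
  have cs : ∀ a b c : ℝ, (a + b + c) ^ 2 ≤ 3 * (a ^ 2 + b ^ 2 + c ^ 2) := fun a b c => by nlinarith [sq_nonneg (a - b), sq_nonneg (b - c), sq_nonneg (a - c)]
  calc _ ≤ _ := pow_le_pow_left₀ (norm_nonneg _) T 2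
    _ ≤ _ := cs _ _ _
    _ = _ := by simp only [mul_pow, h2s]; ring

noncomputable def HP (c : ℝ) (J : ℕ) (r : ℝ) (α : ℕ → ℝ) (m : ℕ) : ℝ[X] :=
  C c * ((1 - X) ^ J * ∏ j ∈ Finset.range m, (1 - C (2 * r * cos (α j)) * X + C (r ^ 2) * X ^ 2))

lemma HP_eval (c : ℝ) (J : ℕ) (r : ℝ) (α : ℕ → ℝ) (m : ℕ) (z : ℂ) : aeval z (HP c J r α m) =
    c * ((1 - z) ^ J * ∏ j ∈ Finset.range m, (1 - 2 * (r * z) * cos (α j) + (r * z) ^ 2)) := by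
  unfold HP
  simp only [map_mul, aeval_C, map_pow, map_sub, map_one, aeval_X, map_prod, map_add]
  congr 2
  refine Finset.prod_congr rfl fun j _ => ?_
  simp only [Complex.coe_algebraMap]; push_cast; ring

lemma HP_zero (c : ℝ) (J : ℕ) (r : ℝ) (α : ℕ → ℝ) (m : ℕ) : (HP c J r α m).coeff 0 = c := by
  rw [coeff_zero_eq_eval_zero, HP]; simp [eval_prod]

lemma HP_fac (r x : ℝ) : (1 - C (2 * r * x) * X + C (r ^ 2) * X ^ 2 : ℝ[X]).natDegree ≤ 2 := by compute_degree

lemma HP_fac2 (r x : ℝ) : (1 - C (2 * r * x) * X + C (r ^ 2) * X ^ 2 : ℝ[X]).coeff 2 = r ^ 2 := by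
  simp [coeff_one, -map_pow]

lemma HP_prod_deg (r : ℝ) (α : ℕ → ℝ) (m : ℕ) :
    (∏ j ∈ Finset.range m, (1 - C (2 * r * cos (α j)) * X + C (r ^ 2) * X ^ 2 : ℝ[X])).natDegree ≤ 2 * m := by
  refine (natDegree_prod_le _ _).trans ?_
  refine (Finset.sum_le_card_nsmul _ _ 2 fun j _ => HP_fac _ _).trans ?_
  simp [mul_comm]

lemma oneX_deg (J : ℕ) : ((1 - X : ℝ[X]) ^ J).natDegree ≤ J := by
  refine (natDegree_pow_le).trans ?_
  have : (1 - X : ℝ[X]).natDegree ≤ 1 := by compute_degree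
  nlinarith

lemma HP_deg (c : ℝ) (J : ℕ) (r : ℝ) (α : ℕ → ℝ) (m : ℕ) : (HP c J r α m).natDegree ≤ J + 2 * m := by
  refine (natDegree_C_mul_le _ _).trans (natDegree_mul_le.trans (add_le_add (oneX_deg J) (HP_prod_deg r α m)))

lemma HP_top (c : ℝ) (J : ℕ) (r : ℝ) (α : ℕ → ℝ) (m : ℕ) : (HP c J r α m).coeff (J + 2 * m) = c * ((-1) ^ J * r ^ (2 * m)) := by
  unfold HP
  rw [coeff_C_mul, coeff_mul_add_eq_of_natDegree_le (oneX_deg J) (HP_prod_deg r α m)]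
  congr 2
  · have h := coeff_pow_of_natDegree_le (m := J) (show (1 - X : ℝ[X]).natDegree ≤ 1 by compute_degree)
    rw [mul_one] at h
    rw [h]; simp [coeff_one]
  · have := coeff_prod_of_natDegree_le (Finset.range m) (fun j => (1 - C (2 * r * cos (α j)) * X + C (r ^ 2) * X ^ 2 : ℝ[X])) 2 (fun j _ => HP_fac _ _)
    rw [Finset.card_range, mul_comm m 2] at this
    rw [this]
    simp only [HP_fac2, Finset.prod_const, Finset.card_range, pow_mul]

lemma hr_sq_int {r : ℝ} (h : |r| < 1) : IntervalIntegrable (fun θ => hr r θ ^ 2) volume 0 π ∧ ∫ θ in (0:ℝ)..π, hr r θ ^ 2 = π / (1 - r ^ 2) := by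
  refine ⟨((hr_cont h).pow 2).intervalIntegrable _ _, ?_⟩
  rw [← poisson_int h]
  simp only [hr, inv_pow]

lemma trial_point {n : ℕ} {v r eJ eK eL hU eE eB θ : ℝ} {J : ℕ} {e : ℂ} {α : ℕ → ℝ} {m : ℕ} (hO : hU = r * eJ) (hQ : -eE = r * eK) (eA : eB = r * eL)
    (h : ∏ j ∈ Finset.range m, (1 - 2 * (r * eI θ) * cos (α j) + (r * eI θ) ^ 2) =
        Complex.exp (v * (FF n 0 (eI θ) - 1) + e) * ((1 - r * eJ * eI θ) ^ J * sr (1 - r * eJ * eI θ) *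
          sr (1 - r * eK * eI θ) * (1 - r * eL * eI θ))⁻¹) :
    aeval (eI θ) (HP (exp (v / 2) * ((1 + hU) / 2) ^ J * √((1 + hU) / 2)) J r α m) * (BB n v (eI θ) * ps (eI θ)) =
      kk eB (eI θ) * XX hU eE J e (eI θ) := by
  rw [HP_eval, h]
  have gQ : (r:ℂ) * eJ = hU := by rw [hO]; push_cast; ring
  have c2 : (r:ℂ) * eK = -eE := by rw [← Complex.ofReal_neg, hQ]; push_cast; ring
  have c3 : (r:ℂ) * eL = eB := by rw [eA]; push_cast; ring
  rw [gQ, c2, c3]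
  unfold XX gg eX gC kk BB ps
  have key : Complex.exp (v * (FF n 0 (eI θ) - 1) + e) * Complex.exp (v / 2 - v * FF n 0 (eI θ)) * Complex.exp (v/2) = Complex.exp e := by
    rw [← Complex.exp_add, ← Complex.exp_add]; congr 1; ring
  rw [← key, show (1 - -(eE:ℂ) * eI θ) = 1 + eE * eI θ by ring]
  push_cast
  simp only [mul_inv, mul_pow, inv_pow, div_eq_mul_inv, one_mul]
  ring

lemma tr_e1 (s : ℝ) (eC : 0 ≤ s) (hO : s < 1) : (1 - s) ^ 2 * (π / (1 - s ^ 2)) ≤ (1 - s) * π := by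
  have hQ : 0 < 1 - s := by linarith
  rw [show (1 - s ^ 2) = (1 - s) * (1 + s) by ring, mul_div_assoc', div_le_iff₀ (by positivity)]
  have : 0 ≤ (1 - s) ^ 2 * π * s := by positivity
  linarith

lemma tr_e2 {r x : ℝ} (hr : 0 < r) (hO : r < 1) (hx : 0 ≤ x) : r * (1 - x) < 1 := by
  have := mul_nonneg hr.le hx
  linarith

set_option maxHeartbeats 1000000 in
lemma trial {n : ℕ} (hn : 1 ≤ n) {M L K η δ δ1 eB eT r hU : ℝ} {N J' : ℕ} (hM : 0 < M) (hη : 0 < η) (hη' : η ≤ 1 / 2) (hML : M + L = N)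
    (hd1 : 0 < δ1) (hd1' : δ1 ≤ 1) (hr : r = exp (-η)) (eM : hU = r * (1 - δ1)) (eA : eB ≤ 0) (h3' : -r < eB)
    (hK : K + 2 * M / bt n * η * AA n + ((2 * J' : ℕ) + 1 / 2) / δ1 + J' ≤ L) (hb : 1 / 2 / η + 1 / (1 + eB / r) ≤ M / 8)
    (hJ : J' ≤ N) (hδ : 0 < δ) (hδ' : 2 * δ ≤ 1) (hK0 : 0 < K) (hKδ : π / K ≤ δ / 2)
    (hE0 : (2 * δ / (1 - hU)) ^ (2 * J') * exp (9 * log (2 / (1 - r)) + 2 * M / bt n * η ^ 2 * AA n) ≤ 1)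
    (gZ : 20 * π / (M * δ ^ 2) * (2 * π / (1 - r ^ 2)) + π / K * (40 / δ ^ 2) * π + 2 * M / bt n * η ^ 2 * AA n ≤ eT) (hE2 : eT ≤ 1) :
    ∃ H : ℝ[X], H.natDegree ≤ 2 * N ∧ H.coeff 0 = exp (2 * M / bt n / 2) * ((1 + hU) / 2) ^ (2 * J') * √((1 + hU) / 2) ∧
      H.coeff (2 * N) = H.coeff 0 * r ^ (2 * (N - J')) ∧
      (∀ θ ∈ Set.Icc 0 π, ‖aeval (eI θ) H * (BB n (2 * M / bt n) (eI θ) * ps (eI θ))‖ * ‖1 - eB * eI θ‖ ≤ 4) ∧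
      ∫ θ in (0:ℝ)..π, ‖aeval (eI θ) H * (BB n (2 * M / bt n) (eI θ) * ps (eI θ)) - kk eB (eI θ)‖ ^ 2 ≤
        12 * δ + 54 * ((2 * J' : ℕ) + 1) ^ 2 * (1 - hU) * π + 27 * (1 / (1 + eB)) ^ 2 * (1 - r * (1 - η)) * π + 12 * eT ^ 2 * (π / (1 + eB)) := by
  have eN : 0 < r := hr ▸ exp_pos _
  have hrl : r < 1 := by rw [hr, exp_lt_one_iff]; linarith
  have hr1l : hU < 1 := by rw [eM]; exact tr_e2 eN hrl hd1.le
  have gK : 0 ≤ hU := by rw [eM]; exact mul_nonneg eN.le (by linarith)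
  set eE := r * (1 - η) with hr2
  have kA : 0 ≤ eE := mul_nonneg eN.le (by linarith)
  have hr2l : eE < 1 := by rw [hr2]; exact tr_e2 eN hrl hη.le
  have hz' : -1 < eB := by linarith
  have hb3 : -1 < eB / r := by rw [lt_div_iff₀ eN]; linarith
  have hpi := pi_gt_three
  obtain ⟨α, hα⟩ := approx hn (M := M) (L := L) (K := K) (η := η) (δ := δ) (eJ := 1 - δ1) (eK := -(1 - η)) (eL := eB / r) (N := N) (J' := J') hM hη hη' hML
    (by linarith) (by linarith) (by linarith) (by linarith) (div_nonpos_of_nonpos_of_nonneg eA eN.le) hb3 (by convert hK using 4; ring)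
    (by convert hb using 3; ring) hJ hδ (by linarith) hK0 hKδ
  rw [← hr] at hα
  set v := 2 * M / bt n with hv
  set E0 := 9 * log (2 / (1 - r)) + v * η ^ 2 * AA n with hE0d
  set c := exp (v / 2) * ((1 + hU) / 2) ^ (2 * J') * √((1 + hU) / 2) with hc
  set H := HP c (2 * J') r α (N - J') with hH
  have h2N : 2 * N = 2 * J' + 2 * (N - J') := by omega
  have pt : ∀ θ : ℝ, ∃ e : ℂ, aeval (eI θ) H * (BB n v (eI θ) * ps (eI θ)) = kk eB (eI θ) * XX hU eE (2 * J') e (eI θ) ∧ ‖e‖ ≤ E0 ∧ (2 * δ ≤ θ → θ ≤ π → ‖e‖ ≤ eT) := by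
    intro θ
    obtain ⟨e, hO, hQ, eA⟩ := hα θ
    exact ⟨e, trial_point eM (by rw [hr2]; ring) (by field_simp) hO, hQ, fun a b => (eA a b).trans gZ⟩
  have near : ∀ θ e, 0 ≤ θ → θ ≤ 2 * δ → ‖e‖ ≤ E0 → ‖XX hU eE (2 * J') e (eI θ)‖ ≤ √2 := by
    intro θ e eC hO hQ
    refine (XX_norm gK hr1l kA hr2l _ e θ).trans (mul_le_of_le_one_right (sqrt_nonneg _) (le_trans ?_ hE0))
    have hp1 : 0 < 1 - hU := by linarith
    have : ‖gg hU (eI θ)‖ ≤ 2 * δ / (1 - hU) := (gg_le2 gK hr1l eC).trans (by gcongr)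
    gcongr
  have s2 : √2 ≤ 1.42 := by rw [sqrt_le_left (by norm_num)]; norm_num
  have hkk : ∀ θ, 0 < ‖(1:ℂ) - eB * eI θ‖ := fun θ => norm_pos_iff.mpr (one_sub_ne (by rw [abs_of_nonpos eA]; linarith) θ)
  refine ⟨H, h2N ▸ HP_deg _ _ _ _ _, HP_zero _ _ _ _ _, ?_, ?_, ?_⟩
  · rw [h2N, hH, HP_top, HP_zero, Even.neg_one_pow (even_two_mul _), one_mul, hc]
  · intro θ hθ
    obtain ⟨e, hO, hQ, eA⟩ := pt θ
    rw [hO, norm_mul, kk, norm_inv, mul_assoc, mul_comm, mul_assoc, mul_inv_cancel₀ (hkk θ).ne', mul_one]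
    rcases le_total θ (2 * δ) with h | h
    · linarith [near θ e hθ.1 h hQ]
    · refine (XX_norm gK hr1l kA hr2l _ e θ).trans ?_
      have a : ‖gg hU (eI θ)‖ ^ (2 * J') ≤ 1 := pow_le_one₀ (norm_nonneg _) (gg_le gK hr1l θ)
      have b : exp ‖e‖ ≤ 2.7182818286 := (exp_le_exp.mpr ((eA h hθ.2).trans hE2)).trans exp_one_lt_d9.le
      calc √2 * (‖gg hU (eI θ)‖ ^ (2 * J') * exp ‖e‖) ≤ 1.42 * (1 * 2.7182818286) := by gcongr
        _ ≤ 4 := by norm_num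
  · have hcont : Continuous fun θ : ℝ => ‖aeval (eI θ) H * (BB n v (eI θ) * ps (eI θ)) - kk eB (eI θ)‖ ^ 2 := by
      have a : Continuous fun θ : ℝ => aeval (eI θ) H := (Polynomial.continuous_aeval H).comp eI_cont
      have b : Continuous fun θ : ℝ => BB n v (eI θ) * ps (eI θ) := by
        have := Ph_cont hn 0 v
        unfold Ph at this
        simpa only [pow_zero, one_mul] using this
      have d : Continuous fun θ : ℝ => kk eB (eI θ) := (continuous_const.sub (continuous_const.mul eI_cont)).inv₀ fun θ => norm_pos_iff.mp (hkk θ)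
      fun_prop
    set f := fun θ : ℝ => ‖aeval (eI θ) H * (BB n v (eI θ) * ps (eI θ)) - kk eB (eI θ)‖ ^ 2 with hf
    have hfi : ∀ a b, IntervalIntegrable f volume a b := fun a b => hcont.intervalIntegrable a b
    rw [← intervalIntegral.integral_add_adjacent_intervals (hfi 0 (2 * δ)) (hfi (2 * δ) π)]
    have p1 : ∫ θ in (0:ℝ)..(2 * δ), f θ ≤ 12 * δ := by
      have : ∫ θ in (0:ℝ)..(2 * δ), f θ ≤ ∫ θ in (0:ℝ)..(2 * δ), (6:ℝ) := by
        refine intervalIntegral.integral_mono_on (by linarith) (hfi _ _) (by simp) fun θ hθ => ?_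
        obtain ⟨e, hO, hQ, _⟩ := pt θ
        have gG : ‖kk eB (eI θ)‖ ≤ 1 := kk_le_one eA (cos_nonneg_of_mem_Icc ⟨by linarith [hθ.1], by linarith [hθ.2]⟩)
        have gW := near θ e hθ.1 hθ.2 hQ
        have : ‖kk eB (eI θ) * XX hU eE (2 * J') e (eI θ) - kk eB (eI θ)‖ ≤ 2.42 := by
          refine (norm_sub_le _ _).trans ?_
          rw [norm_mul]
          linarith [mul_le_mul gG gW (norm_nonneg _) zero_le_one]
        simp only [hf, hO]
        exact (pow_le_pow_left₀ (norm_nonneg _) this 2).trans (by norm_num)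
      refine this.trans (le_of_eq ?_)
      rw [intervalIntegral.integral_const]; simp; ring
    have p2 : ∫ θ in (2 * δ)..π, f θ ≤ 54 * ((2 * J' : ℕ) + 1) ^ 2 * (1 - hU) * π + 27 * (1 / (1 + eB)) ^ 2 * (1 - eE) * π + 12 * eT ^ 2 * (π / (1 + eB)) := by
      set G := fun θ : ℝ => 54 * ((2 * J' : ℕ) + 1) ^ 2 * (1 - hU) ^ 2 * _root_.hr hU θ ^ 2 + 27 * (1 / (1 + eB)) ^ 2 * (1 - eE) ^ 2 * _root_.hr (-eE) θ ^ 2 + 12 * eT ^ 2 * _root_.hr eB θ ^ 2 with hG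
      have eS : |hU| < 1 := by rw [abs_of_nonneg gK]; exact hr1l
      have eV : |-eE| < 1 := by rw [abs_neg, abs_of_nonneg kA]; exact hr2l
      have eW : |eB| < 1 := by rw [abs_of_nonpos eA]; linarith
      obtain ⟨i1, j1⟩ := hr_sq_int eS
      obtain ⟨i2, j2⟩ := hr_sq_int eV
      obtain ⟨i3, j3⟩ := hr_sq_int eW
      have hGc : Continuous G := by have := hr_cont eS; have := hr_cont eV; have := hr_cont eW; fun_prop
      have hGi : ∀ a b, IntervalIntegrable G volume a b := fun a b => hGc.intervalIntegrable a b
      have eX : ∫ θ in (2 * δ)..π, f θ ≤ ∫ θ in (2 * δ)..π, G θ := by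
        refine intervalIntegral.integral_mono_on (by linarith) (hfi _ _) (hGi _ _) fun θ hθ => ?_
        obtain ⟨e, hO, _, hQ⟩ := pt θ
        have hQ := hQ hθ.1 hθ.2
        simp only [hf, hO, hG]
        refine (XX_sub gK hr1l kA hr2l eA hz' _ (hQ.trans hE2) θ).trans ?_
        gcongr
      have gC : ∫ θ in (2 * δ)..π, G θ ≤ ∫ θ in (0:ℝ)..π, G θ := by
        rw [← intervalIntegral.integral_add_adjacent_intervals (hGi 0 (2 * δ)) (hGi (2 * δ) π)]
        refine le_add_of_nonneg_left (intervalIntegral.integral_nonneg (by linarith) fun θ _ => ?_)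
        simp only [hG]; positivity
      refine eX.trans (gC.trans ?_)
      simp only [hG]
      rw [intervalIntegral.integral_add ((i1.const_mul _).add (i2.const_mul _)) (i3.const_mul _), intervalIntegral.integral_add (i1.const_mul _) (i2.const_mul _)]
      simp only [intervalIntegral.integral_const_mul, j1, j2, j3]
      have eP : π / (1 - eB ^ 2) ≤ π / (1 + eB) := by
        apply div_le_div_of_nonneg_left pi_pos.le (by linarith)
        nlinarith only [eA, hz']
      have gR := mul_le_mul_of_nonneg_left (tr_e1 hU gK hr1l) (show 0 ≤ 54 * (((2 * J' : ℕ):ℝ) + 1) ^ 2 by positivity)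
      have gS := mul_le_mul_of_nonneg_left (tr_e1 eE kA hr2l) (show 0 ≤ 27 * (1 / (1 + eB)) ^ 2 by positivity)
      have t3 := mul_le_mul_of_nonneg_left eP (show 0 ≤ 12 * eT ^ 2 by positivity)
      rw [neg_sq]
      linarith
    linarith

lemma cheb_nat {z : ℂ} (hz : z ≠ 0) (m : ℕ) : aeval (z + z⁻¹) (Chebyshev.C ℝ m) = z ^ (m:ℤ) + z ^ (-(m:ℤ)) ∧ (Chebyshev.C ℝ m).natDegree ≤ m := by
  induction m using Nat.twoStepInduction with
  | zero => simp [map_ofNat]; norm_num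
  | one => simp
  | more m hO hQ =>
    have e : Chebyshev.C ℝ ((m + 2 : ℕ) : ℤ) = X * Chebyshev.C ℝ ((m + 1 : ℕ) : ℤ) - Chebyshev.C ℝ (m : ℤ) := by
      push_cast; exact Chebyshev.C_add_two ℝ _
    rw [e]
    constructor
    · rw [map_sub, map_mul, aeval_X, hO.1, hQ.1]
      simp only [zpow_neg, zpow_natCast]
      field_simp; ring
    · refine (natDegree_sub_le _ _).trans (max_le (natDegree_mul_le.trans ?_) (by omega))
      rw [natDegree_X]; omega

lemma cheb {z : ℂ} (hz : z ≠ 0) (m : ℤ) : aeval (z + z⁻¹) (Chebyshev.C ℝ m) = z ^ m + z ^ (-m) ∧ (Chebyshev.C ℝ m).natDegree ≤ m.natAbs := by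
  rw [← Chebyshev.C_natAbs]
  have h := cheb_nat hz m.natAbs
  refine ⟨?_, h.2⟩
  rw [h.1]
  rcases Int.natAbs_eq m with h | h <;> rw [h] <;> simp [add_comm]

noncomputable def pT (μ a : ℝ) (N : ℕ) (H : ℝ[X]) : ℝ[X] :=
  C μ * ∑ k ∈ Finset.range (2 * N + 1), C (H.coeff k) * (Chebyshev.C ℝ ((k:ℤ) - N)).comp (C (4 / a) * X - 2)

lemma pT_deg (μ a : ℝ) (N : ℕ) (H : ℝ[X]) : (pT μ a N H).natDegree ≤ N := by
  refine (natDegree_C_mul_le _ _).trans (natDegree_sum_le_of_forall_le _ _ fun k hk => (natDegree_C_mul_le _ _).trans (natDegree_comp_le.trans ?_))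
  have hO := (cheb (one_ne_zero) ((k:ℤ) - N)).2
  have hQ : (C (4 / a) * X - 2 : ℝ[X]).natDegree ≤ 1 := by compute_degree
  have := Finset.mem_range.mp hk
  have eA : ((k:ℤ) - N).natAbs ≤ N := by omega
  calc _ ≤ N * 1 := Nat.mul_le_mul (hO.trans eA) hQ
    _ = N := mul_one _

lemma pT_eval (μ : ℝ) {a : ℝ} (ha : 0 < a) {N : ℕ} {H : ℝ[X]} (hH : H.natDegree ≤ 2 * N) {z : ℂ} (hz : z ≠ 0) :
    aeval (((a / 4 : ℝ) : ℂ) * (z + 2 + z⁻¹)) (pT μ a N H) = μ * (z⁻¹ ^ N * aeval z H + z ^ N * aeval z⁻¹ H) := by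
  unfold pT
  rw [map_mul, aeval_C, map_sum]
  simp only [Complex.coe_algebraMap]
  congr 1
  rw [Polynomial.aeval_eq_sum_range' (Nat.lt_succ_of_le hH), Polynomial.aeval_eq_sum_range' (Nat.lt_succ_of_le hH), Finset.mul_sum, Finset.mul_sum, ← Finset.sum_add_distrib]
  refine Finset.sum_congr rfl fun k _ => ?_
  rw [map_mul, aeval_C, aeval_comp]
  have : aeval (((a / 4 : ℝ) : ℂ) * (z + 2 + z⁻¹)) (C (4 / a) * X - 2 : ℝ[X]) = z + z⁻¹ := by
    have ha' : (a:ℂ) ≠ 0 := by exact_mod_cast ha.ne'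
    simp [map_ofNat]; field_simp; ring
  rw [this, (cheb hz _).1]
  simp only [Complex.coe_algebraMap, Algebra.smul_def, neg_sub, zpow_sub₀ hz, zpow_natCast, inv_pow]
  field_simp

lemma pT_circle (μ : ℝ) {a : ℝ} (ha : 0 < a) {N : ℕ} {H : ℝ[X]} (hH : H.natDegree ≤ 2 * N) (θ : ℝ) :
    (pT μ a N H).eval (a * cos (θ / 2) ^ 2) = 2 * μ * ((starRingEnd ℂ) (eI θ ^ N) * aeval (eI θ) H).re := by
  have h := (qq_eval (a := a) (pT_deg μ a N H) (eI_ne θ)).symm.trans (qq_circle (pT_deg μ a N H) θ)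
  have h := mul_left_cancel₀ (pow_ne_zero _ (eI_ne θ)) h
  rw [pT_eval μ ha hH (eI_ne θ)] at h
  have hO : (eI θ)⁻¹ = (starRingEnd ℂ) (eI θ) := by rw [Complex.inv_def, Complex.normSq_eq_norm_sq, eI_norm]; simp
  have hQ : aeval ((starRingEnd ℂ) (eI θ)) H = (starRingEnd ℂ) (aeval (eI θ) H) := Polynomial.aeval_conj H _
  have eA := congrArg Complex.re h
  rw [Complex.ofReal_re, Complex.re_ofReal_mul, hO, hQ] at eA
  rw [← eA, map_pow]
  have : (eI θ) ^ N * (starRingEnd ℂ) (aeval (eI θ) H) = (starRingEnd ℂ) ((starRingEnd ℂ) (eI θ) ^ N * aeval (eI θ) H) := by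
    rw [map_mul, map_pow, Complex.conj_conj]
  rw [this, Complex.add_re, Complex.conj_re]; ring

lemma pT_zero (μ : ℝ) {a : ℝ} (ha : 0 < a) {N : ℕ} {H : ℝ[X]} (hH : H.natDegree ≤ 2 * N) :
    (pT μ a N H).coeff N * (a / 4) ^ N = μ * (H.coeff 0 + H.coeff (2 * N)) := by
  have h : qq a N (pT μ a N H) = fun z => (μ:ℂ) * (aeval z H + ∑ k ∈ Finset.range (2 * N + 1), (H.coeff k : ℂ) * z ^ (2 * N - k)) := by
    refine Continuous.ext_on (dense_compl_singleton (0:ℂ)) (qq_diff _ _ _).continuous ?_ fun z hz => ?_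
    · have := Polynomial.continuous_aeval (A := ℂ) H
      fun_prop
    · have hz : z ≠ 0 := hz
      rw [qq_eval (pT_deg μ a N H) hz, pT_eval μ ha hH hz]
      have eF : z ^ N * z⁻¹ ^ N = 1 := by rw [← mul_pow, mul_inv_cancel₀ hz, one_pow]
      have eG : z ^ (2 * N) * aeval z⁻¹ H = ∑ k ∈ Finset.range (2 * N + 1), (H.coeff k : ℂ) * z ^ (2 * N - k) := by
        rw [Polynomial.aeval_eq_sum_range' (Nat.lt_succ_of_le hH), Finset.mul_sum]
        refine Finset.sum_congr rfl fun k hk => ?_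
        have hk' : k ≤ 2 * N := Nat.lt_succ_iff.mp (Finset.mem_range.mp hk)
        rw [Algebra.smul_def, pow_sub₀ z hz hk', Complex.coe_algebraMap, inv_pow]; ring
      rw [← eG, two_mul, pow_add]
      linear_combination (μ:ℂ) * aeval z H * eF
  have eC := congrFun h 0
  rw [qq_zero] at eC
  have : ∑ k ∈ Finset.range (2 * N + 1), (H.coeff k : ℂ) * 0 ^ (2 * N - k) = H.coeff (2 * N) := by
    rw [Finset.sum_eq_single_of_mem (2 * N) (by simp)]
    · simp
    · intro j hj hne
      have : 2 * N - j ≠ 0 := by have := Finset.mem_range.mp hj; omega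
      simp [this]
  simp only [this] at eC
  rw [← Polynomial.coeff_zero_eq_aeval_zero'] at eC
  simp only [Complex.coe_algebraMap] at eC
  exact_mod_cast eC

lemma EE_conj {n : ℕ} (v a : ℝ) (N : ℕ) (P : ℝ[X]) {z : ℂ} (hz : ‖z‖ ≤ 1) : EE n v a N P ((starRingEnd ℂ) z) = (starRingEnd ℂ) (EE n v a N P z) := by
  unfold EE; rw [qq_conj, BB_conj, ps_conj hz, map_mul, map_mul]

lemma EE_disc {n : ℕ} (hn : 1 ≤ n) {μ a v eB : ℝ} (hμ : 0 < μ) (ha : 0 < a) {N : ℕ} {H : ℝ[X]} (hH : H.natDegree ≤ 2 * N)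
    (hb : ∀ θ ∈ Set.Icc 0 π, ‖aeval (eI θ) H * (BB n v (eI θ) * ps (eI θ))‖ * ‖1 - eB * eI θ‖ ≤ 4) {z : ℂ} (hz : ‖z‖ ≤ 1) :
    ‖EE n v a N (pT μ a N H) z‖ * ‖1 - eB * z‖ ≤ 8 * μ := by
  have hO : ∀ θ ∈ Set.Icc 0 π, ‖EE n v a N (pT μ a N H) (eI θ)‖ * ‖1 - eB * eI θ‖ ≤ 8 * μ := by
    intro θ hθ
    have : ‖qq a N (pT μ a N H) (eI θ)‖ ≤ 2 * μ * ‖aeval (eI θ) H‖ := by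
      rw [qq_circle (pT_deg _ _ _ _), norm_mul, norm_pow, eI_norm, one_pow, one_mul, Complex.norm_real, pT_circle μ ha hH, norm_eq_abs, abs_mul, abs_of_pos (by positivity : 0 < 2 * μ)]
      refine mul_le_mul_of_nonneg_left ((Complex.abs_re_le_norm _).trans (le_of_eq ?_)) (by positivity)
      rw [norm_mul, RCLike.norm_conj, norm_pow, eI_norm, one_pow, one_mul]
    unfold EE
    have h := hb θ hθ
    rw [norm_mul] at h ⊢
    calc _ ≤ 2 * μ * ‖aeval (eI θ) H‖ * ‖BB n v (eI θ) * ps (eI θ)‖ * ‖1 - eB * eI θ‖ := by gcongr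
      _ = 2 * μ * (‖aeval (eI θ) H‖ * ‖BB n v (eI θ) * ps (eI θ)‖ * ‖1 - eB * eI θ‖) := by ring
      _ ≤ 2 * μ * 4 := by gcongr
      _ = 8 * μ := by ring
  have hd : DiffContOnCl ℂ (fun z => EE n v a N (pT μ a N H) z * (1 - eB * z)) (Metric.ball 0 1) := by
    refine DiffContOnCl.smul (𝕜' := ℂ) (DiffContOnCl.smul (𝕜' := ℂ) (qq_diff _ _ _).diffContOnCl (DiffContOnCl.smul (𝕜' := ℂ) (BB_diffCont hn v) ps_diffCont)) ?_
    exact Differentiable.diffContOnCl (by fun_prop)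
  rw [← norm_mul]
  refine Complex.norm_le_of_forall_mem_frontier_norm_le Metric.isBounded_ball hd (C := 8 * μ) (fun w hw => ?_) (z := z) (by rw [closure_ball _ one_ne_zero]; simpa using hz)
  rw [frontier_ball _ one_ne_zero, mem_sphere_zero_iff_norm] at hw
  have hw' : w = eI (Complex.arg w) := by have := Complex.norm_mul_exp_arg_mul_I w; rw [hw] at this; rw [eI]; simpa using this.symm
  rw [norm_mul]
  rcases le_total 0 (Complex.arg w) with h | h
  · rw [hw']; exact hO _ ⟨h, Complex.arg_le_pi w⟩
  · have hQ := hO (-Complex.arg w) ⟨by linarith, by linarith [Complex.neg_pi_lt_arg w]⟩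
    have e : eI (-Complex.arg w) = (starRingEnd ℂ) w := by conv_rhs => rw [hw', eI_conj]
    rw [e, EE_conj _ _ _ _ hw.le, RCLike.norm_conj] at hQ
    have : 1 - (eB:ℂ) * (starRingEnd ℂ) w = (starRingEnd ℂ) (1 - eB * w) := by simp
    rwa [this, RCLike.norm_conj] at hQ

lemma exp_arith {L M y b : ℝ} (hL : 1 ≤ L) (hM : 600 * L ^ 3 ≤ M) (hb : 1 ≤ b) (hy : 0 < y) :
    (2 * L + 1) * y - M * b / 2 * (y ^ 2 * (y / (4 + y))) ≤ 1 - L * y := by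
  have gT : 0 ≤ M := le_trans (by positivity) hM
  suffices (3 * L + 1) * y - 300 * L ^ 3 * (y ^ 2 * (y / (4 + y))) ≤ 1 by
    have hO : 300 * L ^ 3 ≤ M * b / 2 := by nlinarith
    have hQ := mul_le_mul_of_nonneg_right hO (show 0 ≤ y ^ 2 * (y / (4 + y)) by positivity)
    linarith
  rcases le_total (4 * (L * y)) 1 with h | h
  · have : 0 ≤ 300 * L ^ 3 * (y ^ 2 * (y / (4 + y))) := by positivity
    nlinarith
  · have eA : 4 * L * y ≤ 300 * L ^ 3 * (y ^ 2 * (y / (4 + y))) := by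
      rw [show 300 * L ^ 3 * (y ^ 2 * (y / (4 + y))) = 300 * L ^ 3 * y ^ 2 * y / (4 + y) by ring, le_div_iff₀ (by positivity)]
      have eH : 16 + 4 * y ≤ 300 * (L * y) ^ 2 := by nlinarith
      have := mul_le_mul_of_nonneg_left eH (show 0 ≤ L * y by positivity)
      nlinarith
    nlinarith

lemma EE_pos {n : ℕ} (v a : ℝ) {N : ℕ} {P : ℝ[X]} (hP : P.natDegree ≤ N) (y : ℝ) :
    EE n v a N P ((exp (-y) : ℝ) : ℂ) = ((exp (-y) ^ N * P.eval (a * cosh (y / 2) ^ 2) : ℝ) : ℂ) * (BB n v ((exp (-y) : ℝ) : ℂ) * ps ((exp (-y) : ℝ) : ℂ)) := by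
  unfold EE
  rw [qq_eval hP (by exact_mod_cast (exp_pos _).ne')]
  have : ((a / 4 : ℝ) : ℂ) * (((exp (-y) : ℝ) : ℂ) + 2 + ((exp (-y) : ℝ) : ℂ)⁻¹) = ((a * cosh (y / 2) ^ 2 : ℝ) : ℂ) := by
    have h : a / 4 * (exp (-y) + 2 + (exp (-y))⁻¹) = a * cosh (y / 2) ^ 2 := by
      rw [← exp_neg, neg_neg, cosh_eq, show y = y / 2 + y / 2 by ring, neg_add, exp_add, exp_add]
      have := exp_add (y / 2) (-(y / 2))
      rw [add_neg_cancel, exp_zero] at this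
      rw [show (y / 2 + y / 2) / 2 = y / 2 by ring]
      linear_combination (a / 2) * this
    rw [← h]; push_cast; ring
  rw [this]
  have hQ : aeval ((a * cosh (y / 2) ^ 2 : ℝ) : ℂ) P = ((P.eval (a * cosh (y / 2) ^ 2) : ℝ) : ℂ) := Polynomial.aeval_ofReal ..
  rw [hQ]; push_cast; ring

lemma tail_pt {n : ℕ} {a v eB μ : ℝ} (ha : 0 < a) (hav : a ^ bt n = v * eQ n) (hz : eB ≤ 0) {N : ℕ} {p : ℝ[X]} (hp : p.natDegree ≤ N)
    (hE : ∀ z : ℂ, ‖z‖ ≤ 1 → ‖EE n v a N p z‖ * ‖1 - eB * z‖ ≤ 8 * μ) {y : ℝ} (hy : 0 < y) :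
    (a / 2 * sinh y) * (p.eval (a * cosh (y / 2) ^ 2) ^ 2 * exp (-((a * cosh (y / 2) ^ 2) ^ bt n))) ≤
      16 * μ ^ 2 * a * exp ((2 * N + 1) * y - v * De n y) := by
  set x := a * cosh (y / 2) ^ 2 with hx
  set E := exp (-y) with hEd
  have hE0 : 0 < E := exp_pos _
  have gZ : E < 1 := by rw [hEd, exp_lt_one_iff]; linarith
  have hc : 0 < cosh (y / 2) := cosh_pos _
  have hO := hE ((E : ℝ) : ℂ) (by rw [Complex.norm_real, norm_eq_abs, abs_of_pos hE0]; exact gZ.le)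
  have hQ : 1 ≤ ‖(1:ℂ) - eB * ((E : ℝ) : ℂ)‖ := by
    rw [show (1:ℂ) - eB * ((E : ℝ) : ℂ) = ((1 - eB * E : ℝ) : ℂ) by push_cast; ring, Complex.norm_real]
    exact le_trans (by nlinarith) (le_abs_self _)
  have eA : ‖EE n v a N p ((E : ℝ) : ℂ)‖ ^ 2 ≤ (8 * μ) ^ 2 :=
    pow_le_pow_left₀ (norm_nonneg _) ((le_mul_of_one_le_right (norm_nonneg _) hQ).trans hO) 2
  have eH : exp (-(x ^ bt n)) = exp (-(v * Zf n 1 y)) * exp (-(v * De n y)) := by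
    rw [← exp_add]; congr 1
    have : x ^ bt n = v * eQ n * cosh (y / 2) ^ (2 * n + 1) := by
      rw [hx, mul_rpow ha.le (by positivity), hav, ← rpow_natCast, ← rpow_natCast, ← rpow_mul hc.le]
      congr 2; unfold bt; push_cast; ring
    rw [this, De]; ring
  rw [EE_pos v a hp, norm_mul, norm_mul, mul_pow, mul_pow, BB_norm, ps_norm, Complex.norm_real, norm_eq_abs, sq_abs] at eA
  have eO : ‖(1:ℂ) - ((E : ℝ) : ℂ) ^ 2‖ = 1 - E ^ 2 := by
    rw [show (1:ℂ) - ((E : ℝ) : ℂ) ^ 2 = ((1 - E ^ 2 : ℝ) : ℂ) by push_cast; ring, Complex.norm_real, norm_eq_abs, abs_of_pos (by nlinarith)]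
  have eZ : 2 * (FF n 0 ((E : ℝ) : ℂ)).re - 1 = Zf n 1 y := by rw [Zf, one_mul]
  rw [eO, eZ] at eA
  have gB : sinh y = (1 - E ^ 2) * exp y / 2 := by
    have : E * exp y = 1 := by rw [hEd, ← exp_add]; simp
    rw [sinh_eq, ← hEd]; linear_combination E / 2 * this
  have h8 : exp ((2 * N + 1) * y - v * De n y) = (exp y ^ N) ^ 2 * exp y * exp (-(v * De n y)) := by
    rw [← pow_mul, ← exp_nat_mul, ← exp_add, ← exp_add]; congr 1; push_cast; ring
  have h9 : E ^ N * exp y ^ N = 1 := by rw [← mul_pow, hEd, ← exp_add]; simp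
  rw [eH, gB, h8]
  calc _ = a / 4 * exp y * exp (-(v * De n y)) * (exp y ^ N) ^ 2 * ((E ^ N * p.eval x) ^ 2 * (exp (-(v * Zf n 1 y)) * (1 - E ^ 2))) := by
        linear_combination (-(a / 4 * (1 - E ^ 2) * exp y * p.eval x ^ 2 * exp (-(v * Zf n 1 y)) * exp (-(v * De n y)))) * (E ^ N * exp y ^ N + 1) * h9
    _ ≤ a / 4 * exp y * exp (-(v * De n y)) * (exp y ^ N) ^ 2 * (8 * μ) ^ 2 := by gcongr
    _ = _ := by ring

lemma cov_out {a : ℝ} (ha : 0 < a) (G : ℝ → ℝ) : ∫ x in Set.Ioi a, G x = ∫ y in Set.Ioi (0:ℝ), (a / 2 * sinh y) * G (a * cosh (y / 2) ^ 2) := by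
  have hd : ∀ y : ℝ, HasDerivAt (fun y => a * cosh (y / 2) ^ 2) (a / 2 * sinh y) y := by
    intro y
    have := (((hasDerivAt_cosh (y / 2)).comp y ((hasDerivAt_id y).div_const 2)).pow 2).const_mul a
    convert! this using 1
    have := sinh_two_mul (y / 2)
    rw [show 2 * (y / 2) = y by ring] at this
    rw [this]; simp; ring
  have hmono : StrictMonoOn (fun y => a * cosh (y / 2) ^ 2) (Set.Ici 0) := by
    intro x hx y hy hxy
    have : cosh (x / 2) < cosh (y / 2) := cosh_strictMonoOn (Set.mem_Ici.mpr (div_nonneg hx two_pos.le)) (Set.mem_Ici.mpr (div_nonneg hy two_pos.le)) (by linarith)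
    have eC := cosh_pos (x / 2)
    simp only; gcongr
  have him : (fun y => a * cosh (y / 2) ^ 2) '' Set.Ioi 0 = Set.Ioi a := by
    ext x; constructor
    · rintro ⟨y, hy, rfl⟩
      have := hmono (Set.self_mem_Ici) (Set.Ioi_subset_Ici_self hy) hy
      simpa using this
    · intro hx
      have hx : a < x := hx
      have hO : 1 < √(x / a) := by rw [lt_sqrt zero_le_one, one_pow, one_lt_div ha]; exact hx
      refine ⟨2 * arcosh (√(x / a)), ?_, ?_⟩
      · have := arcosh_pos hO; simpa using this
      · simp only
        rw [mul_div_cancel_left₀ _ two_ne_zero, cosh_arcosh hO.le, sq_sqrt (by have := ha.trans hx; positivity)]; field_simp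
  rw [← him, integral_image_eq_integral_abs_deriv_smul measurableSet_Ioi (fun y _ => (hd y).hasDerivWithinAt) ((hmono.mono Set.Ioi_subset_Ici_self).injOn)]
  refine setIntegral_congr_fun measurableSet_Ioi fun y hy => ?_
  have : 0 < sinh y := sinh_pos_iff.mpr hy
  simp only [smul_eq_mul]
  rw [abs_of_pos (by positivity)]

lemma tail {n : ℕ} (hn : 1 ≤ n) {M L a v eB μ : ℝ} (ha : 0 < a) (hav : a ^ bt n = v * eQ n) (hv : v = 2 * M / bt n) (hz : eB ≤ 0) {N : ℕ} {p : ℝ[X]} (hp : p.natDegree ≤ N)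
    (hML : M + L = N) (hL : 1 ≤ L) (hM : 600 * L ^ 3 ≤ M) (hμ : μ = 2 / (a * π))
    (hE : ∀ z : ℂ, ‖z‖ ≤ 1 → ‖EE n v a N p z‖ * ‖1 - eB * z‖ ≤ 8 * μ) :
    ∫ x in Set.Ioi a, p.eval x ^ 2 * exp (-(x ^ bt n)) ≤ μ * (30 / L) := by
  have hb := bt_ge hn
  have gT : 0 ≤ M := le_trans (by positivity) hM
  have hpi := pi_gt_three
  rw [cov_out ha]
  have hint : IntegrableOn (fun y : ℝ => 16 * μ ^ 2 * a * (exp 1 * exp (-L * y))) (Set.Ioi 0) :=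
    ((exp_neg_integrableOn_Ioi 0 (by linarith : 0 < L)).const_mul _).const_mul _
  have hO : ∫ y in Set.Ioi (0:ℝ), (a / 2 * sinh y) * (p.eval (a * cosh (y / 2) ^ 2) ^ 2 * exp (-((a * cosh (y / 2) ^ 2) ^ bt n))) ≤
      ∫ y in Set.Ioi (0:ℝ), 16 * μ ^ 2 * a * (exp 1 * exp (-L * y)) := by
    refine integral_mono_of_nonneg ?_ hint ?_
    · refine (ae_restrict_iff' measurableSet_Ioi).mpr (ae_of_all _ fun y hy => ?_)
      have : 0 < sinh y := sinh_pos_iff.mpr hy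
      simp only [Pi.zero_apply]; positivity
    · refine (ae_restrict_iff' measurableSet_Ioi).mpr (ae_of_all _ fun y hy => ?_)
      have hy : 0 < y := hy
      refine (tail_pt ha hav hz hp hE hy).trans ?_
      show _ ≤ 16 * μ ^ 2 * a * (exp 1 * exp (-L * y))
      rw [← exp_add]
      refine mul_le_mul_of_nonneg_left (exp_le_exp.mpr ?_) (by positivity)
      have hQ := mul_le_mul_of_nonneg_left (De_ge hn hy.le) (show 0 ≤ v by rw [hv]; positivity)
      have eA : v * (bt n * y + bt n ^ 2 / 4 * y ^ 2 * (y / (4 + y))) = 2 * M * y + M * bt n / 2 * (y ^ 2 * (y / (4 + y))) := by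
        rw [hv]; field_simp
        ring
      have eH := exp_arith hL hM (show 1 ≤ bt n by linarith) hy
      rw [← hML]; linarith
  refine hO.trans ?_
  rw [integral_const_mul, integral_const_mul, integral_exp_mul_Ioi (by linarith)]
  have eF := exp_one_lt_d9
  have hμ0 : 0 < μ := by rw [hμ]; positivity
  have eG : μ * a = 2 / π := by rw [hμ]; field_simp
  have eP : 2 / π ≤ 2 / 3.14 := by have := pi_gt_d2; gcongr
  rw [show 16 * μ ^ 2 * a * (exp 1 * (-exp (-L * 0) / -L)) = μ * (16 * (μ * a) * exp 1 / L) by simp; ring, eG]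
  have : 16 * (2 / π) * exp 1 ≤ 30 := by
    calc 16 * (2 / π) * exp 1 ≤ 16 * (2 / 3.14) * 2.7182818286 := by gcongr
      _ ≤ 30 := by norm_num
  gcongr

lemma ortho {b : ℝ} (hb : 0 < b) {P : ℕ → ℝ[X]} (hdeg : ∀ m, (P m).natDegree = m) (hlead : ∀ m, 0 < (P m).leadingCoeff)
    (horth : ∀ l m, ∫ x in Set.Ioi (0:ℝ), (P l).eval x * (P m).eval x * exp (-(x ^ b)) = if l = m then 1 else 0) (N : ℕ) {q : ℝ[X]} (hq : q.natDegree ≤ N) :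
    ∫ x in Set.Ioi (0:ℝ), (P N).eval x * q.eval x * exp (-(x ^ b)) = q.coeff N / (P N).coeff N := by
  have hl : ∀ m, (P m).coeff m ≠ 0 := fun m => by have := hlead m; rw [leadingCoeff, hdeg] at this; exact this.ne'
  have add : ∀ (c : ℝ) (m : ℕ) (u : ℝ[X]), ∫ x in Set.Ioi (0:ℝ), (P N).eval x * (u + C c * P m).eval x * exp (-(x ^ b)) =
      (∫ x in Set.Ioi (0:ℝ), (P N).eval x * u.eval x * exp (-(x ^ b))) + c * if N = m then 1 else 0 := by
    intro c m u
    rw [← horth, ← integral_const_mul, ← integral_add]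
    · congr 1; ext x; simp; ring
    · have := poly_int hb (P N * u); simp only [eval_mul] at this; exact this
    · simpa using (poly_int hb (P N * P m)).const_mul c
  have sub : ∀ (m : ℕ) (q : ℝ[X]), q.degree < ((m + 1 : ℕ) : WithBot ℕ) → (q - C (q.coeff m / (P m).coeff m) * P m).degree < (m : WithBot ℕ) := by
    intro m q h
    rw [degree_lt_iff_coeff_zero] at h ⊢
    intro k hk
    rw [coeff_sub, coeff_C_mul]
    rcases hk.eq_or_lt with rfl | hk
    · rw [div_mul_cancel₀ _ (hl m), sub_self]
    · rw [h k hk, coeff_eq_zero_of_natDegree_lt (p := P m) (n := k) (by rw [hdeg]; exact hk)]; simp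
  have low : ∀ m, m ≤ N → ∀ q : ℝ[X], q.degree < (m : WithBot ℕ) → ∫ x in Set.Ioi (0:ℝ), (P N).eval x * q.eval x * exp (-(x ^ b)) = 0 := by
    intro m
    induction m with
    | zero => intro _ q h; rw [Nat.cast_zero, Nat.WithBot.lt_zero_iff, degree_eq_bot] at h; simp [h]
    | succ m ih =>
      intro hm q h
      have := add (q.coeff m / (P m).coeff m) m (q - C (q.coeff m / (P m).coeff m) * P m)
      rw [sub_add_cancel, ih (by omega) _ (sub m q h), if_neg (by omega)] at this
      simpa using this
  have := add (q.coeff N / (P N).coeff N) N (q - C (q.coeff N / (P N).coeff N) * P N)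
  rw [sub_add_cancel, low N le_rfl _ (sub N q (by
    rw [degree_lt_iff_coeff_zero]; intro k hk; exact coeff_eq_zero_of_natDegree_lt (by omega))), if_pos rfl] at this
  simpa using this

lemma core {n : ℕ} (hn : 1 ≤ n) {P : ℕ → ℝ[X]} (hdeg : ∀ m, (P m).natDegree = m) (hlead : ∀ m, 0 < (P m).leadingCoeff)
    (horth : ∀ l m, ∫ x in Set.Ioi (0:ℝ), (P l).eval x * (P m).eval x * exp (-(x ^ bt n)) = if l = m then 1 else 0)
    {M L a v eB μ r hU κ : ℝ} {N J' : ℕ} {H : ℝ[X]} (ha : 0 < a) (hav : a ^ bt n = v * eQ n) (hv : v = 2 * M / bt n) (hz : eB ≤ 0) (hz' : -1 < eB)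
    (hML : M + L = N) (hL : 1 ≤ L) (hM : 600 * L ^ 3 ≤ M) (hμ : μ = 2 / (a * π))
    (hO : H.natDegree ≤ 2 * N) (hQ : H.coeff 0 = exp (v / 2) * ((1 + hU) / 2) ^ (2 * J') * √((1 + hU) / 2))
    (eA : H.coeff (2 * N) = H.coeff 0 * r ^ (2 * (N - J')))
    (eH : ∀ θ ∈ Set.Icc 0 π, ‖aeval (eI θ) H * (BB n v (eI θ) * ps (eI θ))‖ * ‖1 - eB * eI θ‖ ≤ 4) (hκ : 0 < κ)
    (eO : ∫ θ in (0:ℝ)..π, ‖aeval (eI θ) H * (BB n v (eI θ) * ps (eI θ)) - kk eB (eI θ)‖ ^ 2 ≤ κ ^ 2) (eZ : 30 / L ≤ κ ^ 2) :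
    |(EE n v a N (P N) eB).re - μ * (((1 + hU) / 2) ^ (2 * J') * √((1 + hU) / 2) * (1 + r ^ (2 * (N - J')))) / (EE n v a N (P N) 0).re| ≤ 2 * κ * √μ ∧
      0 < (EE n v a N (P N) 0).re := by
  have hpi := pi_pos
  have hμ0 : 0 < μ := by rw [hμ]; positivity
  have hlc : 0 < (P N).coeff N := by have := hlead N; rwa [leadingCoeff, hdeg] at this
  have hal : (EE n v a N (P N) 0).re = (P N).coeff N * (a / 4) ^ N * exp (-(v / 2)) := by
    unfold EE
    rw [qq_zero, BB_zero, show ps 0 = 1 by simp [ps, sr_one], mul_one, ← Complex.ofReal_mul, Complex.ofReal_re]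
  refine ⟨?_, by rw [hal]; positivity⟩
  have hd := pT_deg μ a N H
  have hPn : ∫ x in Set.Ioi (0:ℝ), (P N).eval x ^ 2 * exp (-(x ^ bt n)) = 1 := by
    have := horth N N; rw [if_pos rfl] at this; simpa only [sq] using this
  have hT := tail hn ha hav hv hz hd hML hL hM hμ (fun z hz => EE_disc hn hμ0 ha hO eH hz)
  have hc := compare hn ha hav (hdeg N).le hPn (eB := eB) (p := pT μ a N H) (by rw [abs_of_nonpos hz]; linarith) (Polynomial.continuous_aeval H)
    (fun θ => by rw [← hμ]; exact pT_circle μ ha hO θ) hκ eO (by rw [← hμ]; exact hT.trans (by gcongr))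
  rw [ortho (bt_pos n) hdeg hlead horth N hd, ← hμ] at hc
  convert hc using 3
  have eC := pT_zero μ ha hO
  rw [eA, hQ] at eC
  have h8 : exp (-(v / 2)) * exp (v / 2) = 1 := by rw [← exp_add]; simp
  rw [hal, div_eq_div_iff (by positivity) hlc.ne', ← mul_right_inj' (exp_pos (v / 2)).ne']
  linear_combination (-(P N).coeff N) * eC - (pT μ a N H).coeff N * (P N).coeff N * (a / 4) ^ N * h8

lemma core_abs {μ E κ eR α : ℝ} (hμ : 0 < μ) (hα : 0 < α) (he : 1 / 4 ≤ eR) (eC : |α - μ * eR / α| ≤ 2 * κ * √μ) (hO : |E - μ * eR / α| ≤ 2 * κ * √μ) :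
    |E / √μ - 1| ≤ 4 * κ + |√eR - 1| := by
  set m := √μ with hm
  have hm0 : 0 < m := sqrt_pos.mpr hμ
  have hμm : μ = m * m := (mul_self_sqrt hμ.le).symm
  set e := √eR with hed
  have he0 : 0 < e := sqrt_pos.mpr (by linarith)
  have hee : eR = e * e := (mul_self_sqrt (by linarith)).symm
  set s := α / m with hs
  have gN : 0 < s := by positivity
  have hαs : α = s * m := by rw [hs]; field_simp
  have key : μ * eR / α = m * (e * e / s) := by rw [hαs, hμm, hee]; field_simp
  rw [key] at eC hO
  have h0' : |s - e * e / s| ≤ 2 * κ := by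
    rw [show α - m * (e * e / s) = m * (s - e * e / s) by rw [hαs]; ring, abs_mul, abs_of_pos hm0] at eC
    nlinarith
  have h1' : |E / m - e * e / s| ≤ 2 * κ := by
    rw [show E - m * (e * e / s) = m * (E / m - e * e / s) by field_simp, abs_mul, abs_of_pos hm0] at hO
    nlinarith
  have hQ : |e * e / s - e| ≤ 2 * κ := by
    rw [show e * e / s - e = (e / s) * (e - s) by field_simp]
    rw [show s - e * e / s = -((e - s) * (e + s) / s) by field_simp; ring, abs_neg, abs_div, abs_mul, abs_of_pos (by positivity : 0 < e + s), abs_of_pos gN] at h0'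
    rw [abs_mul, abs_of_pos (by positivity : 0 < e / s)]
    refine le_trans ?_ h0'
    rw [div_mul_eq_mul_div, div_le_div_iff_of_pos_right gN]
    nlinarith [abs_nonneg (e - s)]
  have gR := abs_add_le (E / m - e * e / s) (e * e / s - e)
  have gS := abs_add_le (E / m - e) (e - 1)
  rw [sub_add_sub_cancel] at gR gS
  linarith

lemma exp_r {η : ℝ} (h : 0 < η) (hO : η ≤ 1) : η / 2 ≤ 1 - exp (-η) ∧ 1 - exp (-η) ≤ η := by
  have hQ := add_one_le_exp η
  have eA := add_one_le_exp (-η)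
  have eH : exp (-η) * exp η = 1 := by rw [← exp_add]; simp
  have eO := exp_pos (-η)
  refine ⟨?_, by linarith⟩
  by_contra hc
  nlinarith

lemma pr_hE0 {X N η r hU δ1 δ w : ℝ} {D : ℕ} (hX : 64 ≤ X) (hD : 72 ≤ D) (hN : N = X ^ D) (hη : 1 ≤ η * N) (gD : 0 < η) (hr : η / 2 ≤ 1 - r) (eM : δ1 ≤ 1 - hU)
    (hd : δ1 = 1 / X) (hδ : δ = 1 / X ^ 2) (hw : w ≤ 1) : (2 * δ / (1 - hU)) ^ (2 * (9 * D)) * exp (9 * log (2 / (1 - r)) + w) ≤ 1 := by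
  have eY : 0 < X := by linarith
  have eN : 0 < 1 - r := by linarith
  have gE : 0 < N := by rw [hN]; positivity
  have hO : 2 * δ / (1 - hU) ≤ 2 / X := by
    have : 2 * δ / (1 - hU) ≤ 2 * δ / δ1 := by
      have : 0 < δ1 := by rw [hd]; positivity
      have : 0 < δ := by rw [hδ]; positivity
      gcongr
    refine this.trans (le_of_eq ?_)
    rw [hd, hδ]; field_simp
  have h1' : 0 ≤ 2 * δ / (1 - hU) := by
    have : 0 < δ1 := by rw [hd]; positivity
    have : 0 < δ := by rw [hδ]; positivity
    have : 0 < 1 - hU := by linarith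
    positivity
  have hQ : 2 / (1 - r) ≤ 4 * N := by
    rw [div_le_iff₀ eN]
    have := mul_le_mul_of_nonneg_left hr gE.le
    nlinarith
  have eA : exp (9 * log (2 / (1 - r)) + w) ≤ (4 * N) ^ 9 * 3 := by
    rw [exp_add]
    have eF : exp (9 * log (2 / (1 - r))) = (2 / (1 - r)) ^ 9 := by
      rw [show (9:ℝ) = ((9:ℕ):ℝ) by norm_num, exp_nat_mul, exp_log (by positivity)]
    rw [eF]
    have eG : exp w ≤ 3 := (exp_le_exp.mpr hw).trans (by linarith [exp_one_lt_d9])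
    gcongr
  calc _ ≤ (2 / X) ^ (2 * (9 * D)) * ((4 * N) ^ 9 * 3) := by gcongr
    _ = (4 / X) ^ (9 * D) * (3 * 4 ^ 9) := by
      have eF : N ^ 9 = X ^ (9 * D) := by rw [hN, ← pow_mul, mul_comm]
      rw [pow_mul (2 / X) 2, mul_pow, eF, show (2 / X) ^ 2 = 4 / X * (1 / X) by ring, mul_pow, one_div, inv_pow]
      field_simp
    _ ≤ (1 / 16) ^ (9 * D) * (3 * 4 ^ 9) := by
      have : 4 / X ≤ 1 / 16 := by rw [div_le_div_iff₀ eY (by norm_num)]; linarith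
      gcongr
    _ ≤ (1 / 16) ^ 9 * (3 * 4 ^ 9) := by
      refine mul_le_mul_of_nonneg_right (pow_le_pow_of_le_one (by norm_num) (by norm_num) (by omega)) (by norm_num)
    _ ≤ 1 := by norm_num

lemma pr_hE1 {X N M K η r δ w A : ℝ} (hX : 1 ≤ X) (gE : 0 < N) (hM : N / 2 ≤ M) (hK : K = X ^ 18) (hη : η = K / N) (hr : η / 2 ≤ 1 - r) (eM : r ≤ 1) (eN : 0 ≤ r)
    (hδ : δ = 1 / X ^ 2) (hw : w ≤ 2 * A / X ^ 14) :
    20 * π / (M * δ ^ 2) * (2 * π / (1 - r ^ 2)) + π / K * (40 / δ ^ 2) * π + w ≤ (200 * π ^ 2 + 2 * A) / X ^ 14 := by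
  have eY : 0 < X := by linarith
  have hpi := pi_pos
  have hK0 : 0 < K := by rw [hK]; positivity
  have gT : 0 < M := by linarith
  have eF : 20 * π / (M * δ ^ 2) ≤ 40 * π * X ^ 4 / N := by
    rw [div_le_div_iff₀ (by rw [hδ]; positivity) gE, hδ]
    calc 20 * π * N ≤ 20 * π * (2 * M) := by gcongr; linarith
      _ = _ := by field_simp; ring
  have eG : 2 * π / (1 - r ^ 2) ≤ 4 * π * N / K := by
    have hO : K / N / 2 ≤ 1 - r ^ 2 := by rw [← hη]; nlinarith
    calc 2 * π / (1 - r ^ 2) ≤ 2 * π / (K / N / 2) := by gcongr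
      _ = _ := by field_simp; ring
  have eP : 20 * π / (M * δ ^ 2) * (2 * π / (1 - r ^ 2)) ≤ 160 * π ^ 2 / X ^ 14 := by
    have hQ : 0 ≤ 2 * π / (1 - r ^ 2) := div_nonneg (by positivity) (by nlinarith)
    calc _ ≤ 40 * π * X ^ 4 / N * (4 * π * N / K) := by gcongr
      _ = _ := by rw [hK]; field_simp; ring
  have gH : π / K * (40 / δ ^ 2) * π = 40 * π ^ 2 / X ^ 14 := by rw [hK, hδ]; field_simp
  rw [gH]
  calc _ ≤ 160 * π ^ 2 / X ^ 14 + 40 * π ^ 2 / X ^ 14 + 2 * A / X ^ 14 := by gcongr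
    _ = _ := by ring

lemma pr_int {X η r hU δ eT ε gL Q : ℝ} (hX : 1 ≤ X) (gD : 0 < η) (hη : X ^ 54 * η ≤ 1) (hr : 1 - r ≤ η) (eM : r ≤ 1) (eN : 0 ≤ r)
    (hr1d : hU = r * (1 - 1 / X)) (hδ : δ = 1 / X ^ 2) (hE : eT = gL / X ^ 14) (hε : 1 ≤ ε * X ^ 25) :
    12 * δ + 54 * Q ^ 2 * (1 - hU) * π + 27 * (1 / ε) ^ 2 * (1 - r * (1 - η)) * π + 12 * eT ^ 2 * (π / ε) ≤
      (12 + 108 * Q ^ 2 * π + 54 * π + 12 * gL ^ 2 * π) / X := by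
  have eY : 0 < X := by linarith
  have hpi := pi_pos
  have hp : ∀ k, 1 ≤ k → 1 / X ^ k ≤ 1 / X := fun k hk => by
    apply one_div_le_one_div_of_le eY
    calc X = X ^ 1 := (pow_one X).symm
      _ ≤ X ^ k := pow_le_pow_right₀ hX hk
  have hε0 : 0 < ε := by by_contra hc; nlinarith [pow_pos eY 25]
  have hεi : 1 / ε ≤ X ^ 25 := by rw [div_le_iff₀ hε0]; linarith
  have hηX : η ≤ 1 / X ^ 54 := by rw [le_div_iff₀ (by positivity)]; linarith
  have eS : δ ≤ 1 / X := hδ ▸ hp 2 (by norm_num)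
  have eV : 1 - hU ≤ 2 / X := by
    rw [hr1d]
    have := hηX.trans (hp 54 (by norm_num))
    have hQ : 0 ≤ (1 - r) * (1 / X) := mul_nonneg (by linarith) (by positivity)
    rw [show 2 / X = 1 / X + 1 / X by ring]
    linarith
  have eW : (1 / ε) ^ 2 * (1 - r * (1 - η)) ≤ 2 / X := by
    have hO : 1 - r * (1 - η) ≤ 2 * (1 / X ^ 54) := by nlinarith
    calc (1 / ε) ^ 2 * (1 - r * (1 - η)) ≤ (X ^ 25) ^ 2 * (2 * (1 / X ^ 54)) := by
          have : 0 ≤ 1 - r * (1 - η) := by nlinarith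
          gcongr
      _ = 2 * (1 / X ^ 4) := by field_simp
      _ ≤ 2 * (1 / X) := by have := hp 4 (by norm_num); gcongr
      _ = 2 / X := by ring
  have a4 : eT ^ 2 * (π / ε) ≤ gL ^ 2 * π / X := by
    calc eT ^ 2 * (π / ε) = eT ^ 2 * (π * (1 / ε)) := by ring
      _ ≤ eT ^ 2 * (π * X ^ 25) := by gcongr
      _ = gL ^ 2 * π * (1 / X ^ 3) := by rw [hE]; field_simp
      _ ≤ gL ^ 2 * π * (1 / X) := by have := hp 3 (by norm_num); gcongr
      _ = _ := by ring
  calc _ = 12 * δ + 54 * Q ^ 2 * (1 - hU) * π + 27 * ((1 / ε) ^ 2 * (1 - r * (1 - η))) * π + 12 * (eT ^ 2 * (π / ε)) := by ring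
    _ ≤ 12 * (1 / X) + 54 * Q ^ 2 * (2 / X) * π + 27 * (2 / X) * π + 12 * (gL ^ 2 * π / X) := by gcongr
    _ = _ := by ring

lemma pr_hb {X N M η r ε : ℝ} (hX : 64 ≤ X) (hN : X ^ 72 ≤ N) (hM : N / 2 ≤ M) (hη : η = X ^ 18 / N) (hη1 : X ^ 54 * η ≤ 1) (hr : 1 - r ≤ η) (eM : r ≤ 1) (eN : 0 < r)
    (hε : 1 ≤ ε * X ^ 25) : -r < ε - 1 ∧ 1 / 2 / η + 1 / (1 + (ε - 1) / r) ≤ M / 8 := by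
  have eY : 0 < X := by linarith
  have gE : 0 < N := lt_of_lt_of_le (by positivity) hN
  have gD : 0 < η := by rw [hη]; positivity
  have hO : 2 * η ≤ ε := by
    have e : X ^ 25 * (2 * η) ≤ X ^ 25 * ε := by
      calc X ^ 25 * (2 * η) ≤ X ^ 54 * η := by
            have : 2 * X ^ 25 ≤ X ^ 54 := by
              calc 2 * X ^ 25 ≤ X ^ 29 * X ^ 25 := by
                    gcongr; linarith [pow_le_pow_right₀ (show 1 ≤ X by linarith) (show 1 ≤ 29 by norm_num)]
                _ = _ := by ring
            nlinarith
        _ ≤ 1 := hη1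
        _ ≤ X ^ 25 * ε := by linarith
    exact le_of_mul_le_mul_left e (by positivity)
  have hQ : ε / 2 ≤ 1 + (ε - 1) / r := by
    have : 1 + (ε - 1) / r = (r + ε - 1) / r := by field_simp; ring
    rw [this, le_div_iff₀ eN]
    nlinarith
  refine ⟨by linarith, ?_⟩
  have hε0 : 0 < ε := by linarith
  have eA : 1 / (1 + (ε - 1) / r) ≤ 2 * X ^ 25 := by
    calc 1 / (1 + (ε - 1) / r) ≤ 1 / (ε / 2) := by gcongr
      _ ≤ 2 * X ^ 25 := by rw [div_le_iff₀ (by positivity)]; linarith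
  have eH : 1 / 2 / η ≤ N / 32 := by
    rw [hη, div_le_iff₀ (by positivity)]
    have : N / 32 * (X ^ 18 / N) = X ^ 18 / 32 := by field_simp
    rw [this]; linarith [pow_le_pow_right₀ (show 1 ≤ X by linarith) (show 1 ≤ 18 by norm_num)]
  have eO : 2 * X ^ 25 ≤ N / 32 := by
    have : 64 * X ^ 25 ≤ X ^ 72 := by
      calc 64 * X ^ 25 ≤ X ^ 47 * X ^ 25 := by
            gcongr; linarith [pow_le_pow_right₀ (show 1 ≤ X by linarith) (show 1 ≤ 47 by norm_num)]
        _ = _ := by ring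
    linarith
  linarith

lemma par_w {X N M K η A b : ℝ} (hX : 1 ≤ X) (hN : X ^ 72 ≤ N) (gT : 0 < M) (hM : M ≤ N) (hK : K = X ^ 18) (hη : η = K / N) (hA : 0 ≤ A) (hb : 1 ≤ b) :
    2 * M / b * η * A ≤ 2 * A * K ∧ 2 * M / b * η ^ 2 * A ≤ 2 * A / X ^ 14 ∧ X ^ 54 * η ≤ 1 := by
  have eY : 0 < X := by linarith
  have gE : 0 < N := by linarith
  have gD : 0 < η := by rw [hη, hK]; positivity
  have hO : 2 * M / b ≤ 2 * N := by
    rw [div_le_iff₀ (by linarith)]; nlinarith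
  have eA : X ^ 54 * η ≤ 1 := by
    rw [hη, hK, mul_div_assoc', ← pow_add, div_le_one gE]; exact hN
  refine ⟨?_, ?_, eA⟩
  · calc 2 * M / b * η * A ≤ 2 * N * η * A := by gcongr
      _ = _ := by rw [hη]; field_simp
  · calc 2 * M / b * η ^ 2 * A ≤ 2 * N * η ^ 2 * A := by gcongr
      _ = 2 * A * K * η := by rw [hη]; field_simp
      _ = 2 * A / X ^ 14 * (X ^ 32 * η) := by rw [hK]; field_simp
      _ ≤ 2 * A / X ^ 14 * 1 := by
        gcongr
        refine le_trans ?_ eA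
        gcongr
        norm_num
      _ = _ := mul_one _

lemma params {n : ℕ} (hn : 1 ≤ n) {P : ℕ → ℝ[X]} (hdeg : ∀ m, (P m).natDegree = m) (hlead : ∀ m, 0 < (P m).leadingCoeff)
    (horth : ∀ l m, ∫ x in Set.Ioi (0:ℝ), (P l).eval x * (P m).eval x * exp (-(x ^ bt n)) = if l = m then 1 else 0)
    {X ε a M L κ r hU : ℝ} {N D : ℕ} (hD : 72 ≤ D) (hN : (N:ℝ) = X ^ D) (hX : 64 ≤ X) (hX1 : 27 * D + 1 ≤ X)
    (hX2 : 1200 * (2 * AA n + 3) ^ 3 ≤ X) (hX3 : 200 * π ^ 2 + 2 * AA n ≤ X) (hε : 1 ≤ ε * X ^ 25) (hε1 : ε ≤ 1) (hL : L = (2 * AA n + 3) * X ^ 18)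
    (hML : M + L = N) (ha : 0 < a) (hav : a ^ bt n = 2 * M / bt n * eQ n) (hκ : 0 < κ)
    (hκ2 : κ ^ 2 = (12 + 108 * ((2 * (9 * D) : ℕ) + 1) ^ 2 * π + 54 * π + 12 * (200 * π ^ 2 + 2 * AA n) ^ 2 * π) / X)
    (hr : r = exp (-(X ^ 18 / N))) (eM : hU = r * (1 - 1 / X)) :
    |(EE n (2 * M / bt n) a N (P N) ((ε - 1 : ℝ):ℂ)).re - 2 / (a * π) * (((1 + hU) / 2) ^ (2 * (9 * D)) * √((1 + hU) / 2) * (1 + r ^ (2 * (N - 9 * D)))) /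
      (EE n (2 * M / bt n) a N (P N) 0).re| ≤ 2 * κ * √(2 / (a * π)) ∧ 0 < (EE n (2 * M / bt n) a N (P N) 0).re := by
  have hA := AA_nonneg n
  have hpi := pi_pos
  have hpi3 := pi_gt_three
  have hpi4 := pi_le_four
  have eY : 0 < X := by linarith
  have hX1' : 1 ≤ X := by linarith
  have kB : X ^ 72 ≤ N := hN ▸ pow_le_pow_right₀ hX1' hD
  have gE : (0:ℝ) < N := lt_of_lt_of_le (by positivity) kB
  have hb := bt_ge hn
  have pm : ∀ {i j : ℕ}, i ≤ j → X ^ i ≤ X ^ j := fun h => pow_le_pow_right₀ hX1' h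
  have hL1 : 1 ≤ L := by
    rw [hL]; have := pm (Nat.zero_le 18); rw [pow_zero] at this; nlinarith only [this, hA]
  have hL3 : 1200 * L ^ 3 ≤ N := by
    calc 1200 * L ^ 3 = 1200 * (2 * AA n + 3) ^ 3 * X ^ 54 := by rw [hL]; ring
      _ ≤ X * X ^ 54 := by gcongr
      _ = X ^ 55 := by ring
      _ ≤ N := (pm (by norm_num)).trans kB
  have hLL : L ≤ L ^ 3 := le_self_pow₀ hL1 (by norm_num)
  have hMh : (N:ℝ) / 2 ≤ M := by linarith
  have gT : 0 < M := by linarith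
  obtain ⟨w1, w2, w3⟩ := par_w hX1' kB gT (by linarith : M ≤ N) rfl rfl hA (by linarith : 1 ≤ bt n)
  set η : ℝ := X ^ 18 / N with hη
  have gD : 0 < η := by positivity
  have hη1 : η ≤ 1 / 2 := by
    have := pm (show 1 ≤ 54 by norm_num); nlinarith only [this, w3, gD, hX]
  obtain ⟨er1, er2⟩ := exp_r gD (by linarith : η ≤ 1)
  rw [← hr] at er1 er2
  have eN : 0 < r := hr ▸ exp_pos _
  have hrl : r ≤ 1 := by linarith
  obtain ⟨eJ, eK⟩ := pr_hb hX kB hMh hη w3 er2 hrl eN hε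
  have hX14 : X / X ^ 14 ≤ 1 := by rw [div_le_one (by positivity)]; simpa using pm (show 1 ≤ 14 by norm_num)
  have hε0 : 0 < ε := by by_contra hc; nlinarith only [pow_pos eY 25, hc, hε]
  have hXi : 1 / X ≤ 1 := by rw [div_le_one eY]; exact hX1'
  have hr1' : 1 / X ≤ 1 - hU := by
    rw [eM]; have : 0 ≤ (1 - r) * (1 - 1 / X) := mul_nonneg (by linarith) (by linarith)
    linarith
  have hDX : (9:ℝ) * D ≤ X := by have : (0:ℝ) ≤ D := D.cast_nonneg; linarith
  obtain ⟨H, gR, gS, t3, t4, t5⟩ := trial hn (K := X ^ 18) (δ := 1 / X ^ 2) (δ1 := 1 / X) (eB := ε - 1) (eT := (200 * π ^ 2 + 2 * AA n) / X ^ 14) (J' := 9 * D)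
    gT gD hη1 hML (by positivity) hXi hr eM (by linarith) eJ (by
      rw [hL]
      have eF : (18 * D + 1 / 2) * X + 9 * D ≤ X ^ 18 := by
        calc (18 * D + 1 / 2) * X + 9 * D ≤ (27 * D + 1) * X := by nlinarith only [hX1', (D.cast_nonneg : (0:ℝ) ≤ D)]
          _ ≤ X * X := by gcongr
          _ = X ^ 2 := by ring
          _ ≤ _ := pm (by norm_num)
      have eG : (((2 * (9 * D) : ℕ):ℝ) + 1 / 2) / (1 / X) = (18 * D + 1 / 2) * X := by push_cast; field_simp; ring
      rw [eG]; push_cast; linarith [pow_pos eY 18]) eK (by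
      have : ((9 * D : ℕ):ℝ) ≤ (N:ℝ) := by
        push_cast; refine hDX.trans (le_trans ?_ kB); simpa using pm (show 1 ≤ 72 by norm_num)
      exact_mod_cast this) (by positivity) (by
      rw [mul_one_div, div_le_one (by positivity)]; nlinarith only [hX]) (by positivity) (by
      rw [div_div, div_le_div_iff₀ (by positivity) (by positivity)]
      have : 2 * π ≤ X ^ 16 := by have := pm (show 1 ≤ 16 by norm_num); rw [pow_one] at this; linarith
      calc π * (X ^ 2 * 2) = 2 * π * X ^ 2 := by ring
        _ ≤ X ^ 16 * X ^ 2 := by gcongr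
        _ = _ := by ring)
    (pr_hE0 hX hD hN (by rw [hη, div_mul_cancel₀ _ gE.ne']; exact one_le_pow₀ hX1') gD er1 hr1' rfl rfl
      (w2.trans (le_trans (by gcongr; nlinarith only [hX3, hpi]) hX14)))
    (pr_hE1 hX1' gE hMh rfl hη er1 hrl eN.le rfl w2) (le_trans (by gcongr) hX14)
  refine core hn hdeg hlead horth ha hav rfl (by linarith) (by linarith) hML hL1 (by linarith) rfl gR gS t3 t4 hκ (t5.trans ?_) ?_
  · have := pr_int (gL := 200 * π ^ 2 + 2 * AA n) (Q := (2 * (9 * D) : ℕ) + 1) hX1' gD w3 er2 hrl eN.le eM rfl rfl hε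
    rw [← hκ2] at this
    rw [show 1 + (ε - 1) = ε by ring]; exact this
  · rw [hκ2]
    have hQ : X ≤ L := by
      rw [hL]; have := pm (show 1 ≤ 18 by norm_num); rw [pow_one] at this; nlinarith only [this, hA, eY]
    have eA : (0:ℝ) ≤ 108 * (((2 * (9 * D) : ℕ):ℝ) + 1) ^ 2 * π := by positivity
    have eH : (0:ℝ) ≤ 12 * (200 * π ^ 2 + 2 * AA n) ^ 2 * π := by positivity
    calc 30 / L ≤ 30 / X := by gcongr
      _ ≤ _ := by gcongr; linarith

noncomputable def Dn (n : ℕ) : ℕ := 24 * (2 * n + 1)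
noncomputable def eD (n N : ℕ) : ℝ := (N:ℝ) ^ ((Dn n : ℝ)⁻¹)
noncomputable def LL (n N : ℕ) : ℝ := (2 * AA n + 3) * eD n N ^ 18
noncomputable def MM (n N : ℕ) : ℝ := N - LL n N

lemma XX1_pow (n N : ℕ) : (N:ℝ) = eD n N ^ Dn n := by
  rw [eD, rpow_inv_natCast_pow N.cast_nonneg (by simp [Dn])]

lemma XX1_tendsto (n : ℕ) : Tendsto (eD n) atTop atTop :=
  (tendsto_rpow_atTop (by simp [Dn]; positivity)).comp tendsto_natCast_atTop_atTop

noncomputable def rr (n N : ℕ) : ℝ := exp (-(eD n N ^ 18 / N))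
noncomputable def rr1 (n N : ℕ) : ℝ := rr n N * (1 - 1 / eD n N)
noncomputable def e00 (n N : ℕ) : ℝ :=
  ((1 + rr1 n N) / 2) ^ (2 * (9 * Dn n)) * √((1 + rr1 n N) / 2) * (1 + rr n N ^ (2 * (N - 9 * Dn n)))

lemma XX1_ratio {n : ℕ} (hn : 1 ≤ n) {k : ℕ} (hk : k < 72) : Tendsto (fun N : ℕ => eD n N ^ k / N) atTop (𝓝 0) := by
  have : Tendsto (fun x : ℝ => x ^ k / x ^ Dn n) atTop (𝓝 0) := tendsto_pow_div_pow_atTop_zero (by unfold Dn; omega)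
  refine (this.comp (XX1_tendsto n)).congr fun N => ?_
  simp only [Function.comp]; rw [← XX1_pow]

lemma rr_tendsto {n : ℕ} (hn : 1 ≤ n) : Tendsto (rr n) atTop (𝓝 1) := by
  have := (XX1_ratio hn (k := 18) (by norm_num)).neg.rexp
  rw [neg_zero, exp_zero] at this; exact this

lemma rr1_tendsto {n : ℕ} (hn : 1 ≤ n) : Tendsto (rr1 n) atTop (𝓝 1) := by
  have h : Tendsto (fun N => 1 / eD n N) atTop (𝓝 0) := (XX1_tendsto n).const_div_atTop 1
  have := (rr_tendsto hn).mul (h.const_sub 1)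
  rw [sub_zero, mul_one] at this; exact this

lemma e00_tendsto {n : ℕ} (hn : 1 ≤ n) : Tendsto (e00 n) atTop (𝓝 1) := by
  have hO : Tendsto (fun N => (1 + rr1 n N) / 2) atTop (𝓝 1) := by
    have := ((rr1_tendsto hn).const_add 1).div_const 2
    norm_num at this; exact this
  have hQ : Tendsto (fun N => rr n N ^ (2 * (N - 9 * Dn n))) atTop (𝓝 0) := by
    have hx : Tendsto (fun N => exp (-eD n N)) atTop (𝓝 0) := tendsto_exp_neg_atTop_nhds_zero.comp (XX1_tendsto n)
    refine squeeze_zero' (Eventually.of_forall fun N => pow_nonneg (exp_pos _).le _) ?_ hx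
    filter_upwards [(XX1_tendsto n).eventually_ge_atTop 1, eventually_ge_atTop (18 * Dn n), eventually_gt_atTop 0] with N hO hQ eA
    rw [rr, ← exp_nat_mul, exp_le_exp]
    have h3' : (0:ℝ) < N := by exact_mod_cast eA
    have eH : (N:ℝ) ≤ ((2 * (N - 9 * Dn n) : ℕ):ℝ) := by exact_mod_cast (by omega)
    have eO : eD n N ≤ eD n N ^ 18 := le_self_pow₀ hO (by norm_num)
    have eZ : (N:ℝ) * (eD n N ^ 18 / N) = eD n N ^ 18 := by field_simp
    have gB := mul_le_mul_of_nonneg_right eH (by positivity : 0 ≤ eD n N ^ 18 / N)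
    linarith
  have := ((hO.pow (2 * (9 * Dn n))).mul hO.sqrt).mul (hQ.const_add 1)
  rw [one_pow, sqrt_one, add_zero, mul_one, mul_one] at this; exact this

lemma EE_lim {n : ℕ} (hn : 1 ≤ n) {P : ℕ → ℝ[X]} (hdeg : ∀ m, (P m).natDegree = m) (hlead : ∀ m, 0 < (P m).leadingCoeff)
    (horth : ∀ l m, ∫ x in Set.Ioi (0:ℝ), (P l).eval x * (P m).eval x * exp (-(x ^ bt n)) = if l = m then 1 else 0)
    {ε a : ℕ → ℝ} (hε : ∀ᶠ N in atTop, 1 ≤ ε N * eD n N ^ 25) (hε1 : ∀ᶠ N in atTop, ε N ≤ 1) (ha : ∀ᶠ N in atTop, 0 < a N)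
    (hav : ∀ᶠ N in atTop, a N ^ bt n = 2 * MM n N / bt n * eQ n) :
    Tendsto (fun N => (EE n (2 * MM n N / bt n) (a N) N (P N) ((ε N - 1 : ℝ):ℂ)).re / √(2 / (a N * π))) atTop (𝓝 1) := by
  set gM : ℝ := 12 + 108 * ((2 * (9 * Dn n) : ℕ) + 1) ^ 2 * π + 54 * π + 12 * (200 * π ^ 2 + 2 * AA n) ^ 2 * π with hC2
  have hC : 0 < gM := by have := pi_pos; positivity
  have hX := XX1_tendsto n
  have hlim : Tendsto (fun N => 4 * √(gM / eD n N) + |√(e00 n N) - 1|) atTop (𝓝 0) := by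
    have hO : Tendsto (fun N => gM / eD n N) atTop (𝓝 0) := hX.const_div_atTop gM
    have := (hO.sqrt.const_mul 4).add ((e00_tendsto hn).sqrt.sub_const 1).abs
    simpa using this
  rw [tendsto_iff_dist_tendsto_zero]
  refine squeeze_zero' (Eventually.of_forall fun N => dist_nonneg) ?_ hlim
  filter_upwards [hε, hε1, ha, hav, hX.eventually_ge_atTop 64, hX.eventually_ge_atTop (27 * (Dn n : ℝ) + 1), hX.eventually_ge_atTop (1200 * (2 * AA n + 3) ^ 3),
    hX.eventually_ge_atTop (200 * π ^ 2 + 2 * AA n), (e00_tendsto hn).eventually_const_le (by norm_num : (1:ℝ) / 4 < 1)] with N g1 gP g3 g4 g5 g6 g7 g8 g9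
  have hD : 72 ≤ Dn n := by unfold Dn; omega
  have eY : 0 < eD n N := by linarith
  have hX25 : 1 ≤ 1 * eD n N ^ 25 := by rw [one_mul]; exact one_le_pow₀ (by linarith)
  have hκ : 0 < √(gM / eD n N) := sqrt_pos.mpr (by positivity)
  have hκ2 : √(gM / eD n N) ^ 2 = gM / eD n N := sq_sqrt (by positivity)
  have gG := params hn hdeg hlead horth (M := MM n N) hD (XX1_pow n N) g5 g6 g7 g8 g1 gP rfl (by rw [MM, LL]; ring) g3 g4 hκ hκ2 rfl rfl
  have k0 := params hn hdeg hlead horth (M := MM n N) hD (XX1_pow n N) g5 g6 g7 g8 hX25 le_rfl rfl (by rw [MM, LL]; ring) g3 g4 hκ hκ2 rfl rfl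
  rw [sub_self, Complex.ofReal_zero] at k0
  rw [dist_eq]
  exact core_abs (by have := pi_pos; positivity) k0.2 g9 k0.1 gG.1

lemma ps_real {x : ℝ} (hO : -1 < x) (hQ : x < 1) : ps (x:ℂ) = (√(1 - x ^ 2) : ℝ) := by
  have e : ∀ {z : ℝ}, 0 ≤ z → sr (z:ℂ) = (√z : ℝ) := fun {z} hz => by
    rw [sr, sqrt_eq_rpow, Complex.ofReal_cpow hz]; norm_num
  have eF := e (z := 1 - x) (by linarith)
  have eG := e (z := 1 + x) (by linarith)
  push_cast at eF eG
  rw [ps, eF, eG, show 1 - x ^ 2 = (1 - x) * (1 + x) by ring, sqrt_mul (by linarith)]; push_cast; ring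

lemma EE_eval {n N : ℕ} {y a v τ : ℝ} {P : ℝ[X]} (hy : 0 < y) (hP : P.natDegree ≤ N) (hτ : a * sinh (y / 2) ^ 2 = τ) :
    (EE n v a N P ((-exp (-y) : ℝ):ℂ)).re =
      (-1) ^ N * exp (-(N * y)) * P.eval (-τ) * (exp (-(v * Zf n (-1) y / 2)) * √(1 - exp (-y) ^ 2)) := by
  have hO : exp (-y) < 1 := exp_lt_one_iff.mpr (by linarith)
  have eC := exp_pos (-y)
  have hF : ((FF n 0 ((-exp (-y) : ℝ):ℂ)).re : ℂ) = FF n 0 ((-exp (-y) : ℝ):ℂ) := by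
    rw [← Complex.conj_eq_iff_re, ← FF_conj, Complex.conj_ofReal]
  have hB : BB n v ((-exp (-y) : ℝ):ℂ) = (exp (-(v * Zf n (-1) y / 2)) : ℝ) := by
    rw [BB, ← hF, Zf, neg_one_mul]; push_cast; congr 1; ring
  have hq : qq a N P ((-exp (-y) : ℝ):ℂ) = ((-1) ^ N * exp (-(N * y)) * P.eval (-τ) : ℝ) := by
    rw [qq_eval hP (by exact_mod_cast (neg_ne_zero.mpr eC.ne'))]
    have eF : (((a / 4 : ℝ):ℂ) * (((-exp (-y) : ℝ):ℂ) + 2 + ((-exp (-y) : ℝ):ℂ)⁻¹)) = ((-τ : ℝ):ℂ) := by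
      rw [← hτ, ← Complex.ofReal_inv]
      norm_cast
      rw [sinh_eq, inv_neg, ← exp_neg, neg_neg, div_pow, sub_sq, ← exp_nat_mul, ← exp_nat_mul, mul_assoc, ← exp_add,
        show ((2:ℕ):ℝ) * (y / 2) = y by push_cast; ring, show ((2:ℕ):ℝ) * -(y / 2) = -y by push_cast; ring, add_neg_cancel, exp_zero]
      push_cast; ring
    rw [eF, show (aeval ((-τ : ℝ):ℂ)) P = ((P.eval (-τ) : ℝ):ℂ) from aeval_algebraMap_apply_eq_algebraMap_eval _ _]
    rw [neg_mul_eq_mul_neg, exp_nat_mul, ← mul_pow]; push_cast; ring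
  rw [EE, hq, hB, ps_real (by linarith) (by linarith), neg_sq]
  norm_cast

lemma one_sub_exp {y : ℝ} : 1 - exp (-y) ^ 2 = 4 * exp (-y) * sinh (y / 2) * cosh (y / 2) := by
  have h := sinh_two_mul (y / 2)
  rw [show 2 * (y / 2) = y by ring, sinh_eq] at h
  have hQ : exp (-y) * exp y = 1 := by rw [← exp_add]; simp
  linear_combination (-1) * hQ + (2 * exp (-y)) * h

lemma eval_form {n N : ℕ} {y a v τ aN Z S E : ℝ} {P : ℝ[X]} (hy : 0 < y) (ha : 0 < a) (haN : 0 < aN) (hτ0 : 0 < τ) (hP : P.natDegree ≤ N)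
    (hτ : a * sinh (y / 2) ^ 2 = τ) (hZ : Zf n (-1) y = Z) (hE : E = (EE n v a N P ((-exp (-y) : ℝ):ℂ)).re / √(2 / (a * π))) :
    P.eval (-τ) / ((-1) ^ N * (√(2 * π))⁻¹ * (τ * aN) ^ (-(1 / 4) : ℝ) * exp S) =
      E * ((aN / a) ^ (1 / 4 : ℝ) * (exp (y / 2) / √(cosh (y / 2)))) * exp (N * y + v * Z / 2 - S) := by
  have hpi := pi_pos
  have hs : 0 < sinh (y / 2) := sinh_pos_iff.mpr (by linarith)
  have hc := cosh_pos (y / 2)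
  have hz : √(1 - exp (-y) ^ 2) = 2 * exp (-(y / 2)) * √(sinh (y / 2)) * √(cosh (y / 2)) := by
    rw [one_sub_exp, sqrt_mul (by positivity), sqrt_mul (by positivity), sqrt_mul (by positivity), show (4:ℝ) = 2 ^ 2 by norm_num,
      sqrt_sq (by norm_num), show exp (-y) = exp (-(y / 2)) ^ 2 by rw [← exp_nat_mul]; congr 1; push_cast; ring,
      sqrt_sq (exp_pos _).le]
  have hm : √(2 / (a * π)) * √(2 * π) * √a = 2 := by
    rw [← sqrt_mul (by positivity), ← sqrt_mul (by positivity), show 2 / (a * π) * (2 * π) * a = 2 ^ 2 by field_simp, sqrt_sq (by norm_num)]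
  have hτ4 : (τ * aN) ^ (-(1 / 4) : ℝ) * ((aN / a) ^ (1 / 4 : ℝ) * (√(sinh (y / 2)) * √a)) = 1 := by
    have eF : √(sinh (y / 2)) = (τ / a) ^ (1 / 4 : ℝ) := by
      rw [← hτ, mul_div_cancel_left₀ _ ha.ne', ← rpow_natCast, ← rpow_mul hs.le, sqrt_eq_rpow]; norm_num
    have eG : √a = (a ^ 2) ^ (1 / 4 : ℝ) := by
      rw [← rpow_natCast, ← rpow_mul ha.le, sqrt_eq_rpow]; norm_num
    rw [eF, eG, ← mul_rpow (by positivity) (by positivity), ← mul_rpow (by positivity) (by positivity), rpow_neg (by positivity),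
      show aN / a * (τ / a * a ^ 2) = τ * aN by field_simp, inv_mul_cancel₀ (by positivity)]
  have hm0 : 0 < √(2 / (a * π)) := sqrt_pos.mpr (by positivity)
  have h2p : 0 < √(2 * π) := sqrt_pos.mpr (by positivity)
  have ha0 : 0 < √a := sqrt_pos.mpr ha
  have gN : 0 < √(sinh (y / 2)) := sqrt_pos.mpr hs
  have hc0 : 0 < √(cosh (y / 2)) := sqrt_pos.mpr hc
  have ht0 : 0 < (τ * aN) ^ (-(1 / 4) : ℝ) := by positivity
  have h1N : ((-1:ℝ) ^ N) * (-1) ^ N = 1 := by rw [← mul_pow]; simp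
  have hn1 : ((-1:ℝ) ^ N) ≠ 0 := by positivity
  rw [hE, EE_eval hy hP hτ, hz, hZ, exp_sub, exp_add, exp_neg (N * y), exp_neg (v * Z / 2), exp_neg (y / 2), div_eq_iff (by positivity)]
  set T := (τ * aN) ^ (-(1 / 4) : ℝ)
  set Q := (aN / a) ^ (1 / 4 : ℝ)
  set eF := exp (N * y)
  set eG := exp (v * Z / 2)
  set eP := exp (y / 2)
  have eA : eF ≠ 0 := (exp_pos _).ne'
  have eH : eG ≠ 0 := (exp_pos _).ne'
  have eO : eP ≠ 0 := (exp_pos _).ne'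
  have eZ : exp S ≠ 0 := (exp_pos _).ne'
  have key : 2 * √(sinh (y / 2)) * Q * T = √(2 / (a * π)) * √(2 * π) := by
    rw [← mul_right_inj' ha0.ne']
    linear_combination 2 * hτ4 - hm
  field_simp
  rw [show ((-1:ℝ) ^ N) ^ 2 = 1 by rw [sq]; exact h1N]
  linear_combination -(P.eval (-τ)) * key

lemma choose_rec (α : ℝ) (j : ℕ) : Ring.choose α (j + 1) * (j + 1) = Ring.choose α j * (α - j) := by
  have h := Ring.choose_add_smul_choose (α - j) 1 j
  rw [sub_add_cancel, Ring.choose_one_right, add_comm 1 j, nsmul_eq_mul] at h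
  rw [← h, Nat.choose_succ_self_right]; push_cast; ring

lemma bin_exp (α : ℝ) (K : ℕ) : ∃ C, ∀ᶠ u : ℝ in 𝓝 0, |(1 + u) ^ α - ∑ j ∈ Finset.range K, Ring.choose α j * u ^ j| ≤ C * |u| ^ K := by
  have h := (one_add_rpow_hasFPowerSeriesAt_zero (a := α)).isBigO_sub_partialSum_pow K
  obtain ⟨C, hC⟩ := h.bound
  refine ⟨C, hC.mono fun u hu => ?_⟩
  simpa [FormalMultilinearSeries.partialSum, binomialSeries, mul_comm] using hu

lemma gam_choose (j : ℕ) : (-1) ^ (j + 1) * gammaCoef j / (2 * √π) = Ring.choose (1 / 2 : ℝ) j := by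
  have hp : √π ≠ 0 := (sqrt_pos.mpr pi_pos).ne'
  induction j with
  | zero =>
    have h := Gamma_add_one (s := -1 / 2) (by norm_num)
    rw [show (-1 / 2 + 1 : ℝ) = 1 / 2 by norm_num, Gamma_one_half_eq] at h
    simp only [gammaCoef, Ring.choose_zero_right]
    norm_num
    rw [show (-(1 / 2) : ℝ) = -1 / 2 by norm_num, show Gamma (-1 / 2) = -2 * √π by linarith]; field_simp
  | succ j ih =>
    have h := choose_rec (1 / 2) j
    rw [← ih] at h
    have hj : (0:ℝ) < j + 1 := by positivity
    rw [← mul_left_inj' hj.ne', h]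
    have eF : gammaCoef ((j + 1 : ℕ):ℤ) * (j + 1) = gammaCoef j * (j - 1 / 2) := by
      simp only [gammaCoef, Int.natCast_nonneg, if_true]
      push_cast
      have hj2 : (j:ℝ) - 1 / 2 ≠ 0 := by
        intro eC
        have : (2 * j : ℝ) = 1 := by linarith
        have : 2 * j = 1 := by exact_mod_cast this
        omega
      rw [show (j:ℝ) + 1 - 1 / 2 = (j - 1 / 2) + 1 by ring, Gamma_add_one hj2, Gamma_add_one hj.ne']
      have := (Gamma_pos_of_pos hj).ne'
      field_simp
    rw [div_mul_eq_mul_div, mul_assoc _ (gammaCoef _), eF]; field_simp; ring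

lemma a_choose (r : ℕ) : (-1) ^ r * aCoef r / (2 * √π) * (2 * r + 1) = Ring.choose (-(1 / 2) : ℝ) r := by
  have hp : √π ≠ 0 := (sqrt_pos.mpr pi_pos).ne'
  induction r with
  | zero =>
    simp only [aCoef, Ring.choose_zero_right]
    norm_num
    rw [Gamma_one_half_eq]; field_simp
  | succ j ih =>
    have h := choose_rec (-(1 / 2)) j
    rw [← ih] at h
    have hj : (0:ℝ) < j + 1 := by positivity
    rw [← mul_left_inj' hj.ne', h]
    have eF : aCoef (j + 1) * (2 * (j + 1 : ℕ) + 1) * (j + 1) = aCoef j * (2 * j + 1) * (j + 1 / 2) := by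
      have hj2 : (0:ℝ) < (j:ℝ) + 1 / 2 := by positivity
      simp only [aCoef]
      push_cast
      rw [show (j:ℝ) + 1 + 1 / 2 = (j + 1 / 2) + 1 by ring, Gamma_add_one hj2.ne', Gamma_add_one hj.ne']
      have := (Gamma_pos_of_pos hj).ne'
      field_simp; ring
    rw [pow_succ]
    linear_combination ((-1) ^ j * -1) / (2 * √π) * eF

lemma lim_of_bound {f : ℝ → ℝ} {C : ℝ} (h : ∀ᶠ u : ℝ in 𝓝[>] 0, |f u| ≤ C * u) : Tendsto f (𝓝[>] 0) (𝓝 0) := by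
  refine squeeze_zero_norm' h ?_
  have : Tendsto (fun u : ℝ => C * u) (𝓝 0) (𝓝 (C * 0)) := tendsto_id.const_mul C
  rw [mul_zero] at this
  exact this.mono_left nhdsWithin_le_nhds

lemma sqrt_lim (s : ℕ) : Tendsto (fun u : ℝ => √(1 + u) / u ^ s - ∑ j ∈ Finset.range (s + 1), (-1) ^ (j + 1) * gammaCoef j / (2 * √π) * u ^ j / u ^ s) (𝓝[>] 0) (𝓝 0) := by
  obtain ⟨C, hC⟩ := bin_exp (1 / 2) (s + 1)
  refine lim_of_bound (C := C) ?_
  filter_upwards [hC.filter_mono nhdsWithin_le_nhds, self_mem_nhdsWithin] with u hu eU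
  have eU : 0 < u := eU
  simp only [gam_choose]
  rw [← Finset.sum_div, ← sub_div, abs_div, abs_of_pos (pow_pos eU s), div_le_iff₀ (pow_pos eU s), sqrt_eq_rpow]
  rw [abs_of_pos eU] at hu
  exact hu.trans (le_of_eq (by ring))

lemma ash_lim (n : ℕ) : Tendsto (fun u : ℝ => arsinh (√u) / (√u * u ^ n) - ∑ r ∈ Finset.range (n + 1), (-1) ^ r * aCoef r / (2 * √π) * u ^ r / u ^ n) (𝓝[>] 0) (𝓝 0) := by
  obtain ⟨C, hC⟩ := bin_exp (-(1 / 2)) (n + 1)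
  refine lim_of_bound (C := C) ?_
  obtain ⟨δ, hδ, hb⟩ := Metric.eventually_nhds_iff.mp hC
  filter_upwards [Ioo_mem_nhdsGT hδ] with u ⟨eU, hu1⟩
  set x := √u with hx
  have gA : 0 < x := sqrt_pos.mpr eU
  have hxu : x ^ 2 = u := sq_sqrt eU.le
  have hd : ∀ z ∈ Set.Icc 0 x, HasDerivWithinAt (fun z : ℝ => arsinh z - ∑ r ∈ Finset.range (n + 1), (-1) ^ r * aCoef r / (2 * √π) * z ^ (2 * r + 1))
      ((1 + z ^ 2) ^ (-(1 / 2) : ℝ) - ∑ r ∈ Finset.range (n + 1), Ring.choose (-(1 / 2) : ℝ) r * (z ^ 2) ^ r) (Set.Icc 0 x) z := by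
    intro z hz
    have eF := hasDerivAt_arsinh z
    rw [sqrt_eq_rpow, ← rpow_neg (by positivity)] at eF
    refine (eF.sub (HasDerivAt.fun_sum fun r _ => ?_)).hasDerivWithinAt
    refine ((hasDerivAt_pow (2 * r + 1) z).const_mul ((-1) ^ r * aCoef r / (2 * √π))).congr_deriv ?_
    rw [← a_choose]; push_cast; rw [pow_mul]; ring
  have hbd : ∀ z ∈ Set.Icc 0 x, ‖(1 + z ^ 2) ^ (-(1 / 2) : ℝ) - ∑ r ∈ Finset.range (n + 1), Ring.choose (-(1 / 2) : ℝ) r * (z ^ 2) ^ r‖ ≤ C * u ^ (n + 1) := by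
    intro z hz
    have hz2 : z ^ 2 ≤ u := by rw [← hxu]; exact pow_le_pow_left₀ hz.1 hz.2 2
    have hC0 : 0 ≤ C := by
      have hO := hb (y := u) (by rw [dist_eq, sub_zero, abs_of_pos eU]; exact hu1)
      have hQ := (abs_nonneg _).trans hO
      exact nonneg_of_mul_nonneg_left hQ (by positivity)
    refine (hb (y := z ^ 2) (by rw [dist_eq, sub_zero, abs_of_nonneg (sq_nonneg z)]; linarith)).trans ?_
    rw [abs_of_nonneg (sq_nonneg z)]; gcongr
  have := (convex_Icc 0 x).norm_image_sub_le_of_norm_hasDerivWithin_le hd hbd (Set.left_mem_Icc.mpr gA.le) (Set.right_mem_Icc.mpr gA.le)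
  simp only [arsinh_zero, sub_zero, norm_eq_abs, abs_of_pos gA] at this
  rw [Finset.sum_eq_zero (f := fun r => (-1) ^ r * aCoef r / (2 * √π) * (0:ℝ) ^ (2 * r + 1)) (fun r _ => by simp), sub_zero, sub_zero] at this
  have e : arsinh x / (x * u ^ n) - ∑ r ∈ Finset.range (n + 1), (-1) ^ r * aCoef r / (2 * √π) * u ^ r / u ^ n =
      (arsinh x - ∑ r ∈ Finset.range (n + 1), (-1) ^ r * aCoef r / (2 * √π) * x ^ (2 * r + 1)) / (x * u ^ n) := by
    rw [sub_div, Finset.sum_div]; congr 1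
    refine Finset.sum_congr rfl fun r _ => ?_
    rw [pow_succ, pow_mul, hxu]; field_simp
  rw [e, abs_div, abs_of_pos (by positivity : 0 < x * u ^ n), div_le_iff₀ (by positivity)]
  exact this.trans (le_of_eq (by ring))

lemma Gam_half (s : ℕ) : Gamma (s + 1 / 2) = √π * WW s * s.factorial := by
  induction s with
  | zero => simp only [Nat.cast_zero, zero_add, Gamma_one_half_eq]; simp [WW]
  | succ s ih =>
    rw [show ((s + 1 : ℕ):ℝ) + 1 / 2 = (s + 1 / 2) + 1 by push_cast; ring, Gamma_add_one (by positivity), ih,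
      show WW (s + 1) = WW s * ((2 * s + 1) / (2 * s + 2)) from Finset.prod_range_succ _ _, Nat.factorial_succ]
    push_cast; field_simp

lemma L_half (s : ℕ) : Lcoef (((s + 1 : ℕ):ℝ) - 1 / 2) = (s + 1) * WW (s + 1) := by
  set x : ℝ := ((s + 1 : ℕ):ℝ) - 1 / 2 with hx
  have gA : 0 < x := by rw [hx]; push_cast; linarith [(s.cast_nonneg : (0:ℝ) ≤ s)]
  have h := Gamma_mul_Gamma_add_half x
  have g1 := Gamma_pos_of_pos gA
  have gP : 0 < Gamma (2 * x) := Gamma_pos_of_pos (by positivity)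
  have hp := sqrt_pos.mpr pi_pos
  have hpp : √π * √π = π := mul_self_sqrt pi_pos.le
  have eF : Gamma (x + 1 / 2) = s.factorial := by
    rw [← Gamma_nat_eq_factorial]; congr 1; rw [hx]; push_cast; ring
  have eG : x * Gamma x = √π * WW (s + 1) * (s + 1).factorial := by
    rw [← Gam_half, ← Gamma_add_one gA.ne']; congr 1; rw [hx]; ring
  have eP : (2:ℝ) ^ (1 - 2 * x) * 4 ^ x = 2 := by
    rw [show (4:ℝ) = 2 ^ (2:ℝ) by norm_num, ← rpow_mul (by norm_num), ← rpow_add (by norm_num), sub_add_cancel, rpow_one]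
  rw [eF] at h
  rw [Nat.factorial_succ] at eG
  push_cast at eG
  have hf : (0:ℝ) < s.factorial := by positivity
  rw [Lcoef, div_eq_iff (by have := pi_pos; positivity), ← mul_left_inj' hf.ne']
  calc x * 4 ^ x * Gamma x ^ 2 * s.factorial = x * Gamma x * 4 ^ x * (Gamma x * s.factorial) := by ring
    _ = √π * √π * (WW (s + 1) * ((s + 1) * s.factorial)) * Gamma (2 * x) * (2 ^ (1 - 2 * x) * 4 ^ x) := by rw [h, eG]; ring
    _ = _ := by rw [eP, hpp]; ring

lemma L_bt (n : ℕ) : Lcoef (bt n) = bt n * WW n := by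
  have := L_half n
  rw [show ((n + 1 : ℕ):ℝ) - 1 / 2 = bt n by rw [bt]; push_cast; ring,
    show WW (n + 1) = WW n * ((2 * n + 1) / (2 * n + 2)) from Finset.prod_range_succ _ _] at this
  rw [this, bt]; field_simp

lemma C_pos (n : ℕ) : 0 < Ccoef (bt n) := by
  have hb := bt_pos n
  have := Gamma_pos_of_pos hb
  have : 0 < Gamma (2 * bt n) := Gamma_pos_of_pos (by positivity)
  unfold Ccoef; positivity

lemma C_pow (n : ℕ) : Ccoef (bt n) ^ bt n = 2 * π * WW n := by
  have hb := bt_pos n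
  have g1 := Gamma_pos_of_pos hb
  have gP : 0 < Gamma (2 * bt n) := Gamma_pos_of_pos (by positivity)
  have h := L_bt n
  rw [Lcoef, div_eq_iff (by have := pi_pos; positivity)] at h
  rw [Ccoef, mul_rpow (by norm_num) (by positivity), ← rpow_mul (by positivity), one_div_mul_cancel hb.ne', rpow_one, mul_div_assoc',
    div_eq_iff gP.ne', ← mul_right_inj' hb.ne']
  linarith

lemma sh_form (m : ℕ) {u : ℝ} (hu : 0 < u) : sh m (arsinh (1 / √u)) =
    √(1 + u) * ∑ s ∈ Finset.Icc 1 m, (-1) ^ (m + s) * (WW m / (2 * s * WW s)) / u ^ s + (-1) ^ m * WW m * arsinh (1 / √u) := by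
  induction m with
  | zero => simp [sh, WW]
  | succ m ih =>
    have gA := sqrt_pos.mpr hu
    have hxu : √u ^ 2 = u := sq_sqrt hu.le
    have eF : (1 / √u) ^ (2 * m + 1) * √(1 + (1 / √u) ^ 2) = √(1 + u) / u ^ (m + 1) := by
      rw [show 1 + (1 / √u) ^ 2 = (1 + u) / √u ^ 2 by rw [hxu, div_pow, hxu]; field_simp; ring, sqrt_div (by positivity), sqrt_sq gA.le, div_pow, one_pow,
        div_mul_div_comm, one_mul, ← pow_succ, show 2 * m + 1 + 1 = 2 * (m + 1) by ring, pow_mul, hxu]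
    have hW : WW (m + 1) = WW m * ((2 * m + 1) / (2 * m + 2)) := Finset.prod_range_succ _ _
    have hW0 := WW_pos m
    have hW1 := WW_pos (m + 1)
    rw [sh, sinh_arsinh, cosh_arsinh, eF, ih, Finset.sum_Icc_succ_top (by omega)]
    have eG : ∑ s ∈ Finset.Icc 1 m, (-1) ^ (m + 1 + s) * (WW (m + 1) / (2 * s * WW s)) / u ^ s =
        -((2 * m + 1) / (2 * m + 2)) * ∑ s ∈ Finset.Icc 1 m, (-1) ^ (m + s) * (WW m / (2 * s * WW s)) / u ^ s := by
      rw [Finset.mul_sum]; refine Finset.sum_congr rfl fun s _ => ?_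
      rw [hW]; ring
    have eP : (-1:ℝ) ^ (m + 1 + (m + 1)) = 1 := by rw [← two_mul, pow_mul]; simp
    have gH : WW (m + 1) / (2 * (m + 1 : ℕ) * WW (m + 1)) = 1 / (2 * m + 2) := by push_cast; field_simp
    rw [eG, eP, gH, hW]
    field_simp; ring

noncomputable def Phi (n : ℕ) (u : ℝ) : ℝ := 2 * (arsinh √u / (√u * u ^ n)) + 2 * sh n (arsinh (1 / √u))
noncomputable def Psi (n : ℕ) (u : ℝ) : ℝ := (-1) ^ n * WW n * log (4 / u) + (√π)⁻¹ * ∑ r ∈ Finset.range (n + 1), (-1) ^ r * BCoef n (bt n) r * (u ^ r / u ^ n)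

lemma log_lim : Tendsto (fun u : ℝ => 2 * arsinh (1 / √u) - log (4 / u)) (𝓝[>] 0) (𝓝 0) := by
  have h : Tendsto (fun u : ℝ => 2 * (log (1 + √(1 + u)) - log 2)) (𝓝 0) (𝓝 (2 * (log (1 + √(1 + 0)) - log 2))) := by
    refine ContinuousAt.tendsto (f := fun u : ℝ => 2 * (log (1 + √(1 + u)) - log 2)) ?_
    have : (1:ℝ) + √(1 + 0) ≠ 0 := by positivity
    fun_prop (disch := assumption)
  rw [add_zero, sqrt_one, show (1:ℝ) + 1 = 2 by norm_num, sub_self, mul_zero] at h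
  refine (h.mono_left nhdsWithin_le_nhds).congr' ?_
  filter_upwards [self_mem_nhdsWithin] with u hu
  have hu : 0 < u := hu
  have gA := sqrt_pos.mpr hu
  have hxu : √u ^ 2 = u := sq_sqrt hu.le
  have hO : 1 / √u + √(1 + (1 / √u) ^ 2) = (1 + √(1 + u)) / √u := by
    rw [show 1 + (1 / √u) ^ 2 = (1 + u) / √u ^ 2 by rw [hxu, div_pow, hxu]; field_simp; ring, sqrt_div (by positivity), sqrt_sq gA.le]; ring
  rw [arsinh, hO, log_div (by positivity) gA.ne', log_div (by norm_num) hu.ne', log_sqrt hu.le, show (4:ℝ) = 2 ^ 2 by norm_num, log_pow]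
  push_cast; ring

lemma sum_shift {n s : ℕ} (hs : s ≤ n) {u : ℝ} (hu : 0 < u) :
    (-1) ^ (n + s) * ∑ j ∈ Finset.range (s + 1), (-1) ^ (j + 1) * gammaCoef j / (2 * √π) * u ^ j / u ^ s =
      -((√π)⁻¹ / 2 * ∑ r ∈ Finset.range (n + 1), (-1) ^ r * gammaCoef ((s:ℤ) - (n - r)) * (u ^ r / u ^ n)) := by
  obtain ⟨k, rfl⟩ := Nat.exists_eq_add_of_le hs
  rw [show s + k + 1 = k + (s + 1) by ring, Finset.sum_range_add (fun r : ℕ => (-1) ^ r * gammaCoef ((s:ℤ) - ((s + k : ℕ) - r)) * (u ^ r / u ^ (s + k))) k, Finset.sum_eq_zero (s := Finset.range k), zero_add, Finset.mul_sum, Finset.mul_sum, ← Finset.sum_neg_distrib]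
  · refine Finset.sum_congr rfl fun j _ => ?_
    have eF : (s:ℤ) - ((s + k : ℕ) - (k + j : ℕ)) = j := by push_cast; ring
    have eG : (-1:ℝ) ^ (s + k + s) = (-1) ^ k := by rw [show s + k + s = 2 * s + k by ring, pow_add, pow_mul]; simp
    rw [eF, eG, pow_add u s k, pow_add u k j, pow_add (-1:ℝ) k j]
    field_simp; ring
  · intro r hr
    have hr := Finset.mem_range.mp hr
    have eF : ¬ (0:ℤ) ≤ (s:ℤ) - ((s + k : ℕ) - r) := by push_cast; omega
    rw [gammaCoef, if_neg eF]; ring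

lemma PhiPsi (n : ℕ) : Tendsto (fun u => Phi n u - Psi n u) (𝓝[>] 0) (𝓝 0) := by
  have h := (((ash_lim n).const_mul 2).add (tendsto_finsetSum (Finset.Icc 1 n) fun s _ => (sqrt_lim s).const_mul ((-1) ^ (n + s) * (WW n / (s * WW s))))).add
    (log_lim.const_mul ((-1) ^ n * WW n))
  simp only [mul_zero, Finset.sum_const_zero, add_zero] at h
  refine h.congr' ?_
  filter_upwards [self_mem_nhdsWithin] with u hu
  have hu : 0 < u := hu
  have hp := sqrt_pos.mpr pi_pos
  have hb := bt_pos n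
  rw [Phi, Psi, sh_form n hu]
  have eF : ∀ r : ℕ, BCoef n (bt n) r = aCoef r - WW n / 2 * ∑ s ∈ Finset.Icc 1 n, gammaCoef ((s:ℤ) - (n - r)) / (s * WW s) := fun r => by
    rw [BCoef, L_bt, show bt n * WW n / (2 * bt n) = WW n / 2 by field_simp, deltaCoef]
    congr 2
    refine Finset.sum_congr rfl fun s hs => ?_
    obtain ⟨k, rfl⟩ := Nat.exists_eq_add_of_le' (Finset.mem_Icc.mp hs).1
    rw [L_half]; push_cast; rfl
  have eG : (√π)⁻¹ * ∑ r ∈ Finset.range (n + 1), (-1) ^ r * BCoef n (bt n) r * (u ^ r / u ^ n) =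
      2 * (∑ r ∈ Finset.range (n + 1), (-1) ^ r * aCoef r / (2 * √π) * u ^ r / u ^ n) +
      ∑ s ∈ Finset.Icc 1 n, (WW n / (s * WW s)) * -((√π)⁻¹ / 2 * ∑ r ∈ Finset.range (n + 1), (-1) ^ r * gammaCoef ((s:ℤ) - (n - r)) * (u ^ r / u ^ n)) := by
    simp only [Finset.mul_sum, ← Finset.sum_neg_distrib]
    rw [Finset.sum_comm, ← Finset.sum_add_distrib]
    refine Finset.sum_congr rfl fun r _ => ?_
    rw [eF, mul_sub, sub_mul, mul_sub, sub_eq_add_neg, Finset.mul_sum, Finset.mul_sum, Finset.sum_mul, Finset.mul_sum, ← Finset.sum_neg_distrib]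
    congr 1
    · field_simp
    · refine Finset.sum_congr rfl fun s _ => ?_
      ring
  have eP : ∑ s ∈ Finset.Icc 1 n, (WW n / (s * WW s)) * -((√π)⁻¹ / 2 * ∑ r ∈ Finset.range (n + 1), (-1) ^ r * gammaCoef ((s:ℤ) - (n - r)) * (u ^ r / u ^ n)) =
      ∑ s ∈ Finset.Icc 1 n, (-1) ^ (n + s) * (WW n / (s * WW s)) * ∑ j ∈ Finset.range (s + 1), (-1) ^ (j + 1) * gammaCoef j / (2 * √π) * u ^ j / u ^ s :=
    Finset.sum_congr rfl fun s hs => by rw [← sum_shift (Finset.mem_Icc.mp hs).2 hu]; ring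
  have gH : 2 * (√(1 + u) * ∑ s ∈ Finset.Icc 1 n, (-1) ^ (n + s) * (WW n / (2 * s * WW s)) / u ^ s) =
      ∑ s ∈ Finset.Icc 1 n, (-1) ^ (n + s) * (WW n / (s * WW s)) * (√(1 + u) / u ^ s) := by
    rw [Finset.mul_sum, Finset.mul_sum]
    refine Finset.sum_congr rfl fun s _ => ?_
    rw [show WW n / (2 * s * WW s) = WW n / (s * WW s) / 2 by rw [div_div]; congr 1; ring]; ring
  rw [eG, eP]
  simp only [mul_sub, Finset.sum_sub_distrib]
  linear_combination -gH

noncomputable def rho (n N : ℕ) : ℝ := (MM n N / N) ^ (1 / bt n)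

lemma X_ratio {n k : ℕ} (hk : k < Dn n) : Tendsto (fun N : ℕ => eD n N ^ k / N) atTop (𝓝 0) := by
  have : Tendsto (fun x : ℝ => x ^ k / x ^ Dn n) atTop (𝓝 0) := tendsto_pow_div_pow_atTop_zero hk
  refine (this.comp (XX1_tendsto n)).congr fun N => ?_
  simp only [Function.comp]; rw [← XX1_pow]

lemma X48 (n N : ℕ) : (N:ℝ) ^ (1 / bt n) = eD n N ^ 48 := by
  rw [eD, ← rpow_natCast, ← rpow_mul N.cast_nonneg]
  congr 1; rw [Dn, bt]; push_cast; field_simp; ring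

lemma X48n (n N : ℕ) : (N:ℝ) ^ (1 - 1 / (2 * bt n)) = (eD n N ^ 48) ^ n := by
  rw [eD, ← rpow_natCast, ← rpow_natCast, ← rpow_mul N.cast_nonneg, ← rpow_mul N.cast_nonneg]
  congr 1; rw [Dn, bt]; push_cast; field_simp; ring

lemma x_lim {n : ℕ} (hn : 1 ≤ n) : Tendsto (fun N : ℕ => MM n N / N) atTop (𝓝 1) := by
  have := ((XX1_ratio hn (k := 18) (by norm_num)).const_mul (2 * AA n + 3)).const_sub 1
  rw [mul_zero, sub_zero] at this
  refine this.congr' ?_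
  filter_upwards [eventually_gt_atTop 0] with N hN
  have : (0:ℝ) < N := by exact_mod_cast hN
  rw [MM, LL]; field_simp

lemma rho_lim {n : ℕ} (hn : 1 ≤ n) : Tendsto (rho n) atTop (𝓝 1) := by
  have := (x_lim hn).rpow_const (p := 1 / bt n) (Or.inl one_ne_zero)
  rw [one_rpow] at this; exact this

lemma rho_facts {n : ℕ} (hn : 1 ≤ n) : ∀ᶠ N : ℕ in atTop, 0 < (N:ℝ) ∧ 1 ≤ eD n N ∧ 0 < MM n N ∧ 0 < rho n N ∧ rho n N ≤ 1 ∧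
    1 - rho n N ≤ (2 * AA n + 3) * (eD n N ^ 18 / N) ∧ (eD n N ^ 48 * rho n N) ^ bt n = MM n N := by
  have hb := bt_ge hn
  have hA := AA_nonneg n
  filter_upwards [eventually_gt_atTop 0, (XX1_tendsto n).eventually_ge_atTop 1, (x_lim hn).eventually_const_lt one_pos] with N eC hO hQ
  have hN : (0:ℝ) < N := by exact_mod_cast eC
  have hM : 0 < MM n N := (div_pos_iff_of_pos_right hN).mp hQ
  have hL : 0 ≤ LL n N := by rw [LL]; positivity
  have hx1 : MM n N / N ≤ 1 := by rw [div_le_one hN, MM]; linarith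
  have e : MM n N / N = 1 - (2 * AA n + 3) * (eD n N ^ 18 / N) := by rw [MM, LL]; field_simp
  refine ⟨hN, hO, hM, rpow_pos_of_pos hQ _, rpow_le_one hQ.le hx1 (by positivity), ?_, ?_⟩
  · have : MM n N / N ≤ rho n N := self_le_rpow_of_le_one hQ.le hx1 (by rw [div_le_one (by linarith)]; linarith)
    linarith
  · rw [← X48, rho, ← mul_rpow hN.le hQ.le, ← rpow_mul (by positivity), one_div_mul_cancel (by linarith), rpow_one]; field_simp

lemma pow_diff {n j : ℕ} (hn : 1 ≤ n) (hj : j ≤ n) : Tendsto (fun N => (eD n N ^ 48) ^ j * (rho n N ^ j - 1)) atTop (𝓝 0) := by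
  have h := (X_ratio (n := n) (k := 48 * j + 18) (by unfold Dn; omega)).const_mul (j * (2 * AA n + 3))
  rw [mul_zero] at h
  refine squeeze_zero_norm' ?_ h
  filter_upwards [rho_facts hn] with N ⟨_, hO, _, eA, eH, eO, _⟩
  have hb := one_add_mul_le_pow (a := rho n N - 1) (by linarith) j
  rw [add_sub_cancel] at hb
  have eZ : rho n N ^ j ≤ 1 := pow_le_one₀ eA.le eH
  rw [norm_eq_abs, abs_mul, abs_of_nonneg (by positivity), abs_of_nonpos (by linarith)]
  have gB : (j:ℝ) * (1 - rho n N) ≤ j * ((2 * AA n + 3) * (eD n N ^ 18 / N)) := mul_le_mul_of_nonneg_left eO j.cast_nonneg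
  calc _ ≤ (eD n N ^ 48) ^ j * (j * ((2 * AA n + 3) * (eD n N ^ 18 / N))) := mul_le_mul_of_nonneg_left (by linarith) (by positivity)
    _ = _ := by rw [pow_add, pow_mul]; ring

lemma Psi_diff {n : ℕ} (hn : 1 ≤ n) {q : ℝ} (hq : 0 < q) :
    Tendsto (fun N => Psi n (q / (eD n N ^ 48 * rho n N)) - Psi n (q / eD n N ^ 48)) atTop (𝓝 0) := by
  have hO : Tendsto (fun N => log (rho n N)) atTop (𝓝 0) := by
    have := (rho_lim hn).log one_ne_zero
    rwa [log_one] at this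
  have hQ : Tendsto (fun N => ∑ r ∈ Finset.range (n + 1), (-1) ^ r * BCoef n (bt n) r * (q⁻¹ ^ (n - r)) * ((eD n N ^ 48) ^ (n - r) * (rho n N ^ (n - r) - 1))) atTop (𝓝 0) := by
    have := tendsto_finsetSum (Finset.range (n + 1)) fun r _ => (pow_diff hn (Nat.sub_le n r)).const_mul ((-1) ^ r * BCoef n (bt n) r * (q⁻¹ ^ (n - r)))
    simpa only [mul_zero, Finset.sum_const_zero] using this
  have h := (hO.const_mul ((-1) ^ n * WW n)).add (hQ.const_mul (√π)⁻¹)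
  rw [mul_zero, mul_zero, add_zero] at h
  refine h.congr' ?_
  filter_upwards [rho_facts hn] with N ⟨_, hO, _, eA, _, _, _⟩
  have hX : 0 < eD n N ^ 48 := by positivity
  have eF : log (4 / (q / (eD n N ^ 48 * rho n N))) = log (4 / (q / eD n N ^ 48)) + log (rho n N) := by
    rw [← log_mul (by positivity) eA.ne']; congr 1; field_simp
  have eG : ∑ r ∈ Finset.range (n + 1), (-1) ^ r * BCoef n (bt n) r * (q⁻¹ ^ (n - r)) * ((eD n N ^ 48) ^ (n - r) * (rho n N ^ (n - r) - 1)) =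
      ∑ r ∈ Finset.range (n + 1), (-1) ^ r * BCoef n (bt n) r * ((q / (eD n N ^ 48 * rho n N)) ^ r / (q / (eD n N ^ 48 * rho n N)) ^ n) -
      ∑ r ∈ Finset.range (n + 1), (-1) ^ r * BCoef n (bt n) r * ((q / eD n N ^ 48) ^ r / (q / eD n N ^ 48) ^ n) := by
    rw [← Finset.sum_sub_distrib]
    refine Finset.sum_congr rfl fun r hr => ?_
    obtain ⟨k, hk⟩ := Nat.exists_eq_add_of_le (Nat.lt_succ_iff.mp (Finset.mem_range.mp hr))
    have hg : ∀ x : ℝ, 0 < x → x ^ r / x ^ n = x⁻¹ ^ k := fun x hx => by rw [hk, pow_add, inv_pow]; field_simp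
    rw [hg _ (by positivity), hg _ (by positivity), show n - r = k by omega, inv_div, inv_div, div_pow, div_pow, mul_pow, inv_pow]
    ring
  rw [eG, Psi, Psi, eF]; ring

lemma S_eq {n N : ℕ} {τ : ℝ} (hτ : 0 < τ) (hX : 0 < eD n N) :
    ((-1:ℝ) ^ n * τ ^ bt n / (2 * π)) * log (4 * Ccoef (bt n) * (N:ℝ) ^ (1 / bt n) / τ) +
    ((N:ℝ) ^ (1 - 1 / (2 * bt n)) / √(π * Ccoef (bt n))) * ∑ r ∈ Finset.range (n + 1), (-1:ℝ) ^ r * BCoef n (bt n) r * τ ^ ((r:ℝ) + 1 / 2) * (Ccoef (bt n) * (N:ℝ) ^ (1 / bt n)) ^ (-(r:ℝ)) =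
    τ ^ bt n / Ccoef (bt n) ^ bt n * Psi n (τ / Ccoef (bt n) / eD n N ^ 48) := by
  have hC := C_pos n
  have hp := pi_pos
  rw [Psi, mul_add, X48, X48n]
  have hW := WW_pos n
  congr 1
  · rw [C_pow, show 4 / (τ / Ccoef (bt n) / eD n N ^ 48) = 4 * Ccoef (bt n) * eD n N ^ 48 / τ by field_simp]
    field_simp
  · rw [← mul_assoc, Finset.mul_sum, Finset.mul_sum]
    refine Finset.sum_congr rfl fun r _ => ?_
    have hs : ∀ (x : ℝ) (m : ℕ), 0 < x → x ^ ((m:ℝ) + 1 / 2) = x ^ m * √x := fun x m hx => by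
      rw [rpow_add hx, rpow_natCast, sqrt_eq_rpow]
    rw [show bt n = (n:ℝ) + 1 / 2 from rfl] at hC ⊢
    set C := Ccoef ((n:ℝ) + 1 / 2)
    set Y := eD n N ^ 48 with hY
    have hY0 : 0 < Y := by positivity
    have hO := sqrt_pos.mpr hC
    have hQ := sqrt_pos.mpr hp
    rw [hs _ _ hτ, hs _ _ hτ, hs _ _ hC, sqrt_mul hp.le, rpow_neg (by positivity), rpow_natCast, div_pow, div_pow, div_pow, div_pow, mul_pow]
    field_simp

lemma final_lim {n : ℕ} (hn : 1 ≤ n) {P : ℕ → ℝ[X]} (hdeg : ∀ m, (P m).natDegree = m) (hlead : ∀ m, 0 < (P m).leadingCoeff)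
    (horth : ∀ l m, ∫ x in Set.Ioi (0:ℝ), (P l).eval x * (P m).eval x * exp (-(x ^ bt n)) = if l = m then 1 else 0) {τ : ℝ} (hτ : 0 < τ) :
    Tendsto (fun N : ℕ => (P N).eval (-τ) / ((-1) ^ N * (√(2 * π))⁻¹ * (τ * (Ccoef (bt n) * eD n N ^ 48)) ^ (-(1 / 4) : ℝ) *
      exp (τ ^ bt n / Ccoef (bt n) ^ bt n * Psi n (τ / Ccoef (bt n) / eD n N ^ 48)))) atTop (𝓝 1) := by
  have hC := C_pos n
  have hb := bt_pos n
  have hA := AA_nonneg n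
  have hCp := C_pow n
  set C := Ccoef (bt n)
  have hX := XX1_tendsto n
  have hF := rho_facts hn
  have hρ := rho_lim hn
  set q : ℝ := τ / C with hq
  have hq0 : 0 < q := by positivity
  obtain ⟨u, hu⟩ : ∃ u : ℕ → ℝ, u = fun N => q / (eD n N ^ 48 * rho n N) := ⟨_, rfl⟩
  obtain ⟨y, hy⟩ : ∃ y : ℕ → ℝ, y = fun N => 2 * arsinh √(u N) := ⟨_, rfl⟩
  have hXp : ∀ k : ℕ, k ≠ 0 → Tendsto (fun N => (eD n N ^ k)⁻¹) atTop (𝓝 0) := fun k hk => ((tendsto_pow_atTop hk).comp hX).inv_tendsto_atTop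
  have eU : ∀ᶠ N in atTop, 0 < u N := by
    filter_upwards [hF] with N ⟨_, hO, _, eA, _⟩
    rw [hu]; positivity
  have hulim : Tendsto u atTop (𝓝 0) := by
    have := ((hXp 48 (by norm_num)).const_mul q).div hρ one_ne_zero
    rw [mul_zero, zero_div] at this
    refine this.congr fun N => ?_
    rw [hu]; simp only [Pi.div_apply]; ring
  have hulim' : Tendsto u atTop (𝓝[>] 0) := tendsto_nhdsWithin_iff.mpr ⟨hulim, eU⟩
  have hylim : Tendsto y atTop (𝓝 0) := by
    have := ((continuous_arsinh.tendsto _).comp hulim.sqrt).const_mul 2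
    rw [sqrt_zero, arsinh_zero, mul_zero] at this
    rw [hy]; exact this
  have hsinh : ∀ N, sinh (y N / 2) = √(u N) := fun N => by rw [hy]; simp only; rw [mul_div_cancel_left₀ _ two_ne_zero, sinh_arsinh]
  have hy0 : ∀ᶠ N in atTop, 0 < y N := by
    filter_upwards [eU] with N h
    have := hsinh N ▸ sqrt_pos.mpr h
    have := sinh_pos_iff.mp this
    linarith
  have hLy : Tendsto (fun N => LL n N * y N) atTop (𝓝 0) := by
    have hO : Tendsto (fun N => 2 * √(((2 * AA n + 3) ^ 2 * q) * (eD n N ^ 12)⁻¹ / rho n N)) atTop (𝓝 0) := by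
      have := ((((hXp 12 (by norm_num)).const_mul ((2 * AA n + 3) ^ 2 * q)).div hρ one_ne_zero).sqrt).const_mul 2
      rw [mul_zero, zero_div, sqrt_zero, mul_zero] at this; exact this
    refine squeeze_zero_norm' ?_ hO
    filter_upwards [hF, hy0, eU] with N ⟨_, hO, _, eA, _⟩ eH eO
    have hL : 0 ≤ LL n N := by rw [LL]; positivity
    have eZ : y N / 2 ≤ √(u N) := by rw [← hsinh]; exact self_le_sinh_iff.mpr (by linarith)
    rw [norm_eq_abs, abs_of_nonneg (by positivity), show ((2 * AA n + 3) ^ 2 * q) * (eD n N ^ 12)⁻¹ / rho n N = LL n N ^ 2 * u N by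
      rw [hu, LL]; field_simp, sqrt_mul (by positivity), sqrt_sq hL]
    have := mul_le_mul_of_nonneg_left eZ hL
    linarith
  have hEE := EE_lim hn hdeg hlead horth (ε := fun N => 1 - exp (-y N)) (a := fun N => C * (eD n N ^ 48 * rho n N)) (by
      have hO : Tendsto (fun N => q * eD n N ^ 2) atTop atTop := ((tendsto_pow_atTop two_ne_zero).comp hX).const_mul_atTop hq0
      have hQ : Tendsto (fun N => exp (-(y N / 2))) atTop (𝓝 1) := by
        have := (hylim.div_const 2).neg.rexp
        rw [zero_div, neg_zero, exp_zero] at this; exact this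
      filter_upwards [hF, eU, hO.eventually_ge_atTop 1, hQ.eventually_const_le (by norm_num : (1:ℝ) / 2 < 1)] with N ⟨_, hO, _, eA, h3', _⟩ eH eO eZ
      have eF : 1 - exp (-y N) = 2 * exp (-(y N / 2)) * √(u N) := by
        rw [← hsinh, sinh_eq, show -y N = -(y N / 2) + -(y N / 2) by ring, exp_add]
        have : exp (-(y N / 2)) * exp (y N / 2) = 1 := by rw [← exp_add]; simp
        linear_combination -this
      have eG : 1 ≤ √(u N) * eD n N ^ 25 := by
        rw [show √(u N) * eD n N ^ 25 = √(u N * (eD n N ^ 25) ^ 2) by rw [sqrt_mul eH.le, sqrt_sq (by positivity)], one_le_sqrt,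
          show u N * (eD n N ^ 25) ^ 2 = q * eD n N ^ 2 / rho n N by rw [hu]; field_simp]
        rw [le_div_iff₀ eA]; linarith
      have eP : √(u N) ≤ 2 * exp (-(y N / 2)) * √(u N) := le_mul_of_one_le_left (sqrt_nonneg _) (by linarith)
      rw [eF]
      exact eG.trans (mul_le_mul_of_nonneg_right eP (by positivity)))
    (Eventually.of_forall fun N => by have := exp_pos (-y N); linarith)
    (by filter_upwards [hF] with N ⟨_, hO, _, eA, _⟩; positivity)
    (by
      filter_upwards [hF] with N ⟨_, hO, _, eA, _, _, gB⟩
      rw [mul_rpow hC.le (by positivity), gB, hCp, y0_eq hn]; field_simp)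
  have hpre : Tendsto (fun N => (rho n N)⁻¹ ^ (1 / 4 : ℝ) * (exp (y N / 2) / √(cosh (y N / 2)))) atTop (𝓝 1) := by
    have hO := (hρ.inv₀ one_ne_zero).rpow_const (p := 1 / 4) (Or.inl (by norm_num))
    have hQ := (hylim.div_const 2).rexp
    have eA := ((continuous_cosh.tendsto _).comp (hylim.div_const 2)).sqrt
    have := hO.mul (hQ.div eA (by simp))
    simpa using this
  set κ : ℝ := τ ^ bt n / C ^ bt n with hκ
  have hexp : Tendsto (fun N => LL n N * y N + κ * (Phi n (u N) - Psi n (u N)) + κ * (Psi n (u N) - Psi n (q / eD n N ^ 48))) atTop (𝓝 0) := by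
    have hQ := Psi_diff hn hq0
    have := (hLy.add (((PhiPsi n).comp hulim').const_mul κ)).add (hQ.const_mul κ)
    simp only [mul_zero, add_zero] at this
    rw [hu] at this ⊢; exact this
  have hall := (hEE.mul hpre).mul hexp.rexp
  rw [exp_zero, mul_one, mul_one] at hall
  refine hall.congr' ?_
  filter_upwards [hF, eU, hy0] with N ⟨eC, hO, hQ, eA, _, _, gB⟩ eH eO
  have gN := sqrt_pos.mpr eH
  have hus : √(u N) ^ 2 = u N := sq_sqrt eH.le
  have huq : C * (eD n N ^ 48 * rho n N) * u N = τ := by rw [hu, hq]; field_simp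
  rw [eval_form (n := n) (v := 2 * MM n N / bt n) (y := y N) (a := C * (eD n N ^ 48 * rho n N)) eO (by positivity) (by positivity) hτ (hdeg N).le
    (by rw [hsinh, hus, huq]) (Zn_eq hn eO) rfl]
  have gG : C * eD n N ^ 48 / (C * (eD n N ^ 48 * rho n N)) = (rho n N)⁻¹ := by field_simp
  have gW : 1 - exp (-y N) - 1 = -exp (-y N) := by ring
  have k3 : κ = MM n N * (√(u N) * u N ^ n) := by
    rw [hκ, ← huq, mul_rpow (by positivity) eH.le, mul_rpow hC.le (by positivity), gB]
    rw [show u N ^ bt n = √(u N) * u N ^ n by rw [bt, rpow_add eH, rpow_natCast, sqrt_eq_rpow]; ring]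
    have := rpow_pos_of_pos hC (bt n)
    field_simp
  have k4 : κ * Phi n (u N) = MM n N * y N + 2 * MM n N / bt n * (2 * bt n * √(u N) ^ (2 * n + 1) * sh n (arsinh (1 / √(u N)))) / 2 := by
    have e : √(u N) ^ (2 * n + 1) = √(u N) * u N ^ n := by rw [pow_succ, pow_mul, hus]; ring
    have ey : y N = 2 * arsinh √(u N) := by rw [hy]
    rw [k3, Phi, ey, e]; field_simp
  have k5 : (N:ℝ) = MM n N + LL n N := by rw [MM]; ring
  rw [gG, gW, hsinh]
  congr 2
  rw [mul_sub, k4]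
  linear_combination -(y N) * k5

/-- Strong asymptotics, for fixed `t < 0`, of the polynomials
orthonormal with respect to `exp(−x^β)` on `[0,∞)`, when `β = n + 1/2`, `n ≥ 1`:
`P_N(t) ≃ (−1)^N (2π)^{−1/2} (−tCN^{1/β})^{−1/4}
  exp(((−1)^n (−t)^β/(2π)) ln(4CN^{1/β}/(−t)))
  exp((N^{1−1/(2β)}/√(πC)) ∑_{r=0}^{n} (−1)^r B_r (−t)^{r+1/2} (CN^{1/β})^{−r})`. -/
theorem strong_asymptotics_halfinteger
    (n : ℕ) (hn : 1 ≤ n) (β : ℝ) (hβ : β = (n : ℝ) + 1/2)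
    (P : ℕ → Polynomial ℝ)
    (hdeg : ∀ m, (P m).natDegree = m)
    (hlead : ∀ m, 0 < (P m).leadingCoeff)
    (horth : ∀ l m, (∫ x in Set.Ioi (0:ℝ),
      (P l).eval x * (P m).eval x * Real.exp (-(x ^ β))) = if l = m then 1 else 0)
    (t : ℝ) (ht : t < 0) :
    Tendsto (fun N : ℕ =>
      (P N).eval t /
        ((-1 : ℝ) ^ N * (Real.sqrt (2 * π))⁻¹ *
          (-t * Ccoef β * (N : ℝ) ^ (1 / β)) ^ (-(1/4) : ℝ) *
          Real.exp (((-1 : ℝ) ^ n * (-t) ^ β / (2 * π)) *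
            Real.log (4 * Ccoef β * (N : ℝ) ^ (1 / β) / (-t))) *
          Real.exp (((N : ℝ) ^ (1 - 1 / (2 * β)) / Real.sqrt (π * Ccoef β)) *
            ∑ r ∈ Finset.range (n + 1),
              (-1 : ℝ) ^ r * BCoef n β r * (-t) ^ ((r : ℝ) + 1/2) *
                (Ccoef β * (N : ℝ) ^ (1 / β)) ^ (-(r : ℝ)))))
      atTop (nhds 1) := by
  have hb : β = bt n := hβ
  subst hb
  refine (final_lim hn hdeg hlead horth (neg_pos.mpr ht)).congr' ?_
  filter_upwards [(XX1_tendsto n).eventually_gt_atTop 0] with N hN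
  rw [← S_eq (neg_pos.mpr ht) hN, Real.exp_add, neg_neg, ← X48]
  simp only [mul_assoc]
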